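/- arXiv:2004.13190 — 2 statements merged into one kernel-verified Lean document; each statement's English description precedes it below -/
import Mathlib

section
/- Let R be a commutative Noetherian ring of prime characteristic p > 0 and let I be an ideal of R of positive height such that for every rational number s' ≥ 1 the weak s'-closure of I equals I* + I_{s'}. Then for every real number s > 1 there exists ε > 0 such that for all real t with s − ε < t < s, the weak t-closure of I equals the weak s-closure of I. -/
open Pointwise


/-- `R°`: the set of elements of `R` not contained in any minimal prime of `R`. -/
def RCirc (R : Type*) [CommRing R] : Set R :=
  {c | ∀ P ∈ minimalPrimes R, c ∉ P}

/-- The `q`-th Frobenius power `I^[q]` of an ideal `I`, generated by `q`-th powers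
of elements of `I`. -/
def frobPow {R : Type*} [CommRing R] (I : Ideal R) (q : ℕ) : Ideal R :=
  Ideal.span ((fun f => f ^ q) '' (I : Set R))

/-- The `(s,q)` mixed power `I^(s,q) = I^⌈sq⌉ + I^[q]`. -/
noncomputable def mixedPow {R : Type*} [CommRing R] (I : Ideal R) (s : ℝ) (q : ℕ) : Ideal R :=
  I ^ ⌈s * (q : ℝ)⌉₊ + frobPow I q

/-- The weak `s`-closure of `I`: elements `x` such that there is `c ∈ R°` with
`c·x^q ∈ I^(s,q)` for all sufficiently large powers `q = p^e` of `p`. -/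
def weakCl {R : Type*} [CommRing R] (p : ℕ) (I : Ideal R) (s : ℝ) : Set R :=
  {x | ∃ c ∈ RCirc R, ∃ N : ℕ, ∀ e : ℕ, N ≤ e → c * x ^ p ^ e ∈ mixedPow I s (p ^ e)}

/-- The tight closure `I*` of `I`. -/
def tightCl {R : Type*} [CommRing R] (p : ℕ) (I : Ideal R) : Set R :=
  {x | ∃ c ∈ RCirc R, ∃ N : ℕ, ∀ e : ℕ, N ≤ e → c * x ^ p ^ e ∈ frobPow I (p ^ e)}

/-- The integral closure of `I`: elements `x` such that there is `c ∈ R°` with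
`c·x^n ∈ I^n` for all sufficiently large `n`. -/
def intCl {R : Type*} [CommRing R] (I : Ideal R) : Set R :=
  {x | ∃ c ∈ RCirc R, ∃ N : ℕ, ∀ n : ℕ, N ≤ n → c * x ^ n ∈ I ^ n}

/-- The `α`-th rational power `I_α` of `I`, for rational `α = a/b ≥ 0`:
elements `x` with `x^b` in the integral closure of `I^a`. -/
noncomputable def ratPow {R : Type*} [CommRing R] (I : Ideal R) (α : ℚ) : Set R :=
  {x | x ^ α.den ∈ intCl (I ^ α.num.toNat)}

/-- `μ(I)`: the minimal number of generators of `I`. -/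
noncomputable def mu {R : Type*} [CommRing R] (I : Ideal R) : ℕ :=
  sInf {m : ℕ | ∃ s : Finset R, s.card = m ∧ Ideal.span (s : Set R) = I}

/-- An ideal has positive height if it is not contained in any minimal prime. -/
def PosHeight {R : Type*} [CommRing R] (I : Ideal R) : Prop :=
  ∀ P ∈ minimalPrimes R, ¬ I ≤ P



theorem chain_stop {A : Type*} [CommRing A] [IsDomain A] [IsNoetherianRing A] [Ring.KrullDimLE 1 A]
    (u : A) (hu : u ≠ 0) : ∃ l : ℕ, ∀ (E : Ideal A) (_ : E ≠ ⊥) (G : ℕ → Ideal A)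
      (_ : Monotone G) (_ : u • E ≤ G 0) (_ : ∀ n, G n ≤ E), ∃ j ≤ l, G (j + 1) ≤ G j := by
  have hfin : ∀ a : A, a ≠ 0 → Module.length A (A ⧸ Ideal.span {a}) ≠ ⊤ := fun a ha =>
    Module.length_ne_top_iff.2 (isFiniteLength_quotient_span_singleton A
      (mem_nonZeroDivisors_of_ne_zero ha))
  refine ⟨(Module.length A (A ⧸ Ideal.span {u})).toNat, ?_⟩
  intro E hE G hG hu0 hGE
  by_contra! hcon
  obtain ⟨e, heE, he0⟩ := Submodule.exists_mem_ne_zero_of_ne_bot hE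
  have hmul := Module.length_eq_add_of_exact (Ideal.mulQuot u E) (Ideal.quotOfMul u E)
    (Ideal.mulQuot_injective E (mem_nonZeroDivisors_of_ne_zero hu))
    (Ideal.quotOfMul_surjective E) (Ideal.exact_mulQuot_quotOfMul E)
  have hle : ∀ I J : Ideal A, I ≤ J → Module.length A (A ⧸ J) ≤ Module.length A (A ⧸ I) :=
    fun I J h => Module.length_le_of_surjective (Submodule.factor h) (Submodule.factor_surjective h)
  have hEfin : Module.length A (A ⧸ E) ≠ ⊤ := by
    have := hle (Ideal.span {e}) E (by simpa [Ideal.span_le] using heE)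
    exact ne_top_of_le_ne_top (hfin e he0) this
  have huE : Module.length A (A ⧸ u • E) ≠ ⊤ := by
    rw [hmul]; exact WithTop.add_ne_top.2 ⟨hEfin, hfin u hu⟩
  have hGfin : ∀ n, Module.length A (A ⧸ G n) ≠ ⊤ := fun n =>
    ne_top_of_le_ne_top huE (hle _ _ (hu0.trans (hG (Nat.zero_le n))))
  have hstep : ∀ I J : Ideal A, I ≤ J → ¬ J ≤ I → Module.length A (A ⧸ I) ≠ ⊤ →
      Module.length A (A ⧸ J) < Module.length A (A ⧸ I) := by
    intro I J h h' hf
    rw [Module.length_quotient, Module.length_quotient]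
    apply Order.coheight_strictAnti (lt_of_le_not_ge h h')
    have := hle I J h
    rw [Module.length_quotient, Module.length_quotient] at this
    rw [Module.length_quotient] at hf
    exact lt_of_le_of_lt this (lt_top_iff_ne_top.2 hf)
  set L := (Module.length A (A ⧸ Ideal.span {u})).toNat with hL
  have hLe : Module.length A (A ⧸ Ideal.span {u}) = L := (ENat.natCast_toNat (hfin u hu)).symm
  have hind : ∀ j ≤ L + 1, Module.length A (A ⧸ G j) + j ≤ Module.length A (A ⧸ G 0) := by
    intro j
    induction j with
    | zero => intro _; simp
    | succ j ih =>
      intro hj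
      have h1 := ih (by omega)
      have h2 := hstep _ _ (hG (Nat.le_succ j)) (hcon j (by omega)) (hGfin j)
      have h3 := Order.add_one_le_of_lt h2
      calc _ = Module.length A (A ⧸ G (j+1)) + 1 + j := by push_cast; ring
        _ ≤ _ := by gcongr
        _ ≤ _ := h1
  have h1 := hind (L+1) le_rfl
  have h2 := hle _ _ hu0
  have h3 := hle _ _ (hGE (L+1))
  rw [hmul, hLe] at h2
  obtain ⟨a, ha⟩ := ENat.ne_top_iff_exists.1 hEfin
  rw [← ha] at h2 h3
  have : (a:ℕ∞) + (L + 1 : ℕ) ≤ a + L := le_trans (by gcongr) (h1.trans h2)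
  norm_cast at this
  omega

theorem exists_val {S K : Type*} [CommRing S] [Field K] [Algebra S K] {f : K}
    (hf : ¬ IsIntegral S f) : ∃ V : ValuationSubring K, (∀ x : K, IsIntegral S x → x ∈ V) ∧ f ∉ V := by
  obtain ⟨V, h1, h2⟩ := Subring.exists_le_valuationSubring_of_isIntegrallyClosedIn
    (R := (integralClosure S K).toSubring) (x := f) hf
  exact ⟨V, fun x hx => h1 hx, h2⟩

theorem gap1 {A K : Type*} [CommRing A] [IsDomain A] [IsNoetherianRing A] [Ring.KrullDimLE 1 A]
    [Field K] [Algebra A K] [IsFractionRing A K] (u : A) (hu : u ≠ 0) :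
    ∃ k : ℕ, 0 < k ∧ ∀ f : K, IsIntegral A (algebraMap A K u * f ^ k) → IsIntegral A f := by
  obtain ⟨l, hl⟩ := chain_stop u hu
  refine ⟨l + 2, by omega, ?_⟩
  intro f hg
  by_contra hf
  obtain ⟨V, hV, hfV⟩ := exists_val hf
  set g := algebraMap A K u * f ^ (l + 2) with hgdef
  set T : Submodule A K := Subalgebra.toSubmodule (Algebra.adjoin A {g}) with hT
  have hf0 : f ≠ 0 := fun h => hfV (h ▸ V.zero_mem)
  have hfinv : f⁻¹ ∈ V := (V.mem_or_inv_mem f).resolve_left hfV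
  let N : ℕ → Submodule A K := fun j => T * Submodule.span A ((fun i => f ^ i) '' Set.Iic j)
  have hTfg : T.FG := hg.fg_adjoin_singleton
  have hNfg : ∀ j, (N j).FG := fun j => hTfg.mul (Submodule.fg_span ((Set.finite_Iic j).image _))
  have hNmono : Monotone N := fun i j h =>
    mul_le_mul' le_rfl (Submodule.span_mono (Set.image_mono (Set.Iic_subset_Iic.2 h)))
  have hTV : ∀ t ∈ T, t ∈ V := fun t ht => hV t (by
    have : Algebra.adjoin A {g} ≤ integralClosure A K := Algebra.adjoin_le (Set.singleton_subset_iff.2 hg)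
    exact this ht)
  have hAV : ∀ a : A, algebraMap A K a ∈ V := fun a => hV _ isIntegral_algebraMap
  have hone : (1:K) ∈ T := Subalgebra.one_mem _
  have hfN : ∀ i j, i ≤ j → f ^ i ∈ N j := fun i j h => by
    rw [← one_mul (f ^ i)]
    exact Submodule.mul_mem_mul hone (Submodule.subset_span ⟨i, h, rfl⟩)
  -- valuations of elements of N j
  have key : ∀ (c : K) (j : ℕ), (∀ i ≤ j, c * f ^ i ∈ V) → ∀ x ∈ N j, c * x ∈ V := by
    intro c j hc x hx
    refine Submodule.mul_induction_on hx ?_ ?_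
    · intro t ht y hy
      have : c * y ∈ V := by
        refine Submodule.span_induction (p := fun y _ => c * y ∈ V) ?_ (by simp) ?_ ?_ hy
        · rintro _ ⟨i, hi, rfl⟩; exact hc i hi
        · intro x y _ _ hx hy; rw [mul_add]; exact V.add_mem _ _ hx hy
        · intro a x _ hx; rw [Algebra.smul_def, mul_left_comm]; exact V.mul_mem _ _ (hAV a) hx
      rw [mul_left_comm]; exact V.mul_mem _ _ (hTV t ht) this
    · intro x y hx hy; rw [mul_add]; exact V.add_mem _ _ hx hy
  have huM : ∀ x ∈ N (l+1), algebraMap A K u * x ∈ V := by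
    apply key
    intro i hi
    have : algebraMap A K u * f ^ i = g * f⁻¹ ^ (l + 2 - i) := by
      obtain ⟨m, hm⟩ := Nat.exists_eq_add_of_le (show i ≤ l + 2 by omega)
      rw [hgdef, hm, Nat.add_sub_cancel_left, pow_add, inv_pow]
      field_simp
    rw [this]
    exact V.mul_mem _ _ (hV _ hg) (V.pow_mem hfinv _)
  obtain ⟨d, hd, hdM⟩ := FractionalIdeal.isFractional_of_fg (S := nonZeroDivisors A) (hNfg (l+1))
  have hd0 : algebraMap A K d ≠ 0 := by
    simpa using nonZeroDivisors.ne_zero hd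
  let φ : A →ₗ[A] K := LinearMap.toSpanSingleton A K (algebraMap A K d)⁻¹
  have hφ : ∀ a, φ a = algebraMap A K a * (algebraMap A K d)⁻¹ := fun a => by
    simp [φ, Algebra.smul_def]
  have hrange : ∀ x ∈ N (l+1), ∃ a, φ a = x := by
    intro x hx
    obtain ⟨a, ha⟩ := hdM x hx
    refine ⟨a, ?_⟩
    rw [hφ, ha, Algebra.smul_def]; field_simp
  let uM : Submodule A K := u • N (l+1)
  let E : Ideal A := (N (l+1)).comap φ
  let G : ℕ → Ideal A := fun j => (N (min j (l+1)) ⊔ uM).comap φ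
  have hfinal := hl E ?_ G ?_ ?_ ?_
  · obtain ⟨j, hj, hjG⟩ := hfinal
    obtain ⟨a, ha⟩ := hrange (f ^ (j+1)) (hfN _ _ (by omega))
    have h1 : a ∈ G (j+1) := by
      rw [Submodule.mem_comap]
      rw [ha]; exact Submodule.mem_sup_left (hfN _ _ (by omega))
    have h2 : φ a ∈ N (min j (l+1)) ⊔ uM := hjG h1
    rw [ha, min_eq_left (by omega)] at h2
    obtain ⟨x, hx, y, hy, hxy⟩ := Submodule.mem_sup.1 h2
    obtain ⟨y', hy', rfl⟩ := hy
    apply hfV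
    have e : f = f⁻¹ ^ j * x + f⁻¹ ^ j * (algebraMap A K u * y') := by
      rw [← mul_add]
      have : x + algebraMap A K u * y' = f ^ (j+1) := by rw [← hxy]; simp [Algebra.smul_def]
      rw [this, pow_succ, inv_pow]; field_simp
    rw [e]
    refine V.add_mem _ _ (key _ j ?_ x hx) (V.mul_mem _ _ (V.pow_mem hfinv _) (huM y' hy'))
    intro i hi
    have : f⁻¹ ^ j * f ^ i = f⁻¹ ^ (j - i) := by
      obtain ⟨m, rfl⟩ := Nat.exists_eq_add_of_le hi
      rw [Nat.add_sub_cancel_left, pow_add, inv_pow, inv_pow]; field_simp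
    rw [this]; exact V.pow_mem hfinv _
  · intro h
    have : d ∈ E := by
      rw [Submodule.mem_comap]
      rw [hφ, mul_inv_cancel₀ hd0]
      simpa using hfN 0 (l+1) (by omega)
    rw [h] at this
    exact nonZeroDivisors.ne_zero hd this
  · intro i j h
    exact Submodule.comap_mono (sup_le_sup_right (hNmono (min_le_min_right _ h)) _)
  · rintro _ ⟨e, he, rfl⟩
    rw [Submodule.mem_comap]
    change φ (u • e) ∈ _
    rw [map_smul]
    exact Submodule.mem_sup_right (Submodule.smul_mem_pointwise_smul _ _ _ he)
  · intro n
    apply Submodule.comap_mono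
    refine sup_le (hNmono (min_le_right _ _)) ?_
    rintro _ ⟨e, he, rfl⟩
    exact Submodule.smul_mem _ _ he

theorem loc_pack {B K : Type*} [CommRing B] [IsDomain B] [Field K]
    [Algebra B K] [IsFractionRing B K] (Q : Ideal B) [Q.IsPrime] :
    ∃ _ : Algebra (Localization.AtPrime Q) K, IsScalarTower B (Localization.AtPrime Q) K ∧
      IsFractionRing (Localization.AtPrime Q) K := by
  let := IsLocalization.localizationAlgebraOfSubmonoidLe (Localization.AtPrime Q) K Q.primeCompl
    (nonZeroDivisors B) Q.primeCompl_le_nonZeroDivisors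
  have : IsScalarTower B (Localization.AtPrime Q) K :=
    IsLocalization.localization_isScalarTower_of_submonoid_le _ _ Q.primeCompl _
      Q.primeCompl_le_nonZeroDivisors
  exact ⟨inferInstance, inferInstance,
    IsFractionRing.isFractionRing_of_isDomain_of_isLocalization Q.primeCompl _ _⟩

theorem gap2 {B K : Type*} [CommRing B] [IsDomain B] [IsNoetherianRing B] [Field K]
    [Algebra B K] [IsFractionRing B K] (Q : Ideal B) [Q.IsPrime] (hQ : Q.height ≤ 1)
    (u : B) (hu : u ≠ 0) :
    ∃ k : ℕ, 0 < k ∧ ∀ f : K, IsIntegral B (algebraMap B K u * f ^ k) →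
      ∃ g, g ∉ Q ∧ IsIntegral B (algebraMap B K g * f) := by
  obtain ⟨_, _, _⟩ := loc_pack (K := K) Q
  have : Ring.KrullDimLE 1 (Localization.AtPrime Q) := by
    rw [Ring.krullDimLE_iff, IsLocalization.AtPrime.ringKrullDim_eq_height Q]
    exact_mod_cast hQ
  obtain ⟨k, hk, h⟩ := gap1 (K := K) (algebraMap B (Localization.AtPrime Q) u) (by
    intro h0
    apply hu
    exact (IsLocalization.injective (Localization.AtPrime Q) Q.primeCompl_le_nonZeroDivisors)
      (by rw [h0, map_zero]))
  refine ⟨k, hk, fun f hf => ?_⟩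
  have := h f (by
    rw [← IsScalarTower.algebraMap_apply]
    exact hf.tower_top)
  obtain ⟨m, hm⟩ := this.exists_multiple_integral_of_isLocalization Q.primeCompl
  refine ⟨m, m.2, ?_⟩
  rwa [← Algebra.smul_def]

theorem lemD {B K : Type*} [CommRing B] [Field K]
    [Algebra B K] (hinj : Function.Injective (algebraMap B K)) (Q : Ideal B) [Q.IsPrime]
    (y g : B) (hy : y ∈ Q) (w : K) (hw : IsIntegral B w)
    (hg : algebraMap B K g = w * algebraMap B K y) : g ∈ Q := by
  obtain ⟨Q', -, hp, hc⟩ := Ideal.exists_ideal_over_prime_of_isIntegral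
    (S := integralClosure B K) Q ⊥ (by
      intro x hx
      have hx : algebraMap B (integralClosure B K) x = 0 := hx
      have h2 : algebraMap B K x = 0 := by
        rw [IsScalarTower.algebraMap_apply B (integralClosure B K) K, hx, map_zero]
      rw [(injective_iff_map_eq_zero _).1 hinj x h2]
      exact Q.zero_mem)
  rw [← hc, Ideal.mem_comap] at hy ⊢
  have : algebraMap B (integralClosure B K) g = ⟨w, hw⟩ * algebraMap B (integralClosure B K) y := by
    apply Subtype.ext
    exact hg
  rw [this]
  exact Q'.mul_mem_left _ hy

theorem adjoin_sub {S K : Type*} [CommRing S] [Field K] [Algebra S K] (V : ValuationSubring K)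
    (hV : ∀ a : S, algebraMap S K a ∈ V) {y : K} (hy : y ∈ V) :
    ∀ x ∈ Algebra.adjoin S {y}, x ∈ V := by
  intro x hx
  induction hx using Algebra.adjoin_induction with
  | mem x hx => rw [Set.mem_singleton_iff.1 hx]; exact hy
  | algebraMap r => exact hV r
  | add x y _ _ hx hy => exact V.add_mem _ _ hx hy
  | mul x y _ _ hx hy => exact V.mul_mem _ _ hx hy

theorem gap3 {S K : Type*} [CommRing S] [IsDomain S] [IsNoetherianRing S] [Field K]
    [Algebra S K] [IsFractionRing S K] (y : K) (hy : ¬ IsIntegral S y⁻¹) :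
    ∃ Q : Ideal (Algebra.adjoin S {y}), Q.IsPrime ∧
      (⟨y, Algebra.self_mem_adjoin_singleton S y⟩ : Algebra.adjoin S {y}) ∈ Q ∧
      ∀ u : S, u ≠ 0 → ∃ k : ℕ, 0 < k ∧ ∀ f : K, IsIntegral S (algebraMap S K u * f ^ k) →
        ∃ g : Algebra.adjoin S {y}, g ∉ Q ∧ IsIntegral (Algebra.adjoin S {y}) ((g : K) * f) := by
  have hy0 : y ≠ 0 := by
    rintro rfl; apply hy; rw [inv_zero]; exact isIntegral_zero
  set B := Algebra.adjoin S {y} with hB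
  have hN : IsNoetherianRing B := isNoetherianRing_of_fg ⟨{y}, by simp [hB]⟩
  have hF : IsFractionRing B K := by
    refine IsFractionRing.of_field B K fun z => ?_
    obtain ⟨a, b, hb, rfl⟩ := IsFractionRing.div_surjective (A := S) z
    exact ⟨algebraMap S B a, algebraMap S B b, rfl⟩
  let y' : B := ⟨y, Algebra.self_mem_adjoin_singleton S y⟩
  have hnu : ¬ IsUnit y' := by
    intro h
    obtain ⟨v, hv⟩ := h.exists_right_inv
    have hv' : (v : K) = y⁻¹ := by
      apply eq_inv_of_mul_eq_one_right
      exact congrArg Subtype.val hv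
    apply hy
    have hmem : y⁻¹ ∈ Algebra.adjoin S {y} := hv' ▸ v.2
    by_contra hni
    obtain ⟨V, hV, hyV⟩ := exists_val hni
    exact hyV (adjoin_sub V (fun a => hV _ isIntegral_algebraMap)
      ((V.mem_or_inv_mem y).resolve_right hyV) _ hmem)
  have hne : Ideal.span {y'} ≠ ⊤ := by rwa [Ne, Ideal.span_singleton_eq_top]
  obtain ⟨M, hM, hMle⟩ := Ideal.exists_le_maximal _ hne
  have := hM.isPrime
  obtain ⟨Q, hQ, -⟩ := Ideal.exists_minimalPrimes_le hMle
  have hQp : Q.IsPrime := hQ.1.1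
  refine ⟨Q, hQp, hQ.1.2 (Ideal.mem_span_singleton_self _), fun u hu => ?_⟩
  obtain ⟨k, hk, h⟩ := gap2 (K := K) Q
    (Ideal.height_le_one_of_isPrincipal_of_mem_minimalPrimes _ Q hQ) (algebraMap S B u) (by
      intro h0
      apply hu
      apply IsFractionRing.injective S K
      rw [map_zero, IsScalarTower.algebraMap_apply S B K, h0, map_zero])
  refine ⟨k, hk, fun f hf => ?_⟩
  exact h f (by
    rw [← IsScalarTower.algebraMap_apply]
    exact hf.tower_top)

theorem int_slope {S K : Type*} [CommRing S] [Field K] [Algebra S K] {u z : K}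
    (hu : IsIntegral S u) (hu0 : u ≠ 0) {b0 b : ℕ} {a0 a : ℤ} (hb0 : 0 < b0)
    (h : IsIntegral S (z ^ b0 * u ^ (-a0))) (hle : a * b0 ≤ a0 * b) :
    IsIntegral S (z ^ b * u ^ (-a)) := by
  apply IsIntegral.of_pow hb0
  obtain ⟨m, hm⟩ := Int.eq_ofNat_of_zero_le (sub_nonneg.2 hle)
  have : (z ^ b * u ^ (-a)) ^ b0 = (z ^ b0 * u ^ (-a0)) ^ b * u ^ m := by
    rw [mul_pow, mul_pow, ← zpow_natCast u m, ← hm, ← pow_mul, ← pow_mul, mul_comm b b0,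
      mul_assoc, ← zpow_natCast (u ^ (-a)), ← zpow_natCast (u ^ (-a0)), ← zpow_mul, ← zpow_mul,
      ← zpow_add₀ hu0]
    congr 2
    ring
  rw [this]
  exact (h.pow _).mul (hu.pow _)

/-- order of `z` with respect to `u` is at least `α` -/
def OG (S : Type*) {K : Type*} [CommRing S] [Field K] [Algebra S K] (u : K) (α : ℝ) (z : K) : Prop :=
  ∃ b : ℕ, ∃ a : ℤ, 0 < b ∧ α * b ≤ a ∧ IsIntegral S (z ^ b * u ^ (-a))

section OG
variable {S K : Type*} [CommRing S] [Field K] [Algebra S K] {u : K} {α β : ℝ} {x y z : K}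

theorem OG.anti (h : OG S u α z) (hle : β ≤ α) : OG S u β z := by
  obtain ⟨b, a, hb, hab, hi⟩ := h
  exact ⟨b, a, hb, le_trans (by gcongr) hab, hi⟩

theorem OG.integral (hu : IsIntegral S u) (hu0 : u ≠ 0) (h : OG S u α z) {b : ℕ} {a : ℤ}
    (hab : (a : ℝ) ≤ α * b) : IsIntegral S (z ^ b * u ^ (-a)) := by
  obtain ⟨b0, a0, hb0, hab0, hi⟩ := h
  refine int_slope hu hu0 hb0 hi ?_
  have : (a : ℝ) * b0 ≤ a0 * b := by
    calc (a : ℝ) * b0 ≤ α * b * b0 := by gcongr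
      _ = α * b0 * b := by ring
      _ ≤ a0 * b := by gcongr
  exact_mod_cast this

theorem OG.of_integral (hz : IsIntegral S z) : OG S u 0 z :=
  ⟨1, 0, one_pos, by simp, by simpa using hz⟩

theorem OG.mul (hx : OG S u α x) (hy : OG S u β y) (hu0 : u ≠ 0) :
    OG S u (α + β) (x * y) := by
  obtain ⟨b1, a1, hb1, hab1, hi1⟩ := hx
  obtain ⟨b2, a2, hb2, hab2, hi2⟩ := hy
  refine ⟨b1 * b2, a1 * b2 + a2 * b1, Nat.mul_pos hb1 hb2, ?_, ?_⟩
  · push_cast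
    calc (α + β) * (b1 * b2) = (α * b1) * b2 + (β * b2) * b1 := by ring
      _ ≤ _ := by gcongr
  · have : (x * y) ^ (b1 * b2) * u ^ (-(a1 * b2 + a2 * b1)) =
        (x ^ b1 * u ^ (-a1)) ^ b2 * (y ^ b2 * u ^ (-a2)) ^ b1 := by
      rw [mul_pow, mul_pow, mul_pow, ← zpow_natCast (u ^ (-a1)), ← zpow_natCast (u ^ (-a2)),
        ← zpow_mul, ← zpow_mul, ← pow_mul, ← pow_mul, neg_add, zpow_add₀ hu0, mul_comm b2 b1,
        ← neg_mul, ← neg_mul]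
      ring
    rw [this]
    exact (hi1.pow _).mul (hi2.pow _)

theorem OG.pow (hx : OG S u α x) (n : ℕ) (hu0 : u ≠ 0) : OG S u (n * α) (x ^ n) := by
  induction n with
  | zero => simpa using OG.of_integral isIntegral_one
  | succ n ih =>
    rw [pow_succ]
    have := ih.mul hx hu0
    convert this using 1
    push_cast; ring

theorem OG.add (hu : IsIntegral S u) (hx : OG S u α x) (hy : OG S u α y) (hu0 : u ≠ 0) :
    OG S u α (x + y) := by
  have main : ∀ (b : ℕ) (a : ℤ), 0 < b → α * b ≤ a → IsIntegral S (x ^ b * u ^ (-a)) →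
      IsIntegral S (y ^ b * u ^ (-a)) → OG S u α (x + y) := by
    intro b a hb hab h1 h2
    refine ⟨b, a, hb, hab, ?_⟩
    rw [add_pow, Finset.sum_mul]
    refine IsIntegral.sum _ fun i hi => ?_
    have hib : i ≤ b := by simpa [Nat.lt_succ_iff] using hi
    have key : IsIntegral S (x ^ i * y ^ (b - i) * u ^ (-a)) := by
      apply IsIntegral.of_pow hb
      have : (x ^ i * y ^ (b - i) * u ^ (-a)) ^ b =
          (x ^ b * u ^ (-a)) ^ i * (y ^ b * u ^ (-a)) ^ (b - i) := by
        obtain ⟨m, rfl⟩ := Nat.exists_eq_add_of_le hib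
        rw [Nat.add_sub_cancel_left]
        generalize u ^ (-a) = v
        ring
      rw [this]
      exact (h1.pow _).mul (h2.pow _)
    rw [mul_right_comm]
    exact key.mul (isIntegral_natCast _)
  obtain ⟨b1, a1, hb1, hab1, hi1⟩ := hx
  obtain ⟨b2, a2, hb2, hab2, hi2⟩ := hy
  rcases le_total (a1 * b2) (a2 * b1) with h | h
  · exact main b1 a1 hb1 hab1 hi1 (int_slope hu hu0 hb2 hi2 h)
  · exact main b2 a2 hb2 hab2 (int_slope hu hu0 hb1 hi1 h) hi2
end OG

theorem val_int_mem {S K : Type*} [CommRing S] [Field K] [Algebra S K] (V : ValuationSubring K)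
    (B : Subalgebra S K) (hB : ∀ x ∈ B, x ∈ V) (w : K) (hw : IsIntegral B w) : w ∈ V := by
  let i : B →+* V := (Subring.inclusion (S := B.toSubring) (T := V.toSubring) hB)
  let _ : Algebra B V := i.toAlgebra
  have : IsScalarTower B V K := IsScalarTower.of_algebraMap_eq fun _ => rfl
  have h : IsIntegral V w := hw.tower_top
  obtain ⟨v, hv⟩ := IsIntegrallyClosed.isIntegral_iff.1 h
  rw [← hv]
  exact v.2

theorem dirichlet_one_sided (s : ℝ) (hs : Irrational s) (δ : ℝ) (hδ : 0 < δ) :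
    ∃ b : ℕ, ∃ a : ℤ, 0 < b ∧ 0 < a - s * b ∧ a - s * b < δ := by
  have hne : ∀ (b : ℕ) (a : ℤ), 0 < b → (a : ℝ) - s * b ≠ 0 := by
    intro b a hb h
    have hb' : (b : ℝ) ≠ 0 := by positivity
    apply hs
    refine ⟨(a : ℚ) / b, ?_⟩
    push_cast
    field_simp
    linarith
  obtain ⟨n, hn⟩ := exists_nat_one_div_lt (lt_min hδ (one_pos (α := ℝ)))
  obtain ⟨j, k, hk, -, hjk⟩ := Real.exists_int_int_abs_mul_sub_le s (Nat.succ_pos n)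
  obtain ⟨b, rfl⟩ := Int.eq_ofNat_of_zero_le hk.le
  have hb : 0 < b := by exact_mod_cast hk
  have hsmall : |((b : ℕ) : ℝ) * s - j| < min δ 1 := by
    have : |(((b : ℕ) : ℤ) : ℝ) * s - j| = |((b : ℕ) : ℝ) * s - j| := by norm_cast
    rw [← this]
    refine lt_of_le_of_lt hjk (lt_of_le_of_lt ?_ hn)
    push_cast
    gcongr
    linarith
  obtain ⟨h1, h2⟩ := lt_min_iff.1 hsmall
  rcases lt_or_gt_of_ne (hne b j hb) with h | h
  · set η := b * s - j with hη
    have hη0 : 0 < η := by linarith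
    rw [abs_of_pos hη0] at h1 h2
    have hN : 1 ≤ ⌊1 / η⌋₊ := by
      rw [Nat.one_le_floor_iff, le_div_iff₀ hη0]; linarith
    set N := ⌊1 / η⌋₊ with hNdef
    have hN1 : (N : ℝ) * η ≤ 1 := by
      have := Nat.floor_le (show 0 ≤ 1 / η by positivity)
      rwa [le_div_iff₀ hη0] at this
    have hN2 : 1 < (N + 1 : ℝ) * η := by
      have := Nat.lt_floor_add_one (1 / η)
      rwa [div_lt_iff₀ hη0] at this
    refine ⟨N * b, N * j + 1, Nat.mul_pos hN hb, ?_, ?_⟩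
    · refine lt_of_le_of_ne ?_ (hne _ _ (Nat.mul_pos hN hb)).symm
      push_cast
      nlinarith
    · push_cast
      nlinarith
  · refine ⟨b, j, hb, h, ?_⟩
    have := abs_lt.1 h1
    linarith

/-- the ideal of elements of order at least `α` -/
def lamI {S K : Type*} [CommRing S] [Field K] [Algebra S K] (u : K) (hu : IsIntegral S u)
    (hu0 : u ≠ 0) (α : ℝ) : Ideal S where
  carrier := {z | OG S u α (algebraMap S K z)}
  zero_mem' := ⟨1, ⌈α⌉, one_pos, by simpa using Int.le_ceil α, by simpa using isIntegral_zero⟩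
  add_mem' := by
    intro x y hx hy
    show OG S u α _
    rw [map_add]
    exact OG.add hu hx hy hu0
  smul_mem' := by
    intro c x hx
    show OG S u α _
    rw [smul_eq_mul, map_mul]
    have := (OG.of_integral (S := S) (u := u) (isIntegral_algebraMap (x := c))).mul hx hu0
    rwa [zero_add] at this

theorem mem_lamI {S K : Type*} [CommRing S] [Field K] [Algebra S K] {u : K} {hu : IsIntegral S u}
    {hu0 : u ≠ 0} {α : ℝ} {z : S} : z ∈ lamI u hu hu0 α ↔ OG S u α (algebraMap S K z) := Iff.rfl

theorem og_up {S K : Type*} [CommRing S] [IsNoetherianRing S] [Field K] [Algebra S K] (u : K)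
    (hu : IsIntegral S u) (hu0 : u ≠ 0) (s : ℝ) (hs : Irrational s) :
    ∃ β, s < β ∧ ∀ z : S, OG S u s (algebraMap S K z) → OG S u β (algebraMap S K z) := by
  let F : ℕ →o Ideal S := ⟨fun n => lamI u hu hu0 (s + 1 / ((n : ℝ) + 1)), by
    intro m n h z hz
    refine OG.anti hz ?_
    gcongr⟩
  obtain ⟨n, hn⟩ := monotone_stabilizes_iff_noetherian.2 (inferInstance : IsNoetherian S S) F
  refine ⟨s + 1 / ((n : ℝ) + 1), by linarith [show (0:ℝ) < 1 / ((n : ℝ) + 1) by positivity], ?_⟩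
  rintro z ⟨b, a, hb, hab, hi⟩
  have hb' : (0 : ℝ) < b := by exact_mod_cast hb
  have hlt : s < a / b := by
    rw [lt_div_iff₀ hb']
    refine lt_of_le_of_ne hab ?_
    intro h
    apply hs
    refine ⟨(a : ℚ) / b, ?_⟩
    push_cast
    field_simp
    linarith
  obtain ⟨m, hm⟩ := exists_nat_one_div_lt (sub_pos.2 hlt)
  have hz : OG S u (s + 1 / ((max m n : ℕ) + 1 : ℝ)) (algebraMap S K z) := by
    refine ⟨b, a, hb, ?_, hi⟩
    rw [← le_div_iff₀ hb']
    have : 1 / ((max m n : ℕ) + 1 : ℝ) ≤ 1 / ((m : ℝ) + 1) := by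
      gcongr
      exact le_max_left _ _
    linarith
  have h2 := hn (max m n) (le_max_right _ _)
  have h3 : z ∈ F (max m n) := hz
  rw [← h2] at h3
  exact h3

theorem thmB_rat {S K : Type*} [CommRing S] [IsDomain S] [IsNoetherianRing S] [Field K]
    [Algebra S K] [IsFractionRing S K] (u : S) (hu : u ≠ 0) (s : ℝ) (a : ℤ) (b : ℕ) (hb : 0 < b)
    (hs : s * b = a) (z : K)
    (hz : ∀ α < s, OG S (algebraMap S K u) α z) : OG S (algebraMap S K u) s z := by
  set v := algebraMap S K u with hv
  have hv0 : v ≠ 0 := by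
    intro h; apply hu; apply IsFractionRing.injective S K; rw [map_zero]; exact h
  have hvi : IsIntegral S v := isIntegral_algebraMap
  refine ⟨b, a, hb, hs.le, ?_⟩
  by_contra hx
  set x := z ^ b * v ^ (-a) with hxdef
  obtain ⟨Q, hQ, hyQ, hgap⟩ := gap3 x⁻¹ (by rwa [inv_inv])
  obtain ⟨k, hk, h⟩ := hgap u hu
  have hb' : (0 : ℝ) < b := by exact_mod_cast hb
  have hk' : (0 : ℝ) < k := by exact_mod_cast hk
  have hα : ((a * k - 1 : ℤ) : ℝ) / ((b * k : ℕ) : ℝ) < s := by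
    push_cast
    rw [div_lt_iff₀ (by positivity), ← mul_assoc, hs]
    linarith
  have hinteg := (hz _ hα).integral hvi hv0 (b := b * k) (a := a * k - 1) (by
    rw [div_mul_cancel₀]
    positivity)
  have e : z ^ (b * k) * v ^ (-(a * k - 1)) = v * x ^ k := by
    rw [hxdef, mul_pow, ← zpow_natCast (v ^ (-a)), ← zpow_mul, pow_mul, neg_sub, sub_eq_add_neg,
      zpow_add₀ hv0, ← neg_mul, zpow_one]
    ring
  rw [e] at hinteg
  obtain ⟨g, hgQ, hgi⟩ := h x hinteg
  apply hgQ
  have hx0 : x ≠ 0 := by rintro h0; rw [h0] at hx; exact hx isIntegral_zero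
  refine lemD (B := Algebra.adjoin S {x⁻¹}) (K := K) Subtype.val_injective Q _ g hyQ _ hgi ?_
  show (g : K) = g * x * x⁻¹
  field_simp

theorem adjoin_decomp {S K : Type*} [CommRing S] [Field K] [Algebra S K] (y : K) :
    ∀ g ∈ Algebra.adjoin S {y}, ∃ s0 : S, ∃ b' ∈ Algebra.adjoin S {y},
      g = algebraMap S K s0 + y * b' := by
  intro g hg
  induction hg using Algebra.adjoin_induction with
  | mem x hx =>
    rw [Set.mem_singleton_iff.1 hx]
    exact ⟨0, 1, Subalgebra.one_mem _, by simp⟩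
  | algebraMap r => exact ⟨r, 0, Subalgebra.zero_mem _, by simp⟩
  | add x x' _ _ hx hy =>
    obtain ⟨s1, b1, h1, rfl⟩ := hx
    obtain ⟨s2, b2, h2, rfl⟩ := hy
    exact ⟨s1 + s2, b1 + b2, Subalgebra.add_mem _ h1 h2, by rw [map_add]; ring⟩
  | mul x x' hx' hy' hx hy =>
    obtain ⟨s1, b1, h1, rfl⟩ := hx
    obtain ⟨s2, b2, h2, rfl⟩ := hy
    refine ⟨s1 * s2, b1 * (algebraMap S K s2 + y * b2) + algebraMap S K s1 * b2,
      Subalgebra.add_mem _ (Subalgebra.mul_mem _ h1 hy')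
        (Subalgebra.mul_mem _ (Subalgebra.algebraMap_mem _ _) h2), by rw [map_mul]; ring⟩

theorem thmB_irr {S K : Type*} [CommRing S] [IsDomain S] [IsNoetherianRing S] [IsLocalRing S]
    [Field K] [Algebra S K] [IsFractionRing S K] (u : S) (hu : u ≠ 0) (s : ℝ) (hs : Irrational s)
    (z : S)
    (hz : ∀ α < s, OG S (algebraMap S K u) α (algebraMap S K z))
    (hP : ∀ r ∈ IsLocalRing.maximalIdeal S, OG S (algebraMap S K u) s (algebraMap S K (r * z))) :
    OG S (algebraMap S K u) s (algebraMap S K z) := by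
  set v := algebraMap S K u with hv
  have hv0 : v ≠ 0 := by
    intro h; apply hu; apply IsFractionRing.injective S K; rw [map_zero]; exact h
  have hvi : IsIntegral S v := isIntegral_algebraMap
  by_contra hno
  have hno' : ∀ (b : ℕ) (a : ℤ), 0 < b → s * b ≤ a →
      ¬ IsIntegral S ((algebraMap S K z) ^ b * v ^ (-a)) := fun b a hb hab hi =>
    hno ⟨b, a, hb, hab, hi⟩
  obtain ⟨β, hβ, hup⟩ := og_up v hvi hv0 s hs
  obtain ⟨b, a, hb, hab, hab'⟩ := dirichlet_one_sided s hs (β - s) (by linarith)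
  set w := algebraMap S K z with hw
  set x := w ^ b * v ^ (-a) with hxdef
  have hb' : (0 : ℝ) < b := by exact_mod_cast hb
  have hx : ¬ IsIntegral S x := hno' b a hb (by linarith)
  have hx0 : x ≠ 0 := by rintro h0; rw [h0] at hx; exact hx isIntegral_zero
  have hPx : ∀ r ∈ IsLocalRing.maximalIdeal S, IsIntegral S (algebraMap S K r * x) := by
    intro r hr
    have h1 := hup _ (hP r hr)
    rw [map_mul] at h1
    set η := (β - s - (a - s * b)) / b with hη
    have hη0 : 0 < η := div_pos (by linarith) hb'
    have h2 := h1.mul ((hz (s - η) (by linarith)).pow (b - 1) hv0) hv0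
    have h3 := h2.integral hvi hv0 (b := 1) (a := a) (by
      rw [Nat.cast_one, mul_one, Nat.cast_sub hb, Nat.cast_one]
      have : η * b = β - s - (a - s * b) := by rw [hη]; field_simp
      nlinarith)
    convert h3 using 1
    rw [hxdef, pow_one, mul_assoc (algebraMap S K r), ← pow_succ', Nat.sub_add_cancel hb]
    ring
  obtain ⟨Q, hQ, hyQ, hgap⟩ := gap3 x⁻¹ (by rwa [inv_inv])
  obtain ⟨k, hk, h⟩ := hgap u hu
  have hk' : (0 : ℝ) < k := by exact_mod_cast hk
  have hPQ : ∀ r ∈ IsLocalRing.maximalIdeal S,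
      algebraMap S (Algebra.adjoin S {x⁻¹}) r ∈ Q := by
    intro r hr
    refine lemD (B := Algebra.adjoin S {x⁻¹}) (K := K) Subtype.val_injective Q _ _ hyQ _
      (hPx r hr).tower_top ?_
    show algebraMap S K r = algebraMap S K r * x * x⁻¹
    field_simp
  obtain ⟨b2, a2, hb2, hab2, hab2'⟩ := dirichlet_one_sided s hs (min (1 / k) ((a - s * b) / b))
    (lt_min (by positivity) (by positivity))
  obtain ⟨hd1, hd2⟩ := lt_min_iff.1 hab2'
  have hb2' : (1 : ℝ) ≤ b2 := by exact_mod_cast hb2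
  set f := w ^ b2 * v ^ (-a2) with hfdef
  have hf : ¬ IsIntegral S f := hno' b2 a2 hb2 (by linarith)
  have hα : ((a2 * k - 1 : ℤ) : ℝ) / ((b2 * k : ℕ) : ℝ) < s := by
    rw [lt_div_iff₀ hk'] at hd1
    push_cast
    rw [div_lt_iff₀ (by positivity)]
    nlinarith
  have hinteg := (hz _ hα).integral hvi hv0 (b := b2 * k) (a := a2 * k - 1) (by
    rw [div_mul_cancel₀]
    positivity)
  have e : w ^ (b2 * k) * v ^ (-(a2 * k - 1)) = v * f ^ k := by
    rw [hfdef, mul_pow, ← zpow_natCast (v ^ (-a2)), ← zpow_mul, pow_mul, neg_sub, sub_eq_add_neg,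
      zpow_add₀ hv0, ← neg_mul, zpow_one]
    ring
  rw [e] at hinteg
  obtain ⟨g, hgQ, hgi⟩ := h f hinteg
  obtain ⟨V, hV, hfV⟩ := exists_val hf
  have hfinv : f⁻¹ ∈ V := (V.mem_or_inv_mem f).resolve_left hfV
  have hle : a2 * b ≤ a * b2 := by
    rw [lt_div_iff₀ hb'] at hd2
    have : (a2 : ℝ) * b ≤ a * b2 := by nlinarith
    exact_mod_cast this
  have hxV : x ∉ V := by
    intro hxV
    apply hfV
    apply val_int_mem V (Algebra.adjoin S {x}) (adjoin_sub V (fun a => hV _ isIntegral_algebraMap) hxV)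
    refine int_slope (z := w) (u := v) ?_ hv0 hb (?_ : IsIntegral _ x) hle
    · exact hvi.tower_top
    · exact isIntegral_algebraMap (x := (⟨x, Algebra.self_mem_adjoin_singleton S x⟩ :
        Algebra.adjoin S {x}))
  have hyV : x⁻¹ ∈ V := (V.mem_or_inv_mem x).resolve_left hxV
  have hSV : ∀ a : S, algebraMap S K a ∈ V := fun a => hV _ isIntegral_algebraMap
  have hBV := adjoin_sub V hSV hyV
  have hgf := val_int_mem V _ hBV _ hgi
  obtain ⟨s0, b', hb'B, hdec⟩ := adjoin_decomp x⁻¹ (g : K) g.2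
  have hs0 : IsUnit s0 := by
    by_contra hnu
    apply hgQ
    have h1 := hPQ s0 ((IsLocalRing.mem_maximalIdeal _).2 hnu)
    have h2 := Q.add_mem h1 (Q.mul_mem_right ⟨b', hb'B⟩ hyQ)
    convert h2 using 1
    exact Subtype.ext hdec
  have hgu : IsUnit (⟨g, hBV _ g.2⟩ : V) := by
    have hs0V : IsUnit (⟨algebraMap S K s0, hSV s0⟩ : V) := by
      obtain ⟨t, ht⟩ := hs0.exists_right_inv
      refine IsUnit.of_mul_eq_one ⟨algebraMap S K t, hSV t⟩ (Subtype.ext ?_)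
      show algebraMap S K s0 * algebraMap S K t = 1
      rw [← map_mul, ht, map_one]
    have hsum : (⟨algebraMap S K s0, hSV s0⟩ : V) =
        ⟨g, hBV _ g.2⟩ + ⟨x⁻¹, hyV⟩ * (-⟨b', hBV _ hb'B⟩) := by
      apply Subtype.ext
      show algebraMap S K s0 = g + x⁻¹ * (-b')
      rw [hdec]; ring
    rw [hsum] at hs0V
    refine (IsLocalRing.isUnit_or_isUnit_of_isUnit_add hs0V).resolve_right ?_
    intro hu2
    have := isUnit_of_mul_isUnit_left hu2
    obtain ⟨t, ht⟩ := this.exists_right_inv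
    apply hxV
    have : (t : K) = x := by
      have h := congrArg Subtype.val ht
      have h : x⁻¹ * (t : K) = 1 := h
      field_simp at h
      exact h
    rw [← this]
    exact t.2
  obtain ⟨t, ht⟩ := hgu.exists_left_inv
  apply hfV
  have ht' : (t : K) * g = 1 := congrArg Subtype.val ht
  have : f = t * (g * f) := by rw [← mul_assoc, ht', one_mul]
  rw [this]
  exact V.mul_mem _ _ t.2 hgf

theorem artin_of_killed {A : Type*} [CommRing A] [IsLocalRing A] (M : Type*) [AddCommGroup M]
    [Module A M] [Module.Finite A M]
    (h : ∀ m ∈ IsLocalRing.maximalIdeal A, ∀ x : M, m • x = 0) : IsArtinian A M := by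
  have hM : Module.IsTorsionBySet A M (IsLocalRing.maximalIdeal A) := fun x a => h a a.2 x
  let _ : Module (IsLocalRing.ResidueField A) M := hM.module
  have : IsScalarTower A (IsLocalRing.ResidueField A) M := hM.isScalarTower
  have := Module.Finite.of_restrictScalars_finite A (IsLocalRing.ResidueField A) M
  exact isArtinian_of_surjective_algebraMap (IsLocalRing.residue_surjective (R := A))

theorem chain_dcc {A : Type*} [CommRing A] [IsLocalRing A] [IsNoetherianRing A]
    (L W : Ideal A) (hmW : ∀ m ∈ IsLocalRing.maximalIdeal A, ∀ x ∈ W, m * x ∈ L)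
    (N : ℕ → Ideal A) (hN : Antitone N) (hLN : ∀ n, L ≤ N n) (hNW : ∀ n, N n ≤ W) :
    ∃ n, ∀ m, n ≤ m → N n ≤ N m := by
  let L' : Submodule A W := L.submoduleOf W
  have : IsArtinian A (W ⧸ L') := by
    apply artin_of_killed
    intro m hm x
    obtain ⟨x, rfl⟩ := Submodule.mkQ_surjective _ x
    rw [← map_smul, Submodule.mkQ_apply, Submodule.Quotient.mk_eq_zero]
    exact hmW m hm x x.2
  let F : ℕ →o (Submodule A (W ⧸ L'))ᵒᵈ := ⟨fun n => OrderDual.toDual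
    (((N n).submoduleOf W).map L'.mkQ), fun i j h => OrderDual.toDual_le_toDual.2
      (Submodule.map_mono (Submodule.comap_mono (hN h)))⟩
  obtain ⟨n, hn⟩ := IsArtinian.monotone_stabilizes F
  refine ⟨n, fun m hm x hx => ?_⟩
  have h1 : ((N n).submoduleOf W).map L'.mkQ = ((N m).submoduleOf W).map L'.mkQ := hn m hm
  have h2 : L'.mkQ ⟨x, hNW n hx⟩ ∈ ((N m).submoduleOf W).map L'.mkQ := by
    rw [← h1]
    exact ⟨_, hx, rfl⟩
  obtain ⟨y, hy, hxy⟩ := h2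
  rw [Submodule.mkQ_apply, Submodule.mkQ_apply, Submodule.Quotient.eq] at hxy
  have h3 : (y : A) - x ∈ L := hxy
  have := (N m).sub_mem (show (y : A) ∈ N m from hy) (hLN m h3)
  rwa [sub_sub_cancel] at this

theorem ass_below {S : Type*} [CommRing S] [IsNoetherianRing S] (L N : Ideal S)
    (P : Ideal S) [P.IsPrime] (z : S) (hz : z ∈ N) (hP : ∀ r, r * z ∈ L → r ∈ P) :
    ∃ Q : Ideal S, Q ∈ associatedPrimes S (S ⧸ L) ∧ Q ≤ P ∧ ∃ z' ∈ N, ∀ r, r * z' ∈ L ↔ r ∈ Q := by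
  let L' : Submodule S N := L.submoduleOf N
  have hcol : ∀ (w : N) r, r ∈ L'.colon {w} ↔ r * (w : S) ∈ L := by
    intro w r
    rw [Submodule.mem_colon]
    simp only [Set.mem_singleton_iff, forall_eq]
    rfl
  obtain ⟨Q, hQ, hQP⟩ := Ideal.exists_minimalPrimes_le (I := L'.colon {⟨z, hz⟩}) (J := P)
    (fun r hr => hP r ((hcol _ _).1 hr))
  obtain ⟨w, hw⟩ := Submodule.exists_eq_colon_of_mem_minimalPrimes hQ
  refine ⟨Q, ?_, hQP, w, w.2, fun r => by rw [hw, hcol]⟩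
  have hQp : Q.IsPrime := hQ.1.1
  refine isAssociatedPrime_iff.2 ⟨hQp, Ideal.Quotient.mk L w, ?_⟩
  ext r
  rw [hw, hcol, Submodule.mem_colon]
  simp only [Set.mem_singleton_iff, forall_eq, Submodule.mem_bot]
  rw [← Ideal.Quotient.eq_zero_iff_mem, map_mul]
  rfl

theorem lemC {S : Type*} [CommRing S] [IsNoetherianRing S] (L : Ideal S) (Λ : ℕ → Ideal S)
    (hΛ : Antitone Λ) (hL : ∀ n, L ≤ Λ n) (hne : ∀ n, ¬ Λ n ≤ L) :
    ∃ P : Ideal S, P.IsPrime ∧ ∃ z : S, (∀ r, r * z ∈ L ↔ r ∈ P) ∧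
      ∀ n, ∃ r, r ∉ P ∧ r * z ∈ Λ n := by
  classical
  set X := associatedPrimes S (S ⧸ L) with hX
  have hXfin : X.Finite := associatedPrimes.finite S (S ⧸ L)
  let Bad : Ideal S → Prop := fun P => ∀ n, ∃ z ∈ Λ n, ∀ r, r * z ∈ L → r ∈ P
  have hgood : ∀ Y : Set (Ideal S), Y ⊆ X → (∀ P ∈ Y, ¬ Bad P) → ∃ n0, ∀ n, n0 ≤ n → ∀ P ∈ Y,
      ∀ z ∈ Λ n, ¬ ∀ r, r * z ∈ L → r ∈ P := by
    intro Y hYX hY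
    have : ∀ᶠ n in Filter.atTop, ∀ P ∈ Y, ∀ z ∈ Λ n, ¬ ∀ r, r * z ∈ L → r ∈ P := by
      rw [Filter.eventually_all_finite (hXfin.subset hYX)]
      intro P hP
      have := hY P hP
      simp only [Bad] at this
      push Not at this
      obtain ⟨n, hn⟩ := this
      filter_upwards [Filter.eventually_ge_atTop n] with m hm z hz
      push Not
      exact hn z (hΛ hm hz)
    exact Filter.eventually_atTop.1 this
  have hexists : {P ∈ X | Bad P}.Nonempty := by
    by_contra hemp
    rw [Set.not_nonempty_iff_eq_empty] at hemp
    obtain ⟨n, hn⟩ := hgood X subset_rfl (fun P hP hB => by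
      have : P ∈ {P ∈ X | Bad P} := ⟨hP, hB⟩
      rw [hemp] at this
      exact this)
    obtain ⟨z, hz, hzL⟩ := Set.not_subset.1 (hne n)
    obtain ⟨P, hP, hle⟩ := exists_le_isAssociatedPrime_of_isNoetherianRing S
      (Ideal.Quotient.mk L z) (by rwa [Ne, Ideal.Quotient.eq_zero_iff_mem])
    refine hn n le_rfl P hP z hz fun r hr => hle ?_
    rw [Submodule.mem_colon]
    simp only [Set.mem_singleton_iff, forall_eq, Submodule.mem_bot]
    rw [← Ideal.Quotient.eq_zero_iff_mem, map_mul] at hr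
    exact hr
  obtain ⟨P, ⟨hPX, hPB⟩, hPmin⟩ := (hXfin.subset (Set.sep_subset X Bad)).exists_minimal hexists
  have hPp : P.IsPrime := hPX.1
  refine ⟨P, hPp, ?_⟩
  obtain ⟨n0, hn0⟩ := hgood {Q ∈ X | ¬ Bad Q} (Set.sep_subset _ _) (fun Q hQ => hQ.2)
  have step : ∀ n, n0 ≤ n → ∃ z ∈ Λ n, ∀ r, r * z ∈ L ↔ r ∈ P := by
    intro n hn
    obtain ⟨z, hz, hzP⟩ := hPB n
    obtain ⟨Q, hQX, hQP, z', hz', hzQ⟩ := ass_below L (Λ n) P z hz hzP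
    have hQB : Bad Q := by
      by_contra hQB
      exact hn0 n hn Q ⟨hQX, hQB⟩ z' hz' (fun r hr => (hzQ r).1 hr)
    have : Q = P := le_antisymm hQP (hPmin ⟨hQX, hQB⟩ hQP)
    rw [← this]
    exact ⟨z', hz', hzQ⟩
  let W : Ideal S := L.colon (P : Set S)
  have hW : ∀ x, x ∈ W ↔ ∀ r ∈ P, r * x ∈ L := by
    intro x
    rw [Submodule.mem_colon]
    simp only [smul_eq_mul, SetLike.mem_coe, mul_comm]
  let A := Localization.AtPrime P
  have hLW : L ≤ W := fun x hx => (hW x).2 fun r _ => L.mul_mem_left r hx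
  obtain ⟨n1, hn1⟩ := chain_dcc (A := A) (L.map (algebraMap S A)) (W.map (algebraMap S A)) (by
      intro m hm x hx
      rw [← Localization.AtPrime.map_eq_maximalIdeal] at hm
      have : m * x ∈ (P.map (algebraMap S A)) * (W.map (algebraMap S A)) := Ideal.mul_mem_mul hm hx
      rw [← Ideal.map_mul] at this
      refine Ideal.map_mono ?_ this
      rw [Ideal.mul_le]
      intro r hr x hx
      exact (hW x).1 hx r hr)
    (fun n => (Λ n ⊓ W).map (algebraMap S A))
    (fun i j h => Ideal.map_mono (inf_le_inf_right _ (hΛ h)))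
    (fun n => Ideal.map_mono (le_inf (hL n) hLW))
    (fun n => Ideal.map_mono inf_le_right)
  obtain ⟨z, hz, hzP⟩ := step (max n0 n1) (le_max_left _ _)
  refine ⟨z, hzP, fun n => ?_⟩
  have hzW : z ∈ W := (hW z).2 fun r hr => (hzP r).2 hr
  have h1 : algebraMap S A z ∈ (Λ n1 ⊓ W).map (algebraMap S A) :=
    Ideal.mem_map_of_mem _ ⟨hΛ (le_max_right _ _) hz, hzW⟩
  have h2 := hn1 (max n n1) (le_max_right _ _) h1
  obtain ⟨⟨⟨a, ha⟩, ⟨r, hr⟩⟩, hx⟩ := (IsLocalization.mem_map_algebraMap_iff P.primeCompl A).1 h2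
  have hx : algebraMap S A z * algebraMap S A r = algebraMap S A a := hx
  rw [← map_mul, IsLocalization.eq_iff_exists P.primeCompl] at hx
  obtain ⟨⟨t, ht⟩, htx⟩ := hx
  have htx : t * (z * r) = t * a := htx
  refine ⟨t * r, P.primeCompl.mul_mem ht hr, ?_⟩
  rw [show t * r * z = t * (z * r) by ring, htx]
  exact Ideal.mul_mem_left _ _ (hΛ (le_max_left n n1) ha.1)

theorem OG.tower {S S' K : Type*} [CommRing S] [CommRing S'] [Field K] [Algebra S K] [Algebra S' K]
    [Algebra S S'] [IsScalarTower S S' K] {u z : K} {α : ℝ} (h : OG S u α z) : OG S' u α z := by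
  obtain ⟨b, a, hb, hab, hi⟩ := h
  exact ⟨b, a, hb, hab, hi.tower_top⟩

theorem thmA {S K : Type*} [CommRing S] [IsDomain S] [IsNoetherianRing S] [Field K]
    [Algebra S K] [IsFractionRing S K] (u : S) (hu : u ≠ 0) (s : ℝ) :
    ∃ ε : ℝ, 0 < ε ∧ ∀ z : S, OG S (algebraMap S K u) (s - ε) (algebraMap S K z) →
      OG S (algebraMap S K u) s (algebraMap S K z) := by
  by_contra! hcon
  set v := algebraMap S K u with hv
  have hv0 : v ≠ 0 := by
    intro h; apply hu; apply IsFractionRing.injective S K; rw [map_zero]; exact h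
  have hvi : IsIntegral S v := isIntegral_algebraMap
  obtain ⟨P, hP, z, hzP, hzn⟩ := lemC (lamI v hvi hv0 s)
    (fun n => lamI v hvi hv0 (s - 1 / ((n : ℝ) + 1))) (by
      intro m n h z hz
      refine OG.anti hz ?_
      gcongr) (by
      intro n z hz
      refine OG.anti hz ?_
      have : (0 : ℝ) < 1 / ((n : ℝ) + 1) := by positivity
      linarith) (by
      intro n hle
      obtain ⟨z, hz1, hz2⟩ := hcon (1 / ((n : ℝ) + 1)) (by positivity)
      exact hz2 (hle hz1))
  obtain ⟨_, _, _⟩ := loc_pack (K := K) P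
  let A := Localization.AtPrime P
  have hr : ∀ r : S, r ∉ P → IsIntegral A (algebraMap S K r)⁻¹ := by
    intro r hr
    obtain ⟨t, ht⟩ := (IsLocalization.map_units A (⟨r, hr⟩ : P.primeCompl)).exists_right_inv
    have : (algebraMap S K r)⁻¹ = algebraMap A K t := by
      rw [IsScalarTower.algebraMap_apply S A K]
      apply inv_eq_of_mul_eq_one_right
      rw [← map_mul]
      change algebraMap A K (algebraMap S A r * t) = 1
      rw [show algebraMap S A r * t = 1 from ht, map_one]
    rw [this]
    exact isIntegral_algebraMap
  have hvA : v = algebraMap A K (algebraMap S A u) := IsScalarTower.algebraMap_apply S A K u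
  have huA : algebraMap S A u ≠ 0 := by
    intro h; apply hv0; rw [hvA, h, map_zero]
  have hzA : ∀ α < s, OG A v α (algebraMap S K z) := by
    intro α hα
    obtain ⟨n, hn⟩ := exists_nat_one_div_lt (sub_pos.2 hα)
    obtain ⟨r, hrP, hrz⟩ := hzn n
    have h1 : OG A v (s - 1 / ((n : ℝ) + 1)) (algebraMap S K (r * z)) := OG.tower (S := S) hrz
    have h2 := (OG.of_integral (u := v) (hr r hrP)).mul h1 hv0
    have hr0 : algebraMap S K r ≠ 0 := by
      intro h
      apply hrP
      rw [(injective_iff_map_eq_zero _).1 (IsFractionRing.injective S K) r h]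
      exact P.zero_mem
    rw [map_mul, ← mul_assoc, inv_mul_cancel₀ hr0, one_mul, zero_add] at h2
    exact h2.anti (by linarith)
  have hfinal : OG A v s (algebraMap S K z) := by
    by_cases hs : Irrational s
    · rw [hvA, IsScalarTower.algebraMap_apply S A K z] at hzA ⊢
      refine thmB_irr (S := A) (K := K) _ huA s hs _ hzA ?_
      intro m hm
      rw [← Localization.AtPrime.map_eq_maximalIdeal] at hm
      obtain ⟨⟨⟨a, ha⟩, ⟨r, hrP⟩⟩, hx⟩ := (IsLocalization.mem_map_algebraMap_iff P.primeCompl A).1 hm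
      have hx : m * algebraMap S A r = algebraMap S A a := hx
      have h1 : OG A v s (algebraMap S K (a * z)) := OG.tower (S := S) ((hzP a).2 ha)
      have h2 := (OG.of_integral (u := v) (hr r hrP)).mul h1 hv0
      rw [zero_add] at h2
      rw [← hvA]
      convert h2 using 1
      rw [map_mul, map_mul, IsScalarTower.algebraMap_apply S A K a, ← hx, map_mul,
        ← IsScalarTower.algebraMap_apply S A K z, ← IsScalarTower.algebraMap_apply S A K r]
      have hr0 : algebraMap S K r ≠ 0 := by
        intro h
        apply hrP
        rw [(injective_iff_map_eq_zero _).1 (IsFractionRing.injective S K) r h]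
        exact P.zero_mem
      field_simp
    · rw [irrational_iff_ne_rational] at hs
      push Not at hs
      obtain ⟨a, b, hb, rfl⟩ := hs
      obtain ⟨q, hq⟩ : ∃ q : ℚ, (q : ℝ) = (a : ℝ) / b := ⟨(a : ℚ) / b, by push_cast; rfl⟩
      rw [hvA] at hzA ⊢
      refine thmB_rat (S := A) (K := K) _ huA _ q.num q.den q.den_pos ?_ _ hzA
      rw [← hq]
      exact_mod_cast Rat.mul_den_eq_num q
  obtain ⟨b, a, hb, hab, hi⟩ := hfinal
  obtain ⟨⟨r, hrP⟩, hri⟩ := hi.exists_multiple_integral_of_isLocalization P.primeCompl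
  apply hrP
  have hri : IsIntegral S (r • (algebraMap S K z ^ b * v ^ (-a))) := hri
  rw [Algebra.smul_def] at hri
  refine (hzP r).1 ⟨b, a, hb, hab, ?_⟩
  have : algebraMap S K (r * z) ^ b * v ^ (-a) =
      algebraMap S K (r ^ (b - 1)) * (algebraMap S K r * (algebraMap S K z ^ b * v ^ (-a))) := by
    rw [map_mul, mul_pow, map_pow]
    nth_rewrite 1 [← Nat.sub_add_cancel hb]
    rw [pow_succ]
    ring
  rw [this]
  exact isIntegral_algebraMap.mul hri

open Polynomial in
/-- coefficient condition for extended Rees algebra elements -/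
def reesCond {D : Type*} [CommRing D] [IsDomain D] (J : Ideal D) (x : FractionRing D[X]) : Prop :=
  ∃ N : ℕ, ∃ g : D[X], x * (algebraMap D[X] (FractionRing D[X]) X) ^ N = algebraMap D[X] _ g ∧
    ∀ i, g.coeff i ∈ J ^ (i - N)

section rees
open Polynomial
variable {D : Type*} [CommRing D] [IsDomain D] (J : Ideal D)

theorem reesCond.lift {x : FractionRing D[X]} {N : ℕ} {g : D[X]}
    (h : x * (algebraMap D[X] (FractionRing D[X]) X) ^ N = algebraMap D[X] _ g)
    (hg : ∀ i, g.coeff i ∈ J ^ (i - N)) (M : ℕ) :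
    x * (algebraMap D[X] (FractionRing D[X]) X) ^ (N + M) = algebraMap D[X] _ (g * X ^ M) ∧
    ∀ i, (g * X ^ M).coeff i ∈ J ^ (i - (N + M)) := by
  refine ⟨by rw [pow_add, ← mul_assoc, h, map_mul, map_pow], fun i => ?_⟩
  rw [coeff_mul_X_pow']
  split_ifs with hi
  · convert hg (i - M) using 2
    omega
  · exact Ideal.zero_mem _

theorem reesCond.add {x y : FractionRing D[X]} (hx : reesCond J x) (hy : reesCond J y) :
    reesCond J (x + y) := by
  obtain ⟨N, g, h, hg⟩ := hx
  obtain ⟨M, g', h', hg'⟩ := hy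
  obtain ⟨h1, h2⟩ := reesCond.lift J h hg M
  obtain ⟨h3, h4⟩ := reesCond.lift J h' hg' N
  rw [add_comm M N] at h3 h4
  refine ⟨N + M, g * X ^ M + g' * X ^ N, by rw [add_mul, h1, h3, map_add], fun i => ?_⟩
  rw [coeff_add]
  exact Ideal.add_mem _ (h2 i) (h4 i)

theorem reesCond.mul {x y : FractionRing D[X]} (hx : reesCond J x) (hy : reesCond J y) :
    reesCond J (x * y) := by
  obtain ⟨N, g, h, hg⟩ := hx
  obtain ⟨M, g', h', hg'⟩ := hy
  refine ⟨N + M, g * g', by rw [map_mul, ← h, ← h']; ring, fun i => ?_⟩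
  rw [coeff_mul]
  refine Ideal.sum_mem _ fun ⟨k, l⟩ hkl => ?_
  have hkl : k + l = i := by simpa using hkl
  have h1 := Ideal.mul_mem_mul (hg k) (hg' l)
  rw [← pow_add] at h1
  exact Ideal.pow_le_pow_right (by omega) h1

theorem reesCond.of_mem {m : ℕ} {d : D} (hd : d ∈ J ^ m) :
    reesCond J (algebraMap D[X] (FractionRing D[X]) (C d * X ^ m)) := by
  refine ⟨0, C d * X ^ m, by simp, fun i => ?_⟩
  rw [coeff_C_mul_X_pow]
  split_ifs with hi
  · subst hi; simpa using hd
  · exact Ideal.zero_mem _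

theorem reesCond.inv : reesCond J (algebraMap D[X] (FractionRing D[X]) X)⁻¹ := by
  refine ⟨1, 1, ?_, fun i => ?_⟩
  · rw [pow_one, inv_mul_cancel₀, map_one]
    simp
  · rw [coeff_one]
    split_ifs with hi
    · subst hi; simp
    · exact Ideal.zero_mem _

theorem rees [IsNoetherianRing D] : ∃ S : Subalgebra D (FractionRing D[X]),
    IsNoetherianRing S ∧ IsFractionRing S (FractionRing D[X]) ∧
    (∀ x ∈ S, reesCond J x) ∧ (algebraMap D[X] (FractionRing D[X]) X)⁻¹ ∈ S ∧
    ∀ m : ℕ, ∀ d ∈ J ^ m, algebraMap D[X] (FractionRing D[X]) (C d * X ^ m) ∈ S := by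
  classical
  set K := FractionRing D[X] with hK
  set t : K := algebraMap D[X] K X with ht
  have ht0 : t ≠ 0 := by simp [ht]
  obtain ⟨G, hG⟩ : J.FG := IsNoetherian.noetherian J
  let S : Subalgebra D K := Algebra.adjoin D
    (((insert t⁻¹ (G.image (fun d => algebraMap D[X] K (C d * X)))) : Finset K) : Set K)
  have hC : ∀ d : D, algebraMap D K d = algebraMap D[X] K (C d) := fun d => by
    rw [IsScalarTower.algebraMap_apply D D[X] K]; rfl
  have htS : t⁻¹ ∈ S := Algebra.subset_adjoin (by simp)
  have hdS : ∀ d : D, algebraMap D[X] K (C d) ∈ S := fun d => by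
    rw [← hC]; exact S.algebraMap_mem d
  have h1S : ∀ d ∈ J, algebraMap D[X] K (C d * X) ∈ S := by
    intro d hd
    rw [← hG] at hd
    induction hd using Submodule.span_induction with
    | mem d hd => exact Algebra.subset_adjoin (by
        simp only [Finset.coe_insert, Finset.coe_image]
        exact Set.mem_insert_of_mem _ ⟨d, hd, rfl⟩)
    | zero => simp
    | add x y _ _ hx hy => 
      rw [C_add, add_mul, map_add]; exact S.add_mem hx hy
    | smul a x _ hx =>
      rw [smul_eq_mul, C_mul, mul_assoc, map_mul]; exact S.mul_mem (hdS a) hx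
  have hmS : ∀ m : ℕ, ∀ d ∈ J ^ m, algebraMap D[X] K (C d * X ^ m) ∈ S := by
    intro m
    induction m with
    | zero => intro d _; simpa using hdS d
    | succ m ih =>
      intro d hd
      rw [pow_succ] at hd
      refine Submodule.mul_induction_on hd ?_ ?_
      · intro a ha b hb
        rw [show C (a * b) * X ^ (m + 1) = (C a * X ^ m) * (C b * X) by rw [C_mul]; ring, map_mul]
        exact S.mul_mem (ih a ha) (h1S b hb)
      · intro a b ha hb
        rw [C_add, add_mul, map_add]; exact S.add_mem ha hb
  refine ⟨S, isNoetherianRing_of_fg ⟨_, rfl⟩, ?_, ?_, htS, hmS⟩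
  · have key : ∀ p : D[X], ∃ N : ℕ, algebraMap D[X] K p * t⁻¹ ^ N ∈ S := by
      intro p
      induction p using Polynomial.induction_on' with
      | add p q hp hq =>
        obtain ⟨N, hN⟩ := hp
        obtain ⟨M, hM⟩ := hq
        refine ⟨N + M, ?_⟩
        rw [map_add, show (algebraMap D[X] K p + algebraMap D[X] K q) * t⁻¹ ^ (N + M) =
          (algebraMap D[X] K p * t⁻¹ ^ N) * t⁻¹ ^ M + (algebraMap D[X] K q * t⁻¹ ^ M) * t⁻¹ ^ N by ring]
        exact S.add_mem (S.mul_mem hN (S.pow_mem htS _)) (S.mul_mem hM (S.pow_mem htS _))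
      | monomial n a =>
        refine ⟨n, ?_⟩
        rw [← C_mul_X_pow_eq_monomial, map_mul, map_pow, mul_assoc, ← mul_pow, mul_inv_cancel₀ ht0,
          one_pow, mul_one]
        exact hdS a
    refine IsFractionRing.of_field S K fun z => ?_
    obtain ⟨a, b, hb, rfl⟩ := IsFractionRing.div_surjective (A := D[X]) z
    obtain ⟨N, hN⟩ := key a
    obtain ⟨M, hM⟩ := key b
    refine ⟨⟨_, S.mul_mem hN (S.pow_mem htS M)⟩, ⟨_, S.mul_mem hM (S.pow_mem htS N)⟩, ?_⟩
    show _ = (algebraMap D[X] K a * t⁻¹ ^ N * t⁻¹ ^ M) / (algebraMap D[X] K b * t⁻¹ ^ M * t⁻¹ ^ N)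
    rw [mul_assoc, mul_assoc, ← pow_add, ← pow_add, add_comm M N, mul_div_mul_right]
    exact pow_ne_zero _ (inv_ne_zero ht0)
  · intro x hx
    induction hx using Algebra.adjoin_induction with
    | mem x hx =>
      simp only [Finset.coe_insert, Finset.coe_image, Set.mem_insert_iff, Set.mem_image] at hx
      rcases hx with rfl | ⟨d, hd, rfl⟩
      · exact reesCond.inv J
      · have := reesCond.of_mem J (m := 1) (d := d) (by
          rw [pow_one, ← hG]; exact Submodule.subset_span hd)
        rwa [pow_one] at this
    | algebraMap r =>
      rw [hC]
      have := reesCond.of_mem J (m := 0) (d := r) (by simp)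
      rwa [pow_zero, mul_one] at this
    | add x y _ _ hx hy => exact reesCond.add J hx hy
    | mul x y _ _ hx hy => exact reesCond.mul J hx hy

theorem domain_gap [IsNoetherianRing D] (hJ : J ≠ ⊥) (s : ℝ) (hs : 0 < s) :
    ∃ ε : ℝ, 0 < ε ∧ ∀ (z : D) (a b : ℕ), 0 < b → (s - ε) * b ≤ a →
      (∃ c : D, c ≠ 0 ∧ ∃ N : ℕ, ∀ n, N ≤ n → c * z ^ (b * n) ∈ J ^ (a * n)) →
      ∃ c : D, c ≠ 0 ∧ ∀ q : ℕ, c * z ^ q ∈ J ^ ⌈s * (q : ℝ)⌉₊ := by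
  obtain ⟨S, hSN, hSF, hScond, htS, hmS⟩ := rees J
  set K := FractionRing D[X] with hK
  set t : K := algebraMap D[X] K X with ht
  have ht0 : t ≠ 0 := by simp [ht]
  have hinj : Function.Injective (algebraMap D[X] K) := IsFractionRing.injective _ _
  have hC : ∀ d : D, algebraMap D K d = algebraMap D[X] K (C d) := fun d => by
    rw [IsScalarTower.algebraMap_apply D D[X] K]; rfl
  obtain ⟨ε, hε, hA⟩ := thmA (K := K) (⟨t⁻¹, htS⟩ : S) (by
    intro h
    exact inv_ne_zero ht0 (congrArg Subtype.val h)) s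
  refine ⟨ε, hε, ?_⟩
  rintro z a b hb hab ⟨c, hc, N, hcN⟩
  have h1 := hA (algebraMap D S z) (by
    refine ⟨b, a, hb, by exact_mod_cast hab, ?_⟩
    apply IsAlmostIntegral.isIntegral
    have hcS : algebraMap D K c ∈ S := S.algebraMap_mem c
    refine ⟨⟨_, S.mul_mem hcS (S.pow_mem htS (a * N))⟩, mem_nonZeroDivisors_of_ne_zero ?_, ?_⟩
    · intro h0
      have h0 : algebraMap D K c * t⁻¹ ^ (a * N) = 0 := congrArg Subtype.val h0
      rcases mul_eq_zero.1 h0 with h0 | h0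
      · rw [hC] at h0
        apply hc
        have := hinj (h0.trans (map_zero _).symm)
        simpa using this
      · exact pow_ne_zero _ (inv_ne_zero ht0) h0
    · intro n
      have e : algebraMap D K z ^ b * (t⁻¹) ^ (-(a : ℤ)) = algebraMap D K z ^ b * t ^ a := by
        rw [zpow_neg, inv_zpow, inv_inv, zpow_natCast]
      suffices h : algebraMap D K c * t⁻¹ ^ (a * N) * (algebraMap D K z ^ b * t ^ a) ^ n ∈ S by
        refine ⟨⟨_, h⟩, ?_⟩
        rw [Algebra.smul_def]
        show _ = algebraMap D K c * t⁻¹ ^ (a * N) *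
          (algebraMap D K z ^ b * (t⁻¹) ^ (-(a : ℤ))) ^ n
        rw [e]
        rfl
      rcases le_total N n with hn | hn
      · have h1 := hmS _ _ (hcN n hn)
        have h2 := S.mul_mem h1 (S.pow_mem htS (a * N))
        convert h2 using 1
        rw [hC, hC, C_mul, C_pow, map_mul, map_mul, map_pow, map_pow, pow_mul, pow_mul t]
        ring
      · obtain ⟨m, rfl⟩ := Nat.exists_eq_add_of_le hn
        have h1 : algebraMap D K (c * z ^ (b * n)) * t⁻¹ ^ (a * m) ∈ S :=
          S.mul_mem (S.algebraMap_mem _) (S.pow_mem htS _)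
        convert h1 using 1
        have h3 : t⁻¹ ^ (a * n) * t ^ (a * n) = 1 := by
          rw [← mul_pow, inv_mul_cancel₀ ht0, one_pow]
        rw [map_mul, map_pow, mul_add, pow_add, mul_pow, ← pow_mul, ← pow_mul]
        calc _ = algebraMap D K c * algebraMap D K z ^ (b * n) * t⁻¹ ^ (a * m) *
              (t⁻¹ ^ (a * n) * t ^ (a * n)) := by ring
          _ = _ := by rw [h3, mul_one])
  obtain ⟨b', a'', hb', hab', hi⟩ := h1
  obtain ⟨a', rfl⟩ := Int.eq_ofNat_of_zero_le (a := a'') (by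
    have : (0 : ℝ) ≤ a'' := le_trans (by positivity) hab'
    exact_mod_cast this)
  obtain ⟨r, hr, hrn⟩ := hi.isAlmostIntegral
  have hr0 : (r : K) ≠ 0 := fun h => nonZeroDivisors.ne_zero hr (Subtype.ext h)
  obtain ⟨N', g, hg, -⟩ := hScond r r.2
  have hg0 : g ≠ 0 := by
    rintro rfl
    rw [map_zero] at hg
    exact mul_ne_zero hr0 (pow_ne_zero _ ht0) hg
  obtain ⟨i0, hi0⟩ : ∃ i, g.coeff i ≠ 0 := by
    by_contra! h
    exact hg0 (Polynomial.ext (by simpa using h))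
  have hcoef : ∀ n, g.coeff i0 * z ^ (b' * n) ∈ J ^ (a' * n - N') := by
    intro n
    obtain ⟨w, hw⟩ := hrn n
    have e : algebraMap D K z ^ b' * (t⁻¹) ^ (-(a' : ℤ)) = algebraMap D K z ^ b' * t ^ a' := by
      rw [zpow_neg, inv_zpow, inv_inv, zpow_natCast]
    have hw : (w : K) = r * (algebraMap D K z ^ b' * t ^ a') ^ n := by
      rw [← e]
      rw [Algebra.smul_def] at hw
      exact hw
    obtain ⟨M, h, hh, hhJ⟩ := hScond w w.2
    have heq : g * C (z ^ (b' * n)) * X ^ (a' * n + M) = h * X ^ N' := by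
      apply hinj
      have hg' : (r : K) * t ^ N' = algebraMap D[X] K g := hg
      have hh' : (w : K) * t ^ M = algebraMap D[X] K h := hh
      simp only [map_mul, map_pow]
      rw [← ht, ← hg', ← hh', hw, ← hC]
      ring
    have h1 := congrArg (fun f => f.coeff (i0 + (a' * n + M))) heq
    simp only [coeff_mul_X_pow, coeff_mul_C] at h1
    rw [h1, coeff_mul_X_pow']
    split_ifs with hle
    · exact Ideal.pow_le_pow_right (by omega) (hhJ _)
    · exact Ideal.zero_mem _
  obtain ⟨f, hfJ, hf0⟩ := Submodule.exists_mem_ne_zero_of_ne_bot hJ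
  refine ⟨g.coeff i0 * f ^ (N' + a'), mul_ne_zero hi0 (pow_ne_zero _ hf0), fun q => ?_⟩
  have h1 := Ideal.mul_mem_mul (hcoef (q / b')) (Ideal.pow_mem_pow hfJ (N' + a'))
  rw [← pow_add] at h1
  have h2 := Ideal.mul_mem_left _ (z ^ (q % b')) h1
  have e : g.coeff i0 * f ^ (N' + a') * z ^ q =
      z ^ (q % b') * (g.coeff i0 * z ^ (b' * (q / b')) * f ^ (N' + a')) := by
    nth_rewrite 1 [← Nat.mod_add_div q b']
    rw [pow_add]
    ring
  rw [e]
  refine Ideal.pow_le_pow_right ?_ h2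
  have hq : (q : ℝ) ≤ b' * (q / b' : ℕ) + b' := by
    have := Nat.div_add_mod q b'
    have := Nat.mod_lt q hb'
    exact_mod_cast (by omega : q ≤ b' * (q / b') + b')
  have : ⌈s * (q : ℝ)⌉₊ ≤ a' * (q / b') + a' := by
    apply Nat.ceil_le.2
    push_cast at hab' ⊢
    calc s * (q : ℝ) ≤ s * (b' * (q / b' : ℕ) + b') := by gcongr
      _ = (s * b') * (q / b' : ℕ) + s * b' := by ring
      _ ≤ _ := by gcongr
  omega
end rees

theorem ring_gap {R : Type*} [CommRing R] [IsNoetherianRing R] (I P : Ideal R) [P.IsPrime]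
    (hIP : ¬ I ≤ P) (s : ℝ) (hs : 0 < s) :
    ∃ ε : ℝ, 0 < ε ∧ ∀ (z : R) (a b : ℕ), 0 < b → (s - ε) * b ≤ a →
      (∃ c : R, c ∉ P ∧ ∃ N : ℕ, ∀ n, N ≤ n → c * z ^ (b * n) ∈ I ^ (a * n)) →
      ∃ c : R, c ∉ P ∧ ∀ q : ℕ, c * z ^ q ∈ I ^ ⌈s * (q : ℝ)⌉₊ ⊔ P := by
  obtain ⟨ε, hε, h⟩ := domain_gap (I.map (Ideal.Quotient.mk P)) (by
    intro h0
    apply hIP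
    rw [Ideal.map_eq_bot_iff_le_ker, Ideal.mk_ker] at h0
    exact h0) s hs
  refine ⟨ε, hε, ?_⟩
  rintro z a b hb hab ⟨c, hc, N, hN⟩
  obtain ⟨c', hc', hq⟩ := h (Ideal.Quotient.mk P z) a b hb hab ⟨Ideal.Quotient.mk P c, by
    rwa [Ne, Ideal.Quotient.eq_zero_iff_mem], N, fun n hn => by
      rw [← Ideal.map_pow, ← map_pow, ← map_mul]
      exact Ideal.mem_map_of_mem _ (hN n hn)⟩
  obtain ⟨c', rfl⟩ := Ideal.Quotient.mk_surjective c'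
  refine ⟨c', by rwa [Ne, Ideal.Quotient.eq_zero_iff_mem] at hc', fun q => ?_⟩
  have := hq q
  rwa [← Ideal.map_pow, ← map_pow, ← map_mul, Ideal.mem_quotient_iff_mem_sup] at this

theorem ring_gap_unif {R : Type*} [CommRing R] [IsNoetherianRing R] (I : Ideal R)
    (hI : PosHeight I) (s : ℝ) (hs : 0 < s) :
    ∃ ε : ℝ, 0 < ε ∧ ∀ P ∈ minimalPrimes R, ∀ (z : R) (a b : ℕ), 0 < b → (s - ε) * b ≤ a →
      (∃ c : R, c ∉ P ∧ ∃ N : ℕ, ∀ n, N ≤ n → c * z ^ (b * n) ∈ I ^ (a * n)) →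
      ∃ c : R, c ∉ P ∧ ∀ q : ℕ, c * z ^ q ∈ I ^ ⌈s * (q : ℝ)⌉₊ ⊔ P := by
  have hfin : (minimalPrimes R).Finite := minimalPrimes.finite_of_isNoetherianRing R
  have : ∀ᶠ ε : ℝ in nhdsWithin 0 (Set.Ioi 0), ∀ P ∈ minimalPrimes R, ∀ (z : R) (a b : ℕ),
      0 < b → (s - ε) * b ≤ a →
      (∃ c : R, c ∉ P ∧ ∃ N : ℕ, ∀ n, N ≤ n → c * z ^ (b * n) ∈ I ^ (a * n)) →
      ∃ c : R, c ∉ P ∧ ∀ q : ℕ, c * z ^ q ∈ I ^ ⌈s * (q : ℝ)⌉₊ ⊔ P := by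
    rw [Filter.eventually_all_finite hfin]
    intro P hP
    have hPp : P.IsPrime := hP.1.1
    obtain ⟨ε, hε, h⟩ := ring_gap I P (hI P hP) s hs
    filter_upwards [Ioc_mem_nhdsGT hε] with δ hδ z a b hb hab hc
    refine h z a b hb (le_trans ?_ hab) hc
    gcongr
    exact hδ.2
  obtain ⟨ε, h1, h2⟩ := (this.and self_mem_nhdsWithin).exists
  exact ⟨ε, h2, h1⟩

theorem RCirc_mul {R : Type*} [CommRing R] {c d : R} (hc : c ∈ RCirc R) (hd : d ∈ RCirc R) :
    c * d ∈ RCirc R := by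
  intro P hP h
  have hPp : P.IsPrime := hP.1.1
  exact (hPp.mem_or_mem h).elim (hc P hP) (hd P hP)

theorem RCirc_pow {R : Type*} [CommRing R] {c : R} (hc : c ∈ RCirc R) (n : ℕ) :
    c ^ n ∈ RCirc R := by
  intro P hP h
  have hPp : P.IsPrime := hP.1.1
  exact hc P hP (hPp.mem_of_pow_mem n h)

theorem weakCl_of_local {R : Type*} [CommRing R] [IsNoetherianRing R]
    (p : ℕ) (hp : p.Prime) (hcp : CharP R p) (I : Ideal R) (s : ℝ) (z : R)
    (h : ∀ P ∈ minimalPrimes R, ∃ c : R, c ∉ P ∧ ∀ q : ℕ, c * z ^ q ∈ I ^ ⌈s * (q : ℝ)⌉₊ ⊔ P) :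
    z ∈ weakCl p I s := by
  classical
  have : Fact p.Prime := ⟨hp⟩
  have hfin : (minimalPrimes R).Finite := minimalPrimes.finite_of_isNoetherianRing R
  set T := hfin.toFinset with hT
  have hTmem : ∀ P, P ∈ T ↔ P ∈ minimalPrimes R := fun P => hfin.mem_toFinset
  have hprime : ∀ P ∈ T, P.IsPrime := fun P hP => ((hTmem P).1 hP).1.1
  have he : ∀ P : Ideal R, ∃ e : R, P ∈ T → e ∉ P ∧ ∀ P' ∈ T, P' ≠ P → e ∈ P' := by
    intro P
    by_cases hP : P ∈ T
    · have hPp := hprime P hP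
      have hnle : ¬ (T.erase P).inf id ≤ P := by
        intro hle
        obtain ⟨P', hP', hle'⟩ := (Ideal.IsPrime.inf_le' hPp).1 hle
        obtain ⟨hne, hP'T⟩ := Finset.mem_erase.1 hP'
        apply hne
        have h1 := ((hTmem P).1 hP).2 (y := P') ⟨hprime P' hP'T, bot_le⟩ hle'
        exact le_antisymm hle' h1
      obtain ⟨e, he, heP⟩ := Set.not_subset.1 hnle
      refine ⟨e, fun _ => ⟨heP, fun P' hP' hne => ?_⟩⟩
      exact (Finset.inf_le (f := id) (Finset.mem_erase.2 ⟨hne, hP'⟩)) he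
    · exact ⟨0, fun h => absurd h hP⟩
  choose e he using he
  have hc : ∀ P : Ideal R, ∃ c : R, P ∈ T → c ∉ P ∧
      ∀ q : ℕ, c * z ^ q ∈ I ^ ⌈s * (q : ℝ)⌉₊ ⊔ P := by
    intro P
    by_cases hP : P ∈ T
    · obtain ⟨c, hc⟩ := h P ((hTmem P).1 hP)
      exact ⟨c, fun _ => hc⟩
    · exact ⟨0, fun h => absurd h hP⟩
  choose c hc using hc
  set d := ∑ P ∈ T, e P * c P with hd
  have hdR : d ∈ RCirc R := by
    intro P hP hdP
    have hPT := (hTmem P).2 hP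
    have hPp := hprime P hPT
    rw [hd, ← Finset.add_sum_erase T _ hPT] at hdP
    have h2 : ∑ P' ∈ T.erase P, e P' * c P' ∈ P := by
      refine Ideal.sum_mem _ fun P' hP' => ?_
      obtain ⟨hne, hP'T⟩ := Finset.mem_erase.1 hP'
      exact Ideal.mul_mem_right _ _ ((he P' hP'T).2 P hPT hne.symm)
    rw [Ideal.add_mem_iff_left _ h2] at hdP
    exact (hPp.mem_or_mem hdP).elim (he P hPT).1 (hc P hPT).1
  have hnil : ∀ x : R, (∀ P ∈ T, x ∈ P) → x ∈ nilradical R := by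
    intro x hx
    have : nilradical R = sInf (minimalPrimes R) := by
      rw [nilradical, Ideal.zero_eq_bot, ← Ideal.sInf_minimalPrimes]
    rw [this, Ideal.mem_sInf]
    intro P hP
    exact hx P ((hTmem P).2 hP)
  have hdz : ∀ q : ℕ, d * z ^ q ∈ I ^ ⌈s * (q : ℝ)⌉₊ ⊔ nilradical R := by
    intro q
    rw [hd, Finset.sum_mul]
    refine Ideal.sum_mem _ fun P hP => ?_
    obtain ⟨i, hi, x, hx, hix⟩ := Submodule.mem_sup.1 ((hc P hP).2 q)
    rw [mul_assoc, ← hix, mul_add]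
    refine Submodule.add_mem_sup (Ideal.mul_mem_left _ _ hi) (hnil _ fun P' hP' => ?_)
    by_cases hPP : P' = P
    · subst hPP; exact Ideal.mul_mem_left _ _ hx
    · exact Ideal.mul_mem_right _ _ ((he P hP).2 P' hP' hPP)
  obtain ⟨n, hn⟩ := IsNoetherianRing.isNilpotent_nilradical R
  have hnil0 : ∀ x ∈ nilradical R, x ^ p ^ n = 0 := by
    intro x hx
    have h1 : x ^ n = 0 := by
      have := Ideal.pow_mem_pow hx n
      rw [hn] at this
      exact this
    exact pow_eq_zero_of_le (Nat.lt_pow_self hp.one_lt).le h1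
  refine ⟨d ^ p ^ n, RCirc_pow hdR _, n, fun k hk => ?_⟩
  obtain ⟨m, rfl⟩ := Nat.exists_eq_add_of_le hk
  obtain ⟨i, hi, x, hx, hix⟩ := Submodule.mem_sup.1 (hdz (p ^ m))
  have e1 : d ^ p ^ n * z ^ p ^ (n + m) = i ^ p ^ n := by
    rw [show p ^ (n + m) = p ^ m * p ^ n by rw [pow_add, mul_comm], pow_mul, ← mul_pow, ← hix,
      add_pow_char_pow, hnil0 x hx, add_zero]
  rw [e1]
  refine Submodule.mem_sup_left ?_
  have h2 := Ideal.pow_mem_pow hi (p ^ n)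
  rw [← pow_mul] at h2
  refine Ideal.pow_le_pow_right ?_ h2
  apply Nat.ceil_le.2
  have h3 := Nat.le_ceil (s * ((p ^ m : ℕ) : ℝ))
  push_cast at h3 ⊢
  calc s * (p : ℝ) ^ (n + m) = s * (p : ℝ) ^ m * (p : ℝ) ^ n := by rw [pow_add]; ring
    _ ≤ _ := by gcongr

theorem weakCl_add {R : Type*} [CommRing R]
    (p : ℕ) (hp : p.Prime) (hcp : CharP R p) (I : Ideal R) (s : ℝ) {y z : R}
    (hy : y ∈ weakCl p I s) (hz : z ∈ weakCl p I s) : y + z ∈ weakCl p I s := by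
  have : Fact p.Prime := ⟨hp⟩
  obtain ⟨c, hc, N, hN⟩ := hy
  obtain ⟨d, hd, M, hM⟩ := hz
  refine ⟨c * d, RCirc_mul hc hd, max N M, fun e he => ?_⟩
  rw [add_pow_char_pow, show c * d * (y ^ p ^ e + z ^ p ^ e) =
    d * (c * y ^ p ^ e) + c * (d * z ^ p ^ e) by ring]
  exact Ideal.add_mem _ (Ideal.mul_mem_left _ _ (hN e (le_trans (le_max_left _ _) he)))
    (Ideal.mul_mem_left _ _ (hM e (le_trans (le_max_right _ _) he)))

theorem weakCl_anti {R : Type*} [CommRing R] (p : ℕ) (I : Ideal R) {s t : ℝ} (h : t ≤ s) :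
    weakCl p I s ⊆ weakCl p I t := by
  rintro x ⟨c, hc, N, hN⟩
  refine ⟨c, hc, N, fun e he => ?_⟩
  refine (sup_le_sup_right (Ideal.pow_le_pow_right ?_) _ :
    mixedPow I s (p ^ e) ≤ mixedPow I t (p ^ e)) (hN e he)
  gcongr

theorem tightCl_sub {R : Type*} [CommRing R] (p : ℕ) (I : Ideal R) (s : ℝ) :
    tightCl p I ⊆ weakCl p I s := by
  rintro x ⟨c, hc, N, hN⟩
  exact ⟨c, hc, N, fun e he => Submodule.mem_sup_right (hN e he)⟩

/-- if `I` has positive height and for every rational `s' ≥ 1` the weak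
`s'`-closure of `I` equals `I* + I_{s'}`, then for every real `s > 1` the weak closures are
left-stable at `s`: there is `ε > 0` with weak `t`-closure equal to weak `s`-closure for
all `t ∈ (s − ε, s)`. -/
theorem stmt16 {R : Type*} [CommRing R] [IsNoetherianRing R]
    (p : ℕ) (hp : p.Prime) (hcp : CharP R p)
    (I : Ideal R) (hIh : PosHeight I)
    (hdesc : ∀ s' : ℚ, 1 ≤ s' → weakCl p I ((s' : ℝ)) = tightCl p I + ratPow I s')
    (s : ℝ) (hs : 1 < s) :
    ∃ ε : ℝ, 0 < ε ∧ ∀ t : ℝ, s - ε < t → t < s → weakCl p I t = weakCl p I s := by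
  obtain ⟨ε, hε, hgap⟩ := ring_gap_unif I hIh s (by linarith)
  refine ⟨min ε (s - 1), lt_min hε (by linarith), fun t ht1 ht2 => ?_⟩
  refine Set.Subset.antisymm ?_ (weakCl_anti p I ht2.le)
  intro x hx
  have h1 : s - ε < t := by have := min_le_left ε (s - 1); linarith
  have h2 : 1 < t := by have := min_le_right ε (s - 1); linarith
  obtain ⟨s', hs1, hs2⟩ := exists_rat_btwn (max_lt h1 h2)
  obtain ⟨hs3, hs4⟩ := max_lt_iff.1 hs1
  have hs5 : (1 : ℚ) ≤ s' := by exact_mod_cast hs4.le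
  have hx' := weakCl_anti p I hs2.le hx
  rw [hdesc s' hs5] at hx'
  obtain ⟨y, hy, z, hz, rfl⟩ := Set.mem_add.1 hx'
  refine weakCl_add p hp hcp I s (tightCl_sub p I s hy) ?_
  refine weakCl_of_local p hp hcp I s z fun P hP => ?_
  obtain ⟨c, hc, N, hN⟩ := hz
  refine hgap P hP z s'.num.toNat s'.den s'.den_pos ?_ ⟨c, hc P hP, N, fun n hn => ?_⟩
  · have hnum : 0 ≤ s'.num := Rat.num_nonneg.2 (by linarith)
    have e1 : (s' : ℝ) * s'.den = s'.num := by exact_mod_cast Rat.mul_den_eq_num s'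
    have e2 : ((s'.num.toNat : ℕ) : ℝ) = s'.num := by
      exact_mod_cast Int.toNat_of_nonneg hnum
    rw [e2, ← e1]
    gcongr
  · have := hN n hn
    rwa [← pow_mul, ← pow_mul] at this
end

section
/- Let R be a commutative Noetherian ring of prime characteristic p > 0 graded by a commutative monoid G such that for every g ∈ G the graded piece R_g has length 1 as a module over R_0, and let I be a homogeneous ideal of R of positive height. Then for every rational s ≥ 1 the weak s-closure of I equals I* + I_s, and for every real s > 1 there exists ε > 0 such that for all real t with s − ε < t < s the weak t-closure of I equals the weak s-closure of I. -/
open Pointwise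

/-- dot product with natural weights -/
def wt {ι : Type*} [Fintype ι] (ω : ι → ℕ) (v : ι → ℚ) : ℚ := ∑ i, (ω i : ℚ) * v i

theorem wt_add_smul {ι : Type*} [Fintype ι] (ω : ι → ℕ) (v x : ι → ℚ) (τ : ℚ) :
    wt ω (v + τ • x) = wt ω v + τ * wt ω x := by
  simp only [wt, Pi.add_apply, Pi.smul_apply, smul_eq_mul, mul_add, Finset.sum_add_distrib,
    Finset.mul_sum]
  congr 1
  exact Finset.sum_congr rfl fun i _ => by ring

theorem wt_neg {ι : Type*} [Fintype ι] (ω : ι → ℕ) (x : ι → ℚ) : wt ω (-x) = - wt ω x := by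
  simp [wt]

/-- One step of support reduction, moving along `x` having a negative coordinate. -/
theorem lp_step {ι : Type*} [Fintype ι] (v x : ι → ℚ)
    (hv : ∀ i, 0 ≤ v i) (hx : ∀ i, v i = 0 → x i = 0) (hneg : ∃ i, x i < 0) :
    ∃ τ : ℚ, 0 ≤ τ ∧ (∀ i, 0 ≤ (v + τ • x) i) ∧
      (Finset.univ.filter fun i => (v + τ • x) i ≠ 0) ⊂ (Finset.univ.filter fun i => v i ≠ 0) := by
  classical
  obtain ⟨i0, hi0⟩ := hneg
  obtain ⟨j, hj, hmin⟩ := Finset.exists_min_image (Finset.univ.filter fun i => x i < 0)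
    (fun i => v i / (- x i)) ⟨i0, by simp [hi0]⟩
  have hxj : x j < 0 := by simpa using hj
  refine ⟨v j / (- x j), div_nonneg (hv j) (by linarith), ?_, ?_⟩
  · intro i
    simp only [Pi.add_apply, Pi.smul_apply, smul_eq_mul]
    have hτ : 0 ≤ v j / (- x j) := div_nonneg (hv j) (by linarith)
    by_cases hi : x i < 0
    · have := hmin i (by simp [hi])
      rw [le_div_iff₀ (by linarith)] at this
      linarith
    · have := mul_nonneg hτ (not_lt.1 hi)
      linarith [hv i]
  · rw [Finset.ssubset_iff_of_subset]
    · refine ⟨j, ?_, ?_⟩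
      · simp only [Finset.mem_filter, Finset.mem_univ, true_and]
        intro h
        rw [hx j h] at hxj
        exact lt_irrefl _ hxj
      · simp only [Finset.mem_filter, Finset.mem_univ, true_and, not_not, Pi.add_apply,
          Pi.smul_apply, smul_eq_mul]
        have : x j ≠ 0 := hxj.ne
        field_simp
        ring
    · intro i
      simp only [Finset.mem_filter, Finset.mem_univ, true_and, Pi.add_apply,
          Pi.smul_apply, smul_eq_mul]
      intro h h0
      apply h
      rw [h0, hx i h0]
      simp

theorem lp_reduce {ι : Type*} [Fintype ι] (X : Submodule ℚ (ι → ℚ)) (ω : ι → ℕ) (s : ℚ)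
    (b : ι → ℚ) : ∀ (N : ℕ) (v : ι → ℚ), (Finset.univ.filter fun i => v i ≠ 0).card ≤ N →
      (∀ i, 0 ≤ v i) → b - v ∈ X →
      ∃ v' : ι → ℚ, (∀ i, 0 ≤ v' i) ∧ b - v' ∈ X ∧ (s ≤ wt ω v' ∨ (wt ω v ≤ wt ω v' ∧
        ∀ x ∈ X, (∀ i, v' i = 0 → x i = 0) → x = 0)) := by
  classical
  intro N
  induction N with
  | zero =>
    intro v hN hv hb
    refine ⟨v, hv, hb, Or.inr ⟨le_rfl, fun x _ h => ?_⟩⟩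
    have h0 : ∀ i, v i = 0 := by
      simpa [Finset.filter_eq_empty_iff] using hN
    funext i
    exact h i (h0 i)
  | succ N ih =>
    intro v hN hv hb
    by_cases hind : ∀ x ∈ X, (∀ i, v i = 0 → x i = 0) → x = 0
    · exact ⟨v, hv, hb, Or.inr ⟨le_rfl, hind⟩⟩
    push Not at hind
    obtain ⟨x, hxX, hxs, hx0⟩ := hind
    -- moving
    have move : ∀ y ∈ X, (∀ i, v i = 0 → y i = 0) → 0 ≤ wt ω y → (∃ i, y i < 0) →
        ∃ v' : ι → ℚ, (∀ i, 0 ≤ v' i) ∧ b - v' ∈ X ∧ (s ≤ wt ω v' ∨ (wt ω v ≤ wt ω v' ∧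
        ∀ x ∈ X, (∀ i, v' i = 0 → x i = 0) → x = 0)) := by
      intro y hyX hys hwy hneg
      obtain ⟨τ, hτ, h1, h2⟩ := lp_step v y hv hys hneg
      have hc := Finset.card_lt_card h2
      obtain ⟨v', a1, a2, a3⟩ := ih (v + τ • y) (by omega) h1 (by
        have : b - (v + τ • y) = (b - v) - τ • y := by abel
        rw [this]
        exact X.sub_mem hb (X.smul_mem _ hyX))
      refine ⟨v', a1, a2, a3.imp id fun h => ⟨?_, h.2⟩⟩
      have := h.1
      rw [wt_add_smul] at this
      nlinarith [mul_nonneg hτ hwy]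
    -- large
    have large : ∀ y ∈ X, (∀ i, 0 ≤ y i) → 0 < wt ω y →
        ∃ v' : ι → ℚ, (∀ i, 0 ≤ v' i) ∧ b - v' ∈ X ∧ (s ≤ wt ω v' ∨ (wt ω v ≤ wt ω v' ∧
        ∀ x ∈ X, (∀ i, v' i = 0 → x i = 0) → x = 0)) := by
      intro y hyX hy hwy
      refine ⟨v + (|s| / wt ω y) • y, ?_, ?_, Or.inl ?_⟩
      · intro i
        have := mul_nonneg (div_nonneg (abs_nonneg s) hwy.le) (hy i)
        simp only [Pi.add_apply, Pi.smul_apply, smul_eq_mul]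
        linarith [hv i]
      · have : b - (v + (|s| / wt ω y) • y) = (b - v) - (|s| / wt ω y) • y := by abel
        rw [this]
        exact X.sub_mem hb (X.smul_mem _ hyX)
      · rw [wt_add_smul, div_mul_cancel₀ _ hwy.ne']
        have : 0 ≤ wt ω v := Finset.sum_nonneg fun i _ => mul_nonneg (by positivity) (hv i)
        linarith [le_abs_self s]
    have key : ∀ y ∈ X, (∀ i, v i = 0 → y i = 0) → 0 < wt ω y →
        ∃ v' : ι → ℚ, (∀ i, 0 ≤ v' i) ∧ b - v' ∈ X ∧ (s ≤ wt ω v' ∨ (wt ω v ≤ wt ω v' ∧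
        ∀ x ∈ X, (∀ i, v' i = 0 → x i = 0) → x = 0)) := by
      intro y h1 h2 h3
      by_cases hn : ∃ i, y i < 0
      · exact move y h1 h2 h3.le hn
      · push Not at hn
        exact large y h1 hn h3
    rcases lt_trichotomy (wt ω x) 0 with h | h | h
    · exact key (-x) (X.neg_mem hxX) (fun i hi => by simp [hxs i hi]) (by rw [wt_neg]; linarith)
    · by_cases hn : ∃ i, x i < 0
      · exact move x hxX hxs h.ge hn
      · push Not at hn
        refine move (-x) (X.neg_mem hxX) (fun i hi => by simp [hxs i hi])
          (by rw [wt_neg]; linarith) ?_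
        by_contra hc
        push Not at hc
        apply hx0
        funext i
        have h1 := hc i
        have h2 := hn i
        simp only [Pi.neg_apply] at h1
        simp only [Pi.zero_apply]
        linarith
    · exact key x hxX hxs h

theorem common_den {ι : Type*} [Finite ι] (f : ι → ℚ) :
    ∃ D : ℕ, 0 < D ∧ ∀ i, ∃ z : ℤ, (D : ℚ) * f i = z := by
  classical
  have := Fintype.ofFinite ι
  refine ⟨∏ i, (f i).den, Finset.prod_pos fun i _ => (f i).den_pos, fun i => ?_⟩
  obtain ⟨c, hc⟩ := Finset.dvd_prod_of_mem (fun i => (f i).den) (Finset.mem_univ i)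
  refine ⟨c * (f i).num, ?_⟩
  rw [hc]
  push_cast
  have h := Rat.mul_den_eq_num (f i)
  rw [← h]
  ring

theorem lp_den {ι : Type*} [Fintype ι] (X : Submodule ℚ (ι → ℚ)) (σ : Finset ι) :
    ∃ D : ℕ, 0 < D ∧ ((∀ x ∈ X, (∀ i, i ∉ σ → x i = 0) → x = 0) →
      ∀ (b : ι → ℤ) (v : ι → ℚ), (∀ i, i ∉ σ → v i = 0) → (fun i => (b i : ℚ)) - v ∈ X →
        ∀ j, ∃ z : ℤ, (D : ℚ) * v j = z) := by
  classical
  by_cases hind : (∀ x ∈ X, (∀ i, i ∉ σ → x i = 0) → x = 0)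
  swap
  · exact ⟨1, one_pos, fun h => (hind h).elim⟩
  let Y : Submodule ℚ (ι → ℚ) :=
    { carrier := {v | ∀ i, i ∉ σ → v i = 0}
      add_mem' := fun ha hb i hi => by simp [ha i hi, hb i hi]
      zero_mem' := fun i _ => rfl
      smul_mem' := fun c x hx i hi => by simp [hx i hi] }
  have hd : Disjoint X Y := by
    rw [Submodule.disjoint_def]
    exact fun x hx hy => hind x hx hy
  obtain ⟨Z, hXZ, hZ⟩ := hd.exists_isCompl
  let ψ := Y.projection Z hZ.symm
  have hψY : ∀ v ∈ Y, ψ v = v := fun v hv =>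
    Submodule.projection_apply_left hZ.symm ⟨v, hv⟩
  have hψX : ∀ v ∈ X, ψ v = 0 := fun v hv => by
    rw [Submodule.projection_apply_eq_zero_iff]; exact hXZ hv
  obtain ⟨D, hD, hD'⟩ := common_den (fun k : ι × ι => ψ (Pi.single k.1 1) k.2)
  refine ⟨D, hD, fun _ b v hv hb j => ?_⟩
  have h1 : v = ψ (fun i => (b i : ℚ)) := by
    have := hψX _ hb
    rw [map_sub, hψY v hv, sub_eq_zero] at this
    exact this.symm
  have h2 : (fun i => (b i : ℚ)) = ∑ i, (b i : ℚ) • (Pi.single i (1 : ℚ) : ι → ℚ) := by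
    funext k
    simp [Finset.sum_apply, Pi.single_apply]
  choose z hz using hD'
  refine ⟨∑ i, b i * z (i, j), ?_⟩
  rw [h1, h2]
  simp only [map_sum, map_smul, Finset.sum_apply, Pi.smul_apply, smul_eq_mul, Finset.mul_sum]
  push_cast
  refine Finset.sum_congr rfl fun i _ => ?_
  rw [← hz (i, j)]
  ring

/-- Discreteness of the values of an integral linear program. -/
theorem lp_main {ι : Type*} [Fintype ι] (K : AddSubgroup (ι → ℤ)) (ω : ι → ℕ) (s : ℝ) :
    ∃ ε : ℝ, 0 < ε ∧ ∀ b : ι → ℤ,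
      (∃ n : ℕ, 0 < n ∧ ∃ ν : ι → ℕ, (n • b - fun i => (ν i : ℤ)) ∈ K ∧
        (s - ε) * n < ((∑ i, ω i * ν i : ℕ) : ℝ)) →
      (∃ n : ℕ, 0 < n ∧ ∃ ν : ι → ℕ, (n • b - fun i => (ν i : ℤ)) ∈ K ∧
        s * n ≤ ((∑ i, ω i * ν i : ℕ) : ℝ)) := by
  classical
  let X : Submodule ℚ (ι → ℚ) :=
    { carrier := {x | ∃ n : ℕ, 0 < n ∧ ∃ κ ∈ K, ∀ i, (n : ℚ) * x i = (κ i : ℚ)}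
      add_mem' := by
        rintro x y ⟨n, hn, κ, hκ, h⟩ ⟨n', hn', κ', hκ', h'⟩
        refine ⟨n * n', by positivity, n' • κ + n • κ',
          K.add_mem (K.nsmul_mem hκ _) (K.nsmul_mem hκ' _), fun i => ?_⟩
        simp only [Pi.add_apply, Pi.smul_apply]
        simp only [nsmul_eq_mul]
        push_cast
        rw [← h i, ← h' i]
        ring
      zero_mem' := ⟨1, one_pos, 0, K.zero_mem, fun i => by simp⟩
      smul_mem' := by
        rintro c x ⟨n, hn, κ, hκ, h⟩
        refine ⟨n * c.den, Nat.mul_pos hn c.den_pos, c.num • κ, K.zsmul_mem hκ _, fun i => ?_⟩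
        simp only [Pi.smul_apply, smul_eq_mul]
        push_cast
        rw [← h i, ← Rat.mul_den_eq_num c]
        ring }
  choose D hD hD' using fun σ : Finset ι => lp_den X σ
  obtain ⟨E, hE, hEdvd⟩ : ∃ E : ℕ, 0 < E ∧ ∀ σ, D σ ∣ E :=
    ⟨∏ σ, D σ, Finset.prod_pos fun σ _ => hD σ, fun σ => Finset.dvd_prod_of_mem _ (Finset.mem_univ _)⟩
  have hEr : (0 : ℝ) < E := by exact_mod_cast hE
  refine ⟨s - (⌈s * E⌉ - 1) / E, ?_, ?_⟩
  · have := Int.ceil_lt_add_one (s * E)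
    rw [sub_pos, div_lt_iff₀ hEr]
    linarith
  rintro b ⟨n, hn, ν, hK, hlt⟩
  obtain ⟨s', hs'⟩ := exists_rat_gt s
  have hnq : (0 : ℚ) < n := by exact_mod_cast hn
  obtain ⟨v', h1, h2, h3⟩ := lp_reduce X ω s' (fun i => (b i : ℚ)) _ (fun i => (ν i : ℚ) / n) le_rfl
    (fun i => by positivity) ⟨n, hn, _, hK, fun i => by
      simp only [Pi.sub_apply, Pi.smul_apply]
      simp only [nsmul_eq_mul]
      push_cast
      field_simp⟩
  have h4 : s ≤ ((wt ω v' : ℚ) : ℝ) := by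
    rcases h3 with h3 | ⟨h3, h5⟩
    · have : (s' : ℝ) ≤ ((wt ω v' : ℚ) : ℝ) := by exact_mod_cast h3
      linarith
    · have h6 := hD' (Finset.univ.filter fun i => v' i ≠ 0)
        (fun x hx hh => h5 x hx fun i hi => hh i (by simp [hi])) b v'
        (fun i hi => by simpa using hi) h2
      have h7 : ∃ z : ℤ, (E : ℚ) * wt ω v' = z := by
        choose z hz using h6
        obtain ⟨c, hc⟩ := hEdvd (Finset.univ.filter fun i => v' i ≠ 0)
        refine ⟨∑ i, c * ω i * z i, ?_⟩
        simp only [wt, Finset.mul_sum]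
        push_cast
        refine Finset.sum_congr rfl fun i _ => ?_
        rw [← hz i, hc]
        push_cast
        ring
      obtain ⟨z, hz⟩ := h7
      have hzr : (E : ℝ) * ((wt ω v' : ℚ) : ℝ) = z := by exact_mod_cast hz
      have h8 : wt ω (fun i => (ν i : ℚ) / n) = ((∑ i, ω i * ν i : ℕ) : ℚ) / n := by
        simp only [wt]
        push_cast
        rw [Finset.sum_div]
        exact Finset.sum_congr rfl fun i _ => by ring
      rw [h8, div_le_iff₀ hnq] at h3
      have h9 : ((∑ i, ω i * ν i : ℕ) : ℝ) ≤ ((wt ω v' : ℚ) : ℝ) * n := by exact_mod_cast h3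
      have hnr : (0 : ℝ) < n := by exact_mod_cast hn
      have h10 : (⌈s * E⌉ - 1 : ℝ) / E < ((wt ω v' : ℚ) : ℝ) := by
        have := hlt.trans_le h9
        have h11 := lt_of_mul_lt_mul_right this hnr.le
        linarith
      rw [div_lt_iff₀ hEr, mul_comm ((wt ω v' : ℚ) : ℝ) (E : ℝ), hzr] at h10
      have h12 : ⌈s * E⌉ ≤ z := by
        have : (⌈s * E⌉ - 1 : ℤ) < z := by exact_mod_cast h10
        omega
      have h13 : s * E ≤ z := Int.ceil_le.1 h12
      rw [← hzr, mul_comm] at h13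
      exact le_of_mul_le_mul_left h13 hEr
  obtain ⟨m, hm, κ, hκ, hmκ⟩ := h2
  obtain ⟨d, hd, hdv⟩ := common_den v'
  choose z hz using hdv
  have hz0 : ∀ i, 0 ≤ z i := fun i => by
    have : (0 : ℚ) ≤ z i := by rw [← hz i]; exact mul_nonneg (by positivity) (h1 i)
    exact_mod_cast this
  have hzn : ∀ i, ((z i).toNat : ℚ) = d * v' i := fun i => by
    rw [hz i]; exact_mod_cast congrArg (Int.cast : ℤ → ℚ) (Int.toNat_of_nonneg (hz0 i))
  refine ⟨m * d, by positivity, fun i => m * (z i).toNat, ?_, ?_⟩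
  · have : ((m * d) • b - fun i => ((m * (z i).toNat : ℕ) : ℤ)) = d • κ := by
      funext i
      have h := hmκ i
      simp only [Pi.sub_apply] at h
      have : (((m * d : ℕ) • b - fun i => ((m * (z i).toNat : ℕ) : ℤ)) i : ℚ) = ((d • κ) i : ℤ) := by
        simp only [Pi.sub_apply, Pi.smul_apply]
        simp only [nsmul_eq_mul]
        push_cast
        rw [← h]
        have h' := hzn i
        rw [h']
        ring
      exact_mod_cast this
    rw [this]
    exact K.nsmul_mem hκ _
  · have : ((∑ i, ω i * (m * (z i).toNat) : ℕ) : ℚ) = wt ω v' * (m * d : ℕ) := by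
      simp only [wt]
      push_cast
      rw [Finset.sum_mul]
      refine Finset.sum_congr rfl fun i _ => ?_
      rw [hzn i]
      ring
    have h' : ((∑ i, ω i * (m * (z i).toNat) : ℕ) : ℝ) = ((wt ω v' : ℚ) : ℝ) * (m * d : ℕ) := by
      exact_mod_cast this
    rw [h']
    exact mul_le_mul_of_nonneg_right h4 (by positivity)

theorem grp_aux1 {Γ : Type*} [CommGroup Γ] (A B C u : Γ) (n : ℕ) :
    B ^ n / C / A = ((u / B)⁻¹) ^ n * (u ^ n / A / C) := by
  have h : ∀ {Δ : Type _} [AddCommGroup Δ] (A B C u : Δ),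
      n • B - C - A = n • (-(u - B)) + (n • u - A - C) := by
    intro Δ _ A B C u
    rw [smul_neg, smul_sub]; abel
  exact h (Δ := Additive Γ) A B C u

theorem grp_aux2 {Γ : Type*} [CommGroup Γ] (A B C u : Γ) (n : ℕ) :
    u ^ n / A = (u / B) ^ n * (B ^ n / C / A) * C := by
  have h : ∀ {Δ : Type _} [AddCommGroup Δ] (A B C u : Δ),
      n • u - A = n • (u - B) + (n • B - C - A) + C := by
    intro Δ _ A B C u
    rw [smul_sub]; abel
  exact h (Δ := Additive Γ) A B C u

theorem lemE_fact {Γ : Type*} [CommGroup Γ] (H : Submonoid Γ)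
    (wqo : ∀ f : ℕ → Γ, (∀ n, f n ∈ H) → ∃ i j, i < j ∧ f j / f i ∈ H) :
    ∃ Z : Finset Γ, (∀ z ∈ Z, z ∈ H) ∧ ∀ h ∈ H, ∃ b : Z → ℕ,
      h / ∏ z : Z, (z : Γ) ^ b z ∈ H ∧ (h / ∏ z : Z, (z : Γ) ^ b z)⁻¹ ∈ H := by
  classical
  obtain ⟨Z, hZ, hZ'⟩ : ∃ Z : Finset Γ, (∀ z ∈ Z, z ∈ H ∧ z⁻¹ ∉ H) ∧
      ∀ y, y ∈ H → y⁻¹ ∉ H → ∃ z ∈ Z, y / z ∈ H := by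
    by_contra hcon
    push Not at hcon
    obtain ⟨f, hf, hf'⟩ := exists_seq_of_forall_finset_exists
      (fun y : Γ => y ∈ H ∧ y⁻¹ ∉ H) (fun x y => y / x ∉ H) (fun Z hZ => by
        obtain ⟨y, h1, h2, h3⟩ := hcon Z hZ
        exact ⟨y, ⟨h1, h2⟩, h3⟩)
    obtain ⟨i, j, hij, h⟩ := wqo f fun n => (hf n).1
    exact hf' i j hij h
  have wf : WellFounded (fun y x : Γ => x ∈ H ∧ y ∈ H ∧ x / y ∈ H ∧ y / x ∉ H) := by
    rw [wellFounded_iff_isEmpty_descending_chain]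
    refine ⟨fun ⟨f, hf⟩ => ?_⟩
    obtain ⟨i, j, hij, h⟩ := wqo f fun n => (hf n).1
    have key : ∀ k, f (i + 1) / f (i + 1 + k) ∈ H := by
      intro k
      induction k with
      | zero => simp
      | succ k ih =>
        have := H.mul_mem ih (hf (i + 1 + k)).2.2.1
        rwa [div_mul_div_cancel] at this
    obtain ⟨k, rfl⟩ := Nat.exists_eq_add_of_le (Nat.succ_le_of_lt hij)
    have := H.mul_mem (key k) h
    rw [Nat.succ_eq_add_one, div_mul_div_cancel] at this
    exact (hf i).2.2.2 this
  refine ⟨Z, fun z hz => (hZ z hz).1, fun h => ?_⟩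
  induction h using wf.induction with
  | _ h ih =>
    intro hh
    by_cases hu : h⁻¹ ∈ H
    · exact ⟨0, by simpa using hh, by simpa using hu⟩
    · obtain ⟨z, hz, hd⟩ := hZ' h hh hu
      obtain ⟨b, hb1, hb2⟩ := ih (h / z) ⟨hh, hd, by simpa using (hZ z hz).1,
        by simpa using (hZ z hz).2⟩ hd
      have hprod : ∏ x : Z, (x : Γ) ^ (b + Pi.single ⟨z, hz⟩ 1 : Z → ℕ) x
          = z * ∏ x : Z, (x : Γ) ^ b x := by
        simp only [Pi.add_apply, pow_add, Finset.prod_mul_distrib]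
        rw [mul_comm]
        congr 1
        rw [Finset.prod_eq_single ⟨z, hz⟩]
        · simp
        · intro x _ hx
          simp [hx]
        · simp
      refine ⟨b + Pi.single ⟨z, hz⟩ 1, ?_, ?_⟩
      · rw [hprod, ← div_div]; exact hb1
      · rw [hprod, ← div_div]; exact hb2

theorem lemE {Γ : Type*} [CommGroup Γ] (H : Submonoid Γ)
    (wqo : ∀ f : ℕ → Γ, (∀ n, f n ∈ H) → ∃ i j, i < j ∧ f j / f i ∈ H)
    {ι : Type*} [Fintype ι] (a : ι → Γ) (s : ℝ) :
    ∃ ε : ℝ, 0 < ε ∧ ∀ u ∈ H,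
      (∃ n : ℕ, 0 < n ∧ ∃ β : ι → ℕ, u ^ n / ∏ i, a i ^ β i ∈ H ∧
        (s - ε) * n < ((∑ i, β i : ℕ) : ℝ)) →
      (∃ n : ℕ, 0 < n ∧ ∃ β : ι → ℕ, u ^ n / ∏ i, a i ^ β i ∈ H ∧
        s * n ≤ ((∑ i, β i : ℕ) : ℝ)) := by
  classical
  obtain ⟨Z, hZ, hfac⟩ := lemE_fact H wqo
  let gen : Z ⊕ ι → Γ := Sum.elim (fun z => (z : Γ)) a
  let K : AddSubgroup (Z ⊕ ι → ℤ) :=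
    { carrier := {κ | ∏ i, gen i ^ κ i ∈ H ∧ (∏ i, gen i ^ κ i)⁻¹ ∈ H}
      add_mem' := by
        rintro x y ⟨h1, h2⟩ ⟨h3, h4⟩
        simp only [Set.mem_ofPred_eq, Pi.add_apply, zpow_add, Finset.prod_mul_distrib, mul_inv]
        exact ⟨H.mul_mem h1 h3, H.mul_mem h2 h4⟩
      zero_mem' := by simp
      neg_mem' := by
        rintro x ⟨h1, h2⟩
        simp only [Set.mem_ofPred_eq, Pi.neg_apply, zpow_neg, Finset.prod_inv_distrib, inv_inv]
        exact ⟨h2, h1⟩ }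
  obtain ⟨ε, hε, hlp⟩ := lp_main K (Sum.elim 0 1) s
  have hgen : ∀ (n : ℕ) (b c : Z → ℕ) (β : ι → ℕ),
      ∏ i, gen i ^ (n • (fun i => ((Sum.elim b 0 : Z ⊕ ι → ℕ) i : ℤ)) -
        fun i => ((Sum.elim c β : Z ⊕ ι → ℕ) i : ℤ)) i =
      (∏ z : Z, (z : Γ) ^ b z) ^ n / (∏ z : Z, (z : Γ) ^ c z) / ∏ i, a i ^ β i := by
    intro n b c β
    simp only [Pi.sub_apply, Pi.smul_apply, Fintype.prod_sum_type, gen, Sum.elim_inl,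
      Sum.elim_inr, zpow_sub, zpow_natCast, Pi.zero_apply, Nat.cast_zero, smul_zero, zpow_zero,
      Finset.prod_const_one, one_mul, Finset.prod_mul_distrib, Finset.prod_inv_distrib,
      div_eq_mul_inv, mul_inv, mul_assoc]
    congr 1
    rw [← Finset.prod_pow]
    refine Finset.prod_congr rfl fun z _ => ?_
    rw [nsmul_eq_mul, mul_comm, zpow_mul, zpow_natCast, zpow_natCast]
  refine ⟨ε, hε, ?_⟩
  rintro u hu ⟨n, hn, β, hβ, hlt⟩
  obtain ⟨b, hb1, hb2⟩ := hfac u hu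
  obtain ⟨c, hc1, hc2⟩ := hfac _ hβ
  obtain ⟨n', hn', ν, hν, hle⟩ := hlp (fun i => ((Sum.elim b 0 : Z ⊕ ι → ℕ) i : ℤ))
    ⟨n, hn, Sum.elim c β, by
      change _ ∧ _
      rw [hgen]
      have e : (∏ z : Z, (z : Γ) ^ b z) ^ n / (∏ z : Z, (z : Γ) ^ c z) / ∏ i, a i ^ β i =
        ((u / ∏ z : Z, (z : Γ) ^ b z)⁻¹) ^ n * (u ^ n / (∏ i, a i ^ β i) / (∏ z : Z, (z : Γ) ^ c z)) := grp_aux1 _ _ _ _ _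
      rw [e, mul_inv, ← inv_pow, inv_inv]
      exact ⟨H.mul_mem (H.pow_mem hb2 _) hc1, H.mul_mem (H.pow_mem hb1 _) hc2⟩, by
      simpa [Fintype.sum_sum_type] using hlt⟩
  refine ⟨n', hn', fun i => ν (Sum.inr i), ?_, ?_⟩
  · have e1 : ν = Sum.elim (fun i => ν (Sum.inl i)) (fun i => ν (Sum.inr i)) := by
      funext i; cases i <;> rfl
    rw [e1] at hν
    have hν1 := hν.1
    rw [hgen] at hν1
    have := H.mul_mem (H.mul_mem (H.pow_mem hb1 n') hν1)
      (H.prod_mem (t := Finset.univ) (f := fun z : Z => (z : Γ) ^ ν (Sum.inl z))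
        fun z _ => H.pow_mem (hZ z z.2) _)
    convert this using 1
    exact grp_aux2 _ _ _ _ _
  · simpa [Fintype.sum_sum_type] using hle

open DirectSum

/-- each graded piece is spanned over the degree zero part by any nonzero element -/
def OneDim {R G : Type*} [AddCommMonoid G] [CommRing R] (𝒜 : G → AddSubgroup R) : Prop :=
  ∀ g, ∀ y ∈ 𝒜 g, y ≠ 0 → ∀ z ∈ 𝒜 g, ∃ l ∈ 𝒜 0, z = l * y

section graded
variable {R G : Type*} [AddCommMonoid G] [DecidableEq G] [CommRing R]
  (𝒜 : G → AddSubgroup R) [GradedRing 𝒜]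

theorem oneDim_of_len (hlen : ∀ g : G, (𝒜 g : Set R) ≠ {0} ∧ ∀ M : AddSubgroup R,
      (M : Set R) ⊆ (𝒜 g : Set R) → (∀ a ∈ 𝒜 (0 : G), ∀ m ∈ M, a * m ∈ M) →
      (M : Set R) = {0} ∨ (M : Set R) = (𝒜 g : Set R)) : OneDim 𝒜 := by
  intro g y hy hy0 z hz
  let M : AddSubgroup R :=
    { carrier := {x | ∃ l ∈ 𝒜 0, x = l * y}
      add_mem' := by
        rintro _ _ ⟨a, ha, rfl⟩ ⟨b, hb, rfl⟩
        exact ⟨a + b, add_mem ha hb, by ring⟩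
      zero_mem' := ⟨0, zero_mem _, by simp⟩
      neg_mem' := by
        rintro _ ⟨a, ha, rfl⟩
        exact ⟨-a, neg_mem ha, by ring⟩ }
  have hone : (1 : R) ∈ 𝒜 0 := SetLike.GradedOne.one_mem
  have hyM : y ∈ M := ⟨1, hone, by simp⟩
  rcases (hlen g).2 M (by
    rintro _ ⟨l, hl, rfl⟩
    have := SetLike.GradedMul.mul_mem hl hy
    rwa [zero_add] at this) (by
    rintro a ha _ ⟨l, hl, rfl⟩
    have := SetLike.GradedMul.mul_mem ha hl
    rw [zero_add] at this
    exact ⟨a * l, this, by ring⟩) with h | h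
  · have : y ∈ (M : Set R) := hyM
    rw [h] at this
    exact (hy0 this).elim
  · have : z ∈ (M : Set R) := by rw [h]; exact hz
    exact this

theorem hom_mul {x y : R} (hx : SetLike.IsHomogeneousElem 𝒜 x)
    (hy : SetLike.IsHomogeneousElem 𝒜 y) : SetLike.IsHomogeneousElem 𝒜 (x * y) := hx.mul hy

theorem hom_pow {x : R} (hx : SetLike.IsHomogeneousElem 𝒜 x) (n : ℕ) :
    SetLike.IsHomogeneousElem 𝒜 (x ^ n) := by
  obtain ⟨i, hi⟩ := hx
  exact ⟨n • i, SetLike.pow_mem_graded n hi⟩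

theorem hom_one : SetLike.IsHomogeneousElem 𝒜 (1 : R) := ⟨0, SetLike.GradedOne.one_mem⟩

theorem hom_prod {ι : Type*} (s : Finset ι) (f : ι → R)
    (h : ∀ i ∈ s, SetLike.IsHomogeneousElem 𝒜 (f i)) :
    SetLike.IsHomogeneousElem 𝒜 (∏ i ∈ s, f i) := by
  classical
  induction s using Finset.induction_on with
  | empty => simpa using hom_one 𝒜
  | insert a s ha ih =>
    rw [Finset.prod_insert ha]
    exact (h a (by simp)).mul (ih fun i hi => h i (by simp [hi]))

theorem zero_inv (hk : OneDim 𝒜) {l : R} (hl : l ∈ 𝒜 0) (h0 : l ≠ 0) :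
    ∃ l' ∈ 𝒜 0, l' * l = 1 := by
  obtain ⟨l', h, h'⟩ := hk 0 l hl h0 1 SetLike.GradedOne.one_mem
  exact ⟨l', h, h'.symm⟩

theorem decomp_sum {κ : Type*} (S : Finset κ) (r : κ → R) (d : κ → G)
    (hr : ∀ k ∈ S, r k ∈ 𝒜 (d k)) (g : G) :
    (decompose 𝒜 (∑ k ∈ S, r k) g : R) = ∑ k ∈ S with d k = g, r k := by
  rw [decompose_sum, DFinsupp.finsetSum_apply, AddSubgroup.val_finsetSum, Finset.sum_filter]
  refine Finset.sum_congr rfl fun k hk => ?_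
  split_ifs with h
  · subst h
    exact decompose_of_mem_same 𝒜 (hr k hk)
  · exact decompose_of_mem_ne 𝒜 (hr k hk) h

theorem component_lemma (hk : OneDim 𝒜) {κ : Type*} (S : Finset κ) (r : κ → R) (d : κ → G)
    (hr : ∀ k ∈ S, r k ∈ 𝒜 (d k)) (J b : Ideal R) (hJ : J.IsHomogeneous 𝒜)
    (hrJ : ∑ k ∈ S, r k ∈ J) (hrb : ∑ k ∈ S, r k ∉ b) :
    ∃ k ∈ S, r k ∈ J ∧ r k ∉ b := by
  classical
  obtain ⟨g, hg⟩ : ∃ g, (decompose 𝒜 (∑ k ∈ S, r k) g : R) ∉ b := by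
    by_contra hcon
    push Not at hcon
    apply hrb
    rw [← sum_support_decompose 𝒜 (∑ k ∈ S, r k)]
    exact Ideal.sum_mem _ fun g _ => hcon g
  have hg' := hg
  rw [decomp_sum 𝒜 S r d hr] at hg
  obtain ⟨k, hkS, hkb⟩ : ∃ k ∈ S.filter (fun k => d k = g), r k ∉ b := by
    by_contra hcon
    push Not at hcon
    exact hg (Ideal.sum_mem _ hcon)
  rw [Finset.mem_filter] at hkS
  have hne : (decompose 𝒜 (∑ k ∈ S, r k) g : R) ≠ 0 := fun h => hg' (h ▸ b.zero_mem)
  obtain ⟨l, _, hl⟩ := hk g _ (SetLike.coe_mem _) hne (r k) (hkS.2 ▸ hr k hkS.1)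
  exact ⟨k, hkS.1, hl ▸ J.mul_mem_left _ (hJ g hrJ), hkb⟩

theorem lemma_one (hk : OneDim 𝒜) (T : Set R) (hT : ∀ τ ∈ T, SetLike.IsHomogeneousElem 𝒜 τ)
    {e : R} (he : SetLike.IsHomogeneousElem 𝒜 e) (he0 : e ≠ 0) (heT : e ∈ Ideal.span T) :
    ∃ τ ∈ T, ∃ d, SetLike.IsHomogeneousElem 𝒜 d ∧ e = d * τ := by
  classical
  obtain ⟨n, f, t, h⟩ := Submodule.mem_span_set'.1 heT
  choose dt hdt using fun i => hT (t i) (t i).2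
  let S : Finset (Σ _ : Fin n, G) := Finset.univ.sigma fun i => (decompose 𝒜 (f i)).support
  have hsum : ∑ k ∈ S, (decompose 𝒜 (f k.1) k.2 : R) * t k.1 = e := by
    rw [Finset.sum_sigma, ← h]
    refine Finset.sum_congr rfl fun i _ => ?_
    simp only
    rw [← Finset.sum_mul, sum_support_decompose 𝒜 (f i), smul_eq_mul]
  obtain ⟨g, hg⟩ := he
  have h1 := decomp_sum 𝒜 S (fun k => (decompose 𝒜 (f k.1) k.2 : R) * t k.1)
    (fun k => k.2 + dt k.1) (fun k _ => SetLike.GradedMul.mul_mem (SetLike.coe_mem _) (hdt _)) g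
  rw [hsum, decompose_of_mem_same 𝒜 hg] at h1
  obtain ⟨k, hkS, hk0⟩ := Finset.exists_ne_zero_of_sum_ne_zero (h1 ▸ he0)
  rw [Finset.mem_filter] at hkS
  obtain ⟨l, hl, hle⟩ := hk g _ (hkS.2 ▸ SetLike.GradedMul.mul_mem (SetLike.coe_mem _) (hdt _)) hk0 e hg
  exact ⟨t k.1, (t k.1).2, l * (decompose 𝒜 (f k.1) k.2 : R),
    SetLike.IsHomogeneousElem.mul ⟨0, hl⟩ ⟨k.2, SetLike.coe_mem _⟩, by rw [hle, mul_assoc]⟩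

/-- ideal generated by homogeneous elements dividing no power of `u` -/
def mI (u : R) : Ideal R :=
  Ideal.span {e | SetLike.IsHomogeneousElem 𝒜 e ∧ ∀ n : ℕ, ¬ e ∣ u ^ n}

theorem mI_hom (u : R) : (mI 𝒜 u).IsHomogeneous 𝒜 :=
  Ideal.homogeneous_span 𝒜 _ fun _ h => h.1

theorem mem_mI_iff (hk : OneDim 𝒜) {u : R} (hu : ¬ IsNilpotent u) {e : R}
    (he : SetLike.IsHomogeneousElem 𝒜 e) : e ∈ mI 𝒜 u ↔ ∀ n : ℕ, ¬ e ∣ u ^ n := by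
  refine ⟨fun h n hn => ?_, fun h => Ideal.subset_span ⟨he, h⟩⟩
  by_cases h0 : e = 0
  · subst h0
    exact hu ⟨n, zero_dvd_iff.1 hn⟩
  · obtain ⟨τ, hτ, d, _, rfl⟩ := lemma_one 𝒜 hk _ (fun _ h => h.1) he h0 h
    exact hτ.2 n ((Dvd.intro_left d rfl).trans hn)

end graded

theorem krull_K1 {R : Type*} [CommRing R] [IsNoetherianRing R] (P Q : Ideal R) [hP : P.IsPrime]
    [hQ : Q.IsPrime] (hPQ : P ≤ Q) {C : R} (hC : C ∉ P) :
    ∃ (b : Ideal R) (N : ℕ), P ≤ b ∧ Q ^ N ≤ b ∧ C ∉ b ∧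
      ∀ r x, x ∉ Q → r * x ∈ b → r ∈ b := by
  let Q' := Q.map (Ideal.Quotient.mk P)
  have hQ' : Q'.IsPrime := Ideal.map_isPrime_of_surjective Ideal.Quotient.mk_surjective
    (by rwa [Ideal.mk_ker])
  have hcm : Q'.comap (Ideal.Quotient.mk P) = Q := by
    rw [Ideal.comap_map_of_surjective _ Ideal.Quotient.mk_surjective, ← RingHom.ker_eq_comap_bot,
      Ideal.mk_ker]
    exact sup_eq_left.2 hPQ
  let L := Localization.AtPrime Q'
  let φ : R →+* L := (algebraMap (R ⧸ P) L).comp (Ideal.Quotient.mk P)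
  have hinj : Function.Injective (algebraMap (R ⧸ P) L) :=
    IsLocalization.injective L (Ideal.primeCompl_le_nonZeroDivisors Q')
  have hφC : φ C ≠ 0 := by
    intro h
    have : algebraMap (R ⧸ P) L (Ideal.Quotient.mk P C) = algebraMap (R ⧸ P) L 0 := by
      rw [map_zero]; exact h
    exact hC (Ideal.Quotient.eq_zero_iff_mem.1 (hinj this))
  have hinf := Ideal.iInf_pow_eq_bot_of_isLocalRing (IsLocalRing.maximalIdeal L)
    (Ideal.IsPrime.ne_top inferInstance)
  obtain ⟨N, hN⟩ : ∃ N, φ C ∉ IsLocalRing.maximalIdeal L ^ N := by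
    by_contra hcon
    push Not at hcon
    have : φ C ∈ ⨅ i, IsLocalRing.maximalIdeal L ^ i := by simpa [Ideal.mem_iInf] using hcon
    rw [hinf] at this
    exact hφC this
  refine ⟨(IsLocalRing.maximalIdeal L ^ N).comap φ, N, ?_, ?_, hN, ?_⟩
  · intro x hx
    rw [Ideal.mem_comap]
    have : φ x = 0 := by
      simp [φ, Ideal.Quotient.eq_zero_iff_mem.2 hx]
    rw [this]; exact Ideal.zero_mem _
  · rw [← Ideal.map_le_iff_le_comap, Ideal.map_pow]
    refine Ideal.pow_right_mono ?_ N
    rw [← Ideal.map_map, ← Localization.AtPrime.map_eq_maximalIdeal]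
  · intro r x hx hrx
    rw [Ideal.mem_comap] at hrx ⊢
    rw [map_mul] at hrx
    have hu : IsUnit (φ x) := IsLocalization.map_units L
      (⟨Ideal.Quotient.mk P x, fun h => hx (by rw [← hcm]; exact h)⟩ : Q'.primeCompl)
    obtain ⟨w, hw⟩ := hu.exists_right_inv
    have := Ideal.mul_mem_right w _ hrx
    rwa [mul_assoc, hw, mul_one] at this

theorem pigeon {κ : Type*} (T : Finset κ) (E : ℕ) (pr : κ → ℕ → Prop)
    (h : ∀ e, E ≤ e → ∃ k ∈ T, pr k e) : ∃ k ∈ T, ∀ N, ∃ e, N ≤ e ∧ pr k e := by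
  by_contra hcon
  push Not at hcon
  choose! f hf using hcon
  obtain ⟨k, hk, hke⟩ := h (max E (T.sup f)) (le_max_left _ _)
  exact hf k hk _ ((Finset.le_sup (f := f) hk).trans (le_max_right _ _)) hke

section graded
variable {R G : Type*} [AddCommMonoid G] [DecidableEq G] [CommRing R]
  (𝒜 : G → AddSubgroup R) [GradedRing 𝒜]

theorem dvd_pow_trans' {a b c : R} {n m : ℕ} (h1 : a ∣ b ^ n) (h2 : b ∣ c ^ m) :
    a ∣ c ^ (m * n) := by
  rw [pow_mul]; exact h1.trans (pow_dvd_pow_of_dvd h2 n)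

theorem mI_congr {u v : R} {n m : ℕ} (h1 : u ∣ v ^ n) (h2 : v ∣ u ^ m) : mI 𝒜 u = mI 𝒜 v := by
  unfold mI
  congr 1
  ext e
  constructor
  · rintro ⟨h, h'⟩
    exact ⟨h, fun k hk => h' _ (dvd_pow_trans' hk h2)⟩
  · rintro ⟨h, h'⟩
    exact ⟨h, fun k hk => h' _ (dvd_pow_trans' hk h1)⟩

theorem core1 [IsNoetherianRing R] (hk : OneDim 𝒜) (p : ℕ) (hp : p.Prime) {ι : Type*}
    (S : Finset ι) (hS : S.Nonempty) (v : ι → R) (g : ι → G) (hv : ∀ i ∈ S, v i ∈ 𝒜 (g i))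
    (hnil : ∀ i ∈ S, ¬ IsNilpotent (v i))
    (hdist : ∀ i ∈ S, ∀ j ∈ S, i ≠ j → ∀ e : ℕ, p ^ e • g i ≠ p ^ e • g j) (x : R)
    (l : ι → ℕ → R) (E : ℕ) (hl : ∀ i ∈ S, ∀ e, E ≤ e → l i e ∈ 𝒜 0 ∧ l i e ≠ 0)
    (hx : ∀ e, E ≤ e → x ^ p ^ e = ∑ i ∈ S, l i e * v i ^ p ^ e)
    (C : R) (hC : ∀ P ∈ minimalPrimes R, C ∉ P) (J : ℕ → Ideal R)
    (hJ : ∀ e, (J e).IsHomogeneous 𝒜) (hCJ : ∀ e, E ≤ e → C * x ^ p ^ e ∈ J e) :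
    ∃ i ∈ S, ∃ Q P : Ideal R, Q ∈ (mI 𝒜 (v i)).minimalPrimes ∧ P ∈ minimalPrimes R ∧ P ≤ Q ∧
      v i ∉ Q ∧ ∃ c, SetLike.IsHomogeneousElem 𝒜 c ∧ c ∉ P ∧
        ∀ N, ∃ e, N ≤ e ∧ c * v i ^ p ^ e ∈ J e := by
  classical
  obtain ⟨i0, hi0, hmin⟩ := S.exists_min_image
    (fun i => (S.filter fun j => ∃ n : ℕ, v j ∣ v i ^ n).card) hS
  have hmin' : ∀ j ∈ S, (∃ n : ℕ, v j ∣ v i0 ^ n) → ∃ n : ℕ, v i0 ∣ v j ^ n := by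
    rintro j hj ⟨n, hn⟩
    by_contra hcon
    refine absurd (hmin j hj) (not_le.2 (Finset.card_lt_card ?_))
    refine (Finset.ssubset_iff_of_subset ?_).2 ⟨i0, ?_, ?_⟩
    · intro k hk'
      rw [Finset.mem_filter] at hk' ⊢
      obtain ⟨h1, m, hm⟩ := hk'
      exact ⟨h1, _, dvd_pow_trans' hm hn⟩
    · rw [Finset.mem_filter]
      exact ⟨hi0, 1, by simp⟩
    · rw [Finset.mem_filter]
      exact fun h => hcon h.2
  have hpe : ∀ n : ℕ, n ≤ p ^ n := fun n => (Nat.lt_pow_self hp.one_lt).le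
  have hpe' : ∀ n e : ℕ, n ≤ e → n ≤ p ^ e := fun n e h => h.trans (hpe e)
  have hu := hnil i0 hi0
  have huh : SetLike.IsHomogeneousElem 𝒜 (v i0) := ⟨_, hv i0 hi0⟩
  have hrad : x ∉ (mI 𝒜 (v i0)).radical := by
    rintro ⟨n, hn⟩
    have h1 : x ^ p ^ (max E n) ∈ mI 𝒜 (v i0) :=
      Ideal.mem_of_dvd _ (pow_dvd_pow x (hpe' n _ (le_max_right _ _))) hn
    have h2 := mI_hom 𝒜 (v i0) (p ^ (max E n) • g i0) h1
    rw [hx _ (le_max_left _ _), decomp_sum 𝒜 S _ (fun i => p ^ (max E n) • g i) (by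
      intro k hkS
      have := SetLike.GradedMul.mul_mem (hl k hkS _ (le_max_left E n)).1
        (SetLike.pow_mem_graded (p ^ max E n) (hv k hkS))
      rwa [zero_add] at this), Finset.sum_eq_single_of_mem i0 (by simp [hi0]) (by
      intro j hj hji
      rw [Finset.mem_filter] at hj
      exact (hdist j hj.1 i0 hi0 hji _ hj.2).elim)] at h2
    obtain ⟨l', _, hl'⟩ := zero_inv 𝒜 hk (hl i0 hi0 _ (le_max_left E n)).1
      (hl i0 hi0 _ (le_max_left E n)).2
    have h3 := Ideal.mul_mem_left _ l' h2
    rw [← mul_assoc, hl', one_mul] at h3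
    exact (mem_mI_iff 𝒜 hk hu (hom_pow 𝒜 huh _)).1 h3 _ dvd_rfl
  obtain ⟨Q, hQ, hxQ⟩ : ∃ Q ∈ (mI 𝒜 (v i0)).minimalPrimes, x ∉ Q := by
    by_contra hcon
    push Not at hcon
    rw [← Ideal.sInf_minimalPrimes] at hrad
    exact hrad (by rw [Submodule.mem_sInf]; exact hcon)
  have hQp : Q.IsPrime := hQ.1.1
  have hmQ : mI 𝒜 (v i0) ≤ Q := hQ.1.2
  have huQ : v i0 ∉ Q := by
    intro huQ
    have : ∀ j ∈ S, v j ∈ Q := by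
      intro j hj
      by_cases hjm : v j ∈ mI 𝒜 (v i0)
      · exact hmQ hjm
      · rw [mem_mI_iff 𝒜 hk hu ⟨_, hv j hj⟩] at hjm
        push Not at hjm
        obtain ⟨n, hn⟩ := hmin' j hj hjm
        exact hQp.mem_of_pow_mem _ (Ideal.mem_of_dvd _ hn huQ)
    apply hxQ
    apply hQp.mem_of_pow_mem (p ^ E)
    rw [hx E le_rfl]
    exact Ideal.sum_mem _ fun i hi => Ideal.mul_mem_left _ _
      (Ideal.pow_mem_of_mem _ (this i hi) _ (pow_pos hp.pos _))
  obtain ⟨P, hP, hPQ⟩ := Ideal.exists_minimalPrimes_le (I := ⊥) (J := Q) bot_le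
  have hPp : P.IsPrime := hP.1.1
  obtain ⟨b, N, hPb, hQb, hCb, hb⟩ := krull_K1 P Q hPQ (hC P hP)
  let T := (decompose 𝒜 C).support ×ˢ S
  have hstep : ∀ e, max E N ≤ e → ∃ k ∈ T, (decompose 𝒜 C k.1 : R) ∉ P ∧ v k.2 ∉ Q ∧
      (decompose 𝒜 C k.1 : R) * v k.2 ^ p ^ e ∈ J e := by
    intro e he
    have heE := (le_max_left _ _).trans he
    have hsum : C * x ^ p ^ e =
        ∑ k ∈ T, (decompose 𝒜 C k.1 : R) * (l k.2 e * v k.2 ^ p ^ e) := by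
      rw [Finset.sum_product, hx e heE]
      conv_lhs => rw [← sum_support_decompose 𝒜 C]
      rw [Finset.sum_mul_sum]
    obtain ⟨k, hkT, hkJ, hkb⟩ := component_lemma 𝒜 hk T
      (fun k => (decompose 𝒜 C k.1 : R) * (l k.2 e * v k.2 ^ p ^ e))
      (fun k => k.1 + (0 + p ^ e • g k.2)) (by
        intro k hkT
        have hk2 := (Finset.mem_product.1 hkT).2
        exact SetLike.GradedMul.mul_mem (SetLike.coe_mem _) (SetLike.GradedMul.mul_mem
          (hl _ hk2 e heE).1 (SetLike.pow_mem_graded _ (hv _ hk2)))) (J e) b (hJ e)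
      (hsum ▸ hCJ e heE) (by
        rw [← hsum]
        exact fun h => hCb (hb _ _ (fun h' => hxQ (hQp.mem_of_pow_mem _ h')) h))
    have hk2 := (Finset.mem_product.1 hkT).2
    refine ⟨k, hkT, fun h => hkb (Ideal.mul_mem_right _ _ (hPb h)), fun h => hkb ?_, ?_⟩
    · refine Ideal.mul_mem_left _ _ (Ideal.mul_mem_left _ _ (hQb ?_))
      exact Ideal.mem_of_dvd _ (pow_dvd_pow _ (hpe' N e ((le_max_right _ _).trans he)))
        (Ideal.pow_mem_pow h N)
    · obtain ⟨l', _, hl'⟩ := zero_inv 𝒜 hk (hl _ hk2 e heE).1 (hl _ hk2 e heE).2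
      have h3 := Ideal.mul_mem_left _ l' hkJ
      have e1 : l' * ((decompose 𝒜 C k.1 : R) * (l k.2 e * v k.2 ^ p ^ e)) =
        (l' * l k.2 e) * ((decompose 𝒜 C k.1 : R) * v k.2 ^ p ^ e) := by ring
      rw [e1, hl', one_mul] at h3
      exact h3
  obtain ⟨k, hkT, hkN⟩ := pigeon T _ _ hstep
  have hk2 := (Finset.mem_product.1 hkT).2
  obtain ⟨e0, _, hcP, hvQ, _⟩ := hkN 0
  have hdiv : ∃ n : ℕ, v k.2 ∣ v i0 ^ n := by
    by_contra hcon
    push Not at hcon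
    exact hvQ (hmQ ((mem_mI_iff 𝒜 hk hu ⟨_, hv _ hk2⟩).2 hcon))
  obtain ⟨n, hn⟩ := hdiv
  obtain ⟨m, hm⟩ := hmin' _ hk2 ⟨n, hn⟩
  refine ⟨k.2, hk2, Q, P, ?_, hP, hPQ, hvQ, _, ⟨k.1, SetLike.coe_mem _⟩, hcP, ?_⟩
  · rw [mI_congr 𝒜 hn hm]; exact hQ
  · intro N
    obtain ⟨e, he, h⟩ := hkN N
    exact ⟨e, he, h.2.2⟩

end graded

theorem min_kill {R : Type*} [CommRing R] {I Q : Ideal R} (hQ : Q ∈ I.minimalPrimes) {x : R}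
    (hx : x ∈ Q) : ∃ y, y ∉ Q ∧ ∃ n : ℕ, y * x ^ n ∈ I := by
  have hQp : Q.IsPrime := hQ.1.1
  let M : Submonoid R :=
    { carrier := {z | ∃ y, y ∉ Q ∧ ∃ n : ℕ, z = y * x ^ n}
      mul_mem' := by
        rintro _ _ ⟨y, hy, n, rfl⟩ ⟨y', hy', n', rfl⟩
        exact ⟨y * y', fun h => (hQp.mem_or_mem h).elim hy hy', n + n', by ring⟩
      one_mem' := ⟨1, hQp.one_notMem, 0, by simp⟩ }
  by_contra hcon
  push Not at hcon
  have hdis : Disjoint (I : Set R) M := by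
    rw [Set.disjoint_left]
    rintro _ h ⟨y, hy, n, rfl⟩
    exact hcon y hy n h
  obtain ⟨Q1, hQ1, hI1, hd1⟩ := Ideal.exists_le_prime_disjoint I M hdis
  have hle : Q1 ≤ Q := by
    intro y hy
    by_contra hyQ
    exact Set.disjoint_left.1 hd1 hy ⟨y, hyQ, 0, by simp⟩
  have := hQ.2 ⟨hQ1, hI1⟩ hle hx
  exact Set.disjoint_left.1 hd1 this ⟨1, hQp.one_notMem, 1, by simp⟩

section graded
variable {R G : Type*} [AddCommMonoid G] [DecidableEq G] [CommRing R]
  (𝒜 : G → AddSubgroup R) [GradedRing 𝒜]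

theorem core2 (hk : OneDim 𝒜) (p : ℕ) (hp : p.Prime) (hcp : CharP R p) {u : R}
    {Q : Ideal R} (hQ : Q ∈ (mI 𝒜 u).minimalPrimes)
    (huQ : u ∉ Q) {κ1 κ2 : R} (h1 : SetLike.IsHomogeneousElem 𝒜 κ1)
    (h2 : SetLike.IsHomogeneousElem 𝒜 κ2) (h1Q : κ1 ∉ Q) (h12 : κ1 - κ2 ∈ Q) :
    ∃ r : ℕ, 0 < r ∧ ∃ m : ℕ, u ^ m * κ1 ^ r = u ^ m * κ2 ^ r := by
  classical
  have : Fact p.Prime := ⟨hp⟩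
  have hQp : Q.IsPrime := hQ.1.1
  have hmQ : mI 𝒜 u ≤ Q := hQ.1.2
  have hu : ¬ IsNilpotent u := by
    rintro ⟨n, hn⟩
    exact huQ (hQp.mem_of_pow_mem n (hn ▸ Q.zero_mem))
  obtain ⟨y, hyQ, n, hyn⟩ := min_kill hQ h12
  have hyn' : y * (κ1 ^ p ^ n - κ2 ^ p ^ n) ∈ mI 𝒜 u := by
    rw [← sub_pow_char_pow]
    exact Ideal.mem_of_dvd _ (mul_dvd_mul_left y (pow_dvd_pow _ (Nat.lt_pow_self hp.one_lt).le)) hyn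
  obtain ⟨k1, hK1⟩ := hom_pow 𝒜 h1 (p ^ n)
  obtain ⟨k2, hK2⟩ := hom_pow 𝒜 h2 (p ^ n)
  have hK1Q : κ1 ^ p ^ n ∉ Q := fun h => h1Q (hQp.mem_of_pow_mem _ h)
  have hK12 : κ1 ^ p ^ n - κ2 ^ p ^ n ∈ Q := Ideal.mem_of_dvd _ (sub_dvd_pow_sub_pow _ _ _) h12
  generalize hK1e : κ1 ^ p ^ n = K1 at *
  generalize hK2e : κ2 ^ p ^ n = K2 at *
  set M := (decompose 𝒜 y).support.card with hM
  obtain ⟨g, hg⟩ : ∃ g, (decompose 𝒜 (y * K1 ^ M) g : R) ∉ mI 𝒜 u := by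
    by_contra hcon
    push Not at hcon
    have : y * K1 ^ M ∈ mI 𝒜 u := by
      rw [← sum_support_decompose 𝒜 (y * K1 ^ M)]
      exact Ideal.sum_mem _ fun g _ => hcon g
    rcases hQp.mem_or_mem (hmQ this) with h | h
    · exact hyQ h
    · exact hK1Q (hQp.mem_of_pow_mem _ h)
  have hj : ∀ j ∈ Finset.range (M + 1), ∃ h ∈ (decompose 𝒜 y).support,
      h + (j • k1 + (M - j) • k2) = g ∧
      (decompose 𝒜 y h : R) * (K1 ^ j * K2 ^ (M - j)) ∉ mI 𝒜 u := by
    intro j hj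
    have hjM : j ≤ M := Nat.lt_succ_iff.1 (Finset.mem_range.1 hj)
    have hd : y * K1 ^ M - y * (K1 ^ j * K2 ^ (M - j)) ∈ mI 𝒜 u := by
      have e1 : y * K1 ^ M - y * (K1 ^ j * K2 ^ (M - j)) =
          (y * (K1 ^ (M - j) - K2 ^ (M - j))) * K1 ^ j := by
        have : K1 ^ M = K1 ^ (M - j) * K1 ^ j := by rw [← pow_add, Nat.sub_add_cancel hjM]
        rw [this]; ring
      rw [e1]
      exact Ideal.mul_mem_right _ _
        (Ideal.mem_of_dvd _ (mul_dvd_mul_left y (sub_dvd_pow_sub_pow _ _ _)) hyn')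
    have hd' := mI_hom 𝒜 u g hd
    rw [decompose_sub, DFinsupp.sub_apply, AddSubgroup.coe_sub] at hd'
    have hg' : (decompose 𝒜 (y * (K1 ^ j * K2 ^ (M - j))) g : R) ∉ mI 𝒜 u := by
      intro h
      exact hg (by simpa using Ideal.add_mem _ hd' h)
    have e2 : y * (K1 ^ j * K2 ^ (M - j)) = ∑ h ∈ (decompose 𝒜 y).support,
        (decompose 𝒜 y h : R) * (K1 ^ j * K2 ^ (M - j)) := by
      rw [← Finset.sum_mul, sum_support_decompose]
    rw [e2, decomp_sum 𝒜 _ _ (fun h => h + (j • k1 + (M - j) • k2)) (fun h _ =>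
      SetLike.GradedMul.mul_mem (SetLike.coe_mem _) (SetLike.GradedMul.mul_mem
        (SetLike.pow_mem_graded _ hK1) (SetLike.pow_mem_graded _ hK2)))] at hg'
    by_contra hcon
    push Not at hcon
    apply hg'
    refine Ideal.sum_mem _ fun h hh => ?_
    rw [Finset.mem_filter] at hh
    exact hcon h hh.1 hh.2
  choose! f hf1 hf2 hf3 using hj
  obtain ⟨a, ha, b, hb, hab, hfab⟩ := Finset.exists_ne_map_eq_of_card_lt_of_maps_to
    (s := Finset.range (M + 1)) (t := (decompose 𝒜 y).support) (by simp [← hM]) hf1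
  obtain ⟨j, hj, j', hj', hlt, hff⟩ : ∃ j ∈ Finset.range (M + 1), ∃ j' ∈ Finset.range (M + 1),
      j < j' ∧ f j = f j' := by
    rcases lt_or_gt_of_ne hab with h | h
    · exact ⟨a, ha, b, hb, h, hfab⟩
    · exact ⟨b, hb, a, ha, h, hfab.symm⟩
  have hjM' : j' ≤ M := Nat.lt_succ_iff.1 (Finset.mem_range.1 hj')
  have hmem : ∀ i ∈ Finset.range (M + 1),
      (decompose 𝒜 y (f i) : R) * (K1 ^ i * K2 ^ (M - i)) ∈ 𝒜 g := by
    intro i hi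
    have := SetLike.GradedMul.mul_mem (SetLike.coe_mem (decompose 𝒜 y (f i)))
      (SetLike.GradedMul.mul_mem
        (SetLike.pow_mem_graded i hK1) (SetLike.pow_mem_graded (M - i) hK2))
    rwa [hf2 i hi] at this
  obtain ⟨l, hl, hle⟩ := hk g _ (hmem j' hj') (fun h => hf3 j' hj' (h ▸ Ideal.zero_mem _)) _
    (hmem j hj)
  rw [hff] at hle
  set yh := (decompose 𝒜 y (f j') : R) with hyh
  obtain ⟨r, rfl⟩ := Nat.exists_eq_add_of_lt hlt
  set w := yh * (K1 ^ j * K2 ^ (M - (j + r + 1))) with hw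
  have e3 : yh * (K1 ^ j * K2 ^ (M - j)) = w * K2 ^ (r + 1) := by
    rw [hw, mul_assoc, mul_assoc, ← pow_add]
    congr 4
    omega
  have e4 : yh * (K1 ^ (j + r + 1) * K2 ^ (M - (j + r + 1))) = w * K1 ^ (r + 1) := by
    rw [hw, add_assoc, pow_add]; ring
  have hwm : w ∉ mI 𝒜 u := fun h => hf3 _ hj' (by
    rw [← hyh, e4]; exact Ideal.mul_mem_right _ _ h)
  rw [e3, e4] at hle
  have hwh : SetLike.IsHomogeneousElem 𝒜 w := SetLike.IsHomogeneousElem.mul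
    ⟨_, SetLike.coe_mem _⟩ (SetLike.IsHomogeneousElem.mul (hom_pow 𝒜 ⟨_, hK1⟩ _)
      (hom_pow 𝒜 ⟨_, hK2⟩ _))
  rw [mem_mI_iff 𝒜 hk hu hwh] at hwm
  push Not at hwm
  obtain ⟨m, c, hc⟩ := hwm
  have h5 : u ^ m * K2 ^ (r + 1) = l * (u ^ m * K1 ^ (r + 1)) := by
    rw [hc]
    linear_combination c * hle
  have h6 : (1 - l) * (u ^ m * K1 ^ (r + 1)) ∈ Q := by
    have e5 : (1 - l) * (u ^ m * K1 ^ (r + 1)) = u ^ m * (K1 ^ (r + 1) - K2 ^ (r + 1)) := by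
      linear_combination h5
    rw [e5]
    exact Ideal.mul_mem_left _ _ (Ideal.mem_of_dvd _ (sub_dvd_pow_sub_pow _ _ _) hK12)
  have h7 : l = 1 := by
    by_contra hne
    obtain ⟨l', _, hl'⟩ := zero_inv 𝒜 hk (sub_mem (SetLike.GradedOne.one_mem : (1 : R) ∈ 𝒜 0) hl)
      (sub_ne_zero.2 (Ne.symm hne))
    rcases hQp.mem_or_mem h6 with h | h
    · exact hQp.one_notMem (hl' ▸ Ideal.mul_mem_left _ l' h)
    · rcases hQp.mem_or_mem h with h | h
      · exact huQ (hQp.mem_of_pow_mem _ h)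
      · exact hK1Q (hQp.mem_of_pow_mem _ h)
  rw [h7, one_mul, ← hK1e, ← hK2e, ← pow_mul, ← pow_mul] at h5
  exact ⟨p ^ n * (r + 1), Nat.mul_pos (pow_pos hp.pos _) (Nat.succ_pos _), m, h5.symm⟩

end graded

section graded
variable {R G : Type*} [AddCommMonoid G] [DecidableEq G] [CommRing R]
  (𝒜 : G → AddSubgroup R) [GradedRing 𝒜]

theorem wqoR [IsNoetherianRing R] (hk : OneDim 𝒜) (e : ℕ → R)
    (he : ∀ n, SetLike.IsHomogeneousElem 𝒜 (e n)) (he0 : ∀ n, e n ≠ 0) :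
    ∃ i j, i < j ∧ ∃ d, SetLike.IsHomogeneousElem 𝒜 d ∧ e j = d * e i := by
  let f : ℕ →o Ideal R := ⟨fun n => Ideal.span (e '' {i | i < n}), fun a b hab =>
    Ideal.span_mono (Set.image_mono fun i (hi : i < a) => lt_of_lt_of_le hi hab)⟩
  obtain ⟨n, hn⟩ := monotone_stabilizes_iff_noetherian.2 ‹IsNoetherianRing R› f
  have h1 : e n ∈ f n := by
    rw [hn (n + 1) (Nat.le_succ n)]
    exact Ideal.subset_span ⟨n, Nat.lt_succ_self n, rfl⟩
  obtain ⟨_, ⟨i, hi, rfl⟩, d, hd, h⟩ := lemma_one 𝒜 hk (e '' {i | i < n}) (by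
    rintro _ ⟨i, _, rfl⟩; exact he i) (he n) (he0 n) h1
  exact ⟨i, n, hi, d, hd, h⟩

theorem lemER [IsNoetherianRing R] (hk : OneDim 𝒜) (P : Ideal R) [hP : P.IsPrime]
    {ι : Type*} [Fintype ι] (a : ι → R) (s : ℝ) :
    ∃ ε : ℝ, 0 < ε ∧ ∀ u, SetLike.IsHomogeneousElem 𝒜 u → u ∉ P →
      (∃ n : ℕ, 0 < n ∧ ∃ (β : ι → ℕ) (d : R), SetLike.IsHomogeneousElem 𝒜 d ∧
        u ^ n - d * ∏ i, a i ^ β i ∈ P ∧ (s - ε) * n < ((∑ i, β i : ℕ) : ℝ)) →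
      (∃ n : ℕ, 0 < n ∧ ∃ (β : ι → ℕ) (d : R), SetLike.IsHomogeneousElem 𝒜 d ∧
        u ^ n - d * ∏ i, a i ^ β i ∈ P ∧ s * n ≤ ((∑ i, β i : ℕ) : ℝ)) := by
  classical
  let L := FractionRing (R ⧸ P)
  let φ : R →+* L := (algebraMap (R ⧸ P) L).comp (Ideal.Quotient.mk P)
  have hφ : ∀ x, φ x = 0 ↔ x ∈ P := by
    intro x
    simp only [φ, RingHom.comp_apply]
    rw [FaithfulSMul.algebraMap_eq_zero_iff, Ideal.Quotient.eq_zero_iff_mem]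
  let H : Submonoid Lˣ :=
    { carrier := {γ | ∃ e, SetLike.IsHomogeneousElem 𝒜 e ∧ φ e = γ}
      mul_mem' := by
        rintro _ _ ⟨e, he, h⟩ ⟨e', he', h'⟩
        exact ⟨e * e', he.mul he', by simp [h, h']⟩
      one_mem' := ⟨1, hom_one 𝒜, by simp⟩ }
  have wqo : ∀ f : ℕ → Lˣ, (∀ n, f n ∈ H) → ∃ i j, i < j ∧ f j / f i ∈ H := by
    intro f hf
    choose e he hfe using hf
    obtain ⟨i, j, hij, d, hd, h⟩ := wqoR 𝒜 hk e he (fun n h0 => by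
      have := hfe n
      rw [h0, map_zero] at this
      exact (f n).ne_zero this.symm)
    refine ⟨i, j, hij, d, hd, ?_⟩
    rw [Units.val_div_eq_div_val, ← hfe, ← hfe, h, map_mul, mul_div_cancel_right₀]
    rw [hfe]; exact (f i).ne_zero
  let a' : {i // a i ∉ P} → Lˣ := fun i => Units.mk0 (φ (a i)) (fun h => i.2 ((hφ _).1 h))
  obtain ⟨ε, hε, hE⟩ := lemE H wqo a' s
  refine ⟨ε, hε, ?_⟩
  rintro u hu huP ⟨n, hn, β, d, hd, hmem, hlt⟩
  have hβ : ∀ i, β i ≠ 0 → a i ∉ P := by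
    intro i hi haP
    apply huP
    apply hP.mem_of_pow_mem n
    have h1 : d * ∏ i, a i ^ β i ∈ P := Ideal.mul_mem_left _ _
      (Ideal.mem_of_dvd _ (Finset.dvd_prod_of_mem _ (Finset.mem_univ i))
        (Ideal.pow_mem_of_mem _ haP _ (Nat.pos_of_ne_zero hi)))
    simpa using Ideal.add_mem _ hmem h1
  have hprod : ∀ β : ι → ℕ, (∀ i, β i ≠ 0 → a i ∉ P) →
      φ (∏ i, a i ^ β i) = ((∏ i, a' i ^ β i : Lˣ) : L) := by
    intro β hβ
    rw [← Finset.prod_filter_of_ne (p := fun i => a i ∉ P) (s := Finset.univ) (fun i _ h =>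
      hβ i fun h0 => h (by simp [h0])), Finset.prod_subtype (p := fun i => a i ∉ P) (F := inferInstance) _ (by simp)]
    simp [a']
  have hsum : ∀ β : ι → ℕ, (∀ i, β i ≠ 0 → a i ∉ P) →
      ∑ i, β i = ∑ i : {i // a i ∉ P}, β i := by
    intro β hβ
    rw [← Finset.sum_filter_of_ne (p := fun i => a i ∉ P) (s := Finset.univ) (fun i _ h =>
      hβ i h), Finset.sum_subtype (p := fun i => a i ∉ P) _ (by simp)]
  let u' : Lˣ := Units.mk0 (φ u) (fun h => huP ((hφ _).1 h))
  obtain ⟨n', hn', β', ⟨d', hd', hd'e⟩, hle⟩ := hE u' ⟨u, hu, rfl⟩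
    ⟨n, hn, fun i => β i, ⟨d, hd, by
      rw [← hφ, map_sub, map_mul, map_pow, hprod β hβ, sub_eq_zero] at hmem
      rw [Units.val_div_eq_div_val, Units.val_pow_eq_pow_val, Units.val_mk0, hmem,
        mul_div_cancel_right₀]
      exact Units.ne_zero _⟩, by rw [← hsum β hβ]; exact hlt⟩
  let β'' : ι → ℕ := fun i => if h : a i ∉ P then β' ⟨i, h⟩ else 0
  have hβ'' : ∀ i, β'' i ≠ 0 → a i ∉ P := by
    intro i hi
    by_contra h
    exact hi (by simp [β'', h])
  have hββ : ∀ i : {i // a i ∉ P}, β'' i = β' i := by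
    rintro ⟨i, hi⟩
    simp [β'', hi]
  refine ⟨n', hn', β'', d', hd', ?_, ?_⟩
  · rw [← hφ, map_sub, map_mul, map_pow, hprod β'' hβ'', sub_eq_zero, hd'e]
    simp only [hββ]
    rw [← Units.val_mul, div_mul_cancel, Units.val_pow_eq_pow_val, Units.val_mk0]
  · rw [hsum β'' hβ'']
    simp only [hββ]
    exact hle

end graded

section graded
variable {R G : Type*} [AddCommMonoid G] [DecidableEq G] [CommRing R]
  (𝒜 : G → AddSubgroup R) [GradedRing 𝒜]

theorem pair_step [IsNoetherianRing R] (hk : OneDim 𝒜) (p : ℕ) (hp : p.Prime)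
    {ι : Type*} [Fintype ι] (a : ι → R) {P : Ideal R} (hP : P.IsPrime) {c u : R}
    (hc : c ∉ P) (hu : u ∉ P)
    (pr : ℕ → (ι → ℕ) → Prop)
    (h : ∀ N, ∃ e, N ≤ e ∧ ∃ α, pr e α ∧ ∃ r, SetLike.IsHomogeneousElem 𝒜 r ∧ r ≠ 0 ∧
      c * u ^ p ^ e = r * ∏ i, a i ^ α i) (B : ℕ) :
    ∃ e e' α α' d, B ≤ e ∧ e < e' ∧ pr e α ∧ pr e' α' ∧ α ≤ α' ∧
      SetLike.IsHomogeneousElem 𝒜 d ∧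
      u ^ (p ^ e' - p ^ e) - d * ∏ i, a i ^ (α' i - α i) ∈ P := by
  obtain ⟨φ, hφ, hφ'⟩ := Nat.exists_strictMono_subsequence
    (P := fun e => B ≤ e ∧ ∃ α, pr e α ∧ ∃ r, SetLike.IsHomogeneousElem 𝒜 r ∧ r ≠ 0 ∧
      c * u ^ p ^ e = r * ∏ i, a i ^ α i) (fun N => by
      obtain ⟨e, he, h'⟩ := h (max (N + 1) B)
      exact ⟨e, lt_of_lt_of_le (Nat.lt_succ_self N) ((le_max_left _ _).trans he),
        (le_max_right _ _).trans he, h'⟩)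
  choose hB α hα r hr hr0 hcu using hφ'
  obtain ⟨g, hg⟩ := (wellQuasiOrdered_le (α := ι → ℕ)).exists_monotone_subseq α
  obtain ⟨i, j, hij, d, hd, hde⟩ := wqoR 𝒜 hk (fun n => r (g n)) (fun n => hr _) (fun n => hr0 _)
  have hlt : φ (g i) < φ (g j) := hφ (g.strictMono hij)
  have hle : α (g i) ≤ α (g j) := hg i j hij.le
  refine ⟨φ (g i), φ (g j), α (g i), α (g j), d, hB _, hlt, hα _, hα _, hle, hd, ?_⟩
  have h1 : c * u ^ p ^ φ (g i) *
      (u ^ (p ^ φ (g j) - p ^ φ (g i)) - d * ∏ k, a k ^ (α (g j) k - α (g i) k)) = 0 := by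
    have e1 : u ^ p ^ φ (g i) * u ^ (p ^ φ (g j) - p ^ φ (g i)) = u ^ p ^ φ (g j) := by
      rw [← pow_add, Nat.add_sub_cancel' (Nat.pow_le_pow_right hp.pos hlt.le)]
    have e2 : (∏ k, a k ^ α (g i) k) * ∏ k, a k ^ (α (g j) k - α (g i) k) =
        ∏ k, a k ^ α (g j) k := by
      rw [← Finset.prod_mul_distrib]
      refine Finset.prod_congr rfl fun k _ => ?_
      rw [← pow_add, Nat.add_sub_cancel' (hle k)]
    have e3 := hcu (g i)
    have e4 := hcu (g j)
    rw [← e1, ← e2, hde] at e4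
    linear_combination e4 - d * (∏ k, a k ^ (α (g j) k - α (g i) k)) * e3
  have h2 : c * u ^ p ^ φ (g i) *
      (u ^ (p ^ φ (g j) - p ^ φ (g i)) - d * ∏ k, a k ^ (α (g j) k - α (g i) k)) ∈ P :=
    h1 ▸ P.zero_mem
  rcases hP.mem_or_mem h2 with h | h
  · rcases hP.mem_or_mem h with h | h
    · exact (hc h).elim
    · exact (hu (hP.mem_of_pow_mem _ h)).elim
  · exact h

/-- generators of the mixed power -/
def mixT {ι : Type*} [Fintype ι] (a : ι → R) (t : ℝ) (q : ℕ) : Set R :=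
  {x | (∃ α : ι → ℕ, ∑ i, α i = ⌈t * (q : ℝ)⌉₊ ∧ x = ∏ i, a i ^ α i) ∨ ∃ i, x = a i ^ q}

theorem mixT_hom {ι : Type*} [Fintype ι] (a : ι → R)
    (ha : ∀ i, SetLike.IsHomogeneousElem 𝒜 (a i)) (t : ℝ) (q : ℕ) :
    ∀ x ∈ mixT a t q, SetLike.IsHomogeneousElem 𝒜 x := by
  rintro _ (⟨α, _, rfl⟩ | ⟨i, rfl⟩)
  · exact hom_prod 𝒜 _ _ fun i _ => hom_pow 𝒜 (ha i) _
  · exact hom_pow 𝒜 (ha i) _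

theorem mono_mem {ι : Type*} [Fintype ι] (a : ι → R) (α : ι → ℕ) :
    ∏ i, a i ^ α i ∈ (Ideal.span (Set.range a)) ^ (∑ i, α i) := by
  rw [← Finset.prod_pow_eq_pow_sum]
  have h : ∀ i, a i ∈ Ideal.span (Set.range a) := fun i => Ideal.subset_span ⟨i, rfl⟩
  exact Ideal.prod_mem_prod fun i _ => Ideal.pow_mem_pow (h i) _

theorem pow_le_mono {ι : Type*} [Fintype ι] (a : ι → R) (N : ℕ) :
    (Ideal.span (Set.range a)) ^ N ≤
      Ideal.span {x | ∃ α : ι → ℕ, ∑ i, α i = N ∧ x = ∏ i, a i ^ α i} := by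
  classical
  induction N with
  | zero =>
    rw [pow_zero, Ideal.one_eq_top, top_le_iff, Ideal.eq_top_iff_one]
    exact Ideal.subset_span ⟨0, by simp, by simp⟩
  | succ N ih =>
    rw [pow_succ]
    refine (Ideal.mul_mono_left ih).trans ?_
    rw [Ideal.span_mul_span', Ideal.span_le]
    rintro _ ⟨_, ⟨α, hα, rfl⟩, _, ⟨i, rfl⟩, rfl⟩
    refine Ideal.subset_span ⟨α + Pi.single i 1, ?_, ?_⟩
    · simp [Finset.sum_add_distrib, hα]
    · simp only [Pi.add_apply, pow_add, Finset.prod_mul_distrib]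
      congr 1
      rw [Finset.prod_eq_single i]
      · simp
      · intro x _ hx
        simp [hx]
      · simp

theorem mixedPow_eq {ι : Type*} [Fintype ι] (p : ℕ) (hp : p.Prime) (hcp : CharP R p)
    (a : ι → R) (t : ℝ) (e : ℕ) :
    mixedPow (Ideal.span (Set.range a)) t (p ^ e) = Ideal.span (mixT a t (p ^ e)) := by
  classical
  have : Fact p.Prime := ⟨hp⟩
  apply le_antisymm
  · unfold mixedPow
    rw [Submodule.add_eq_sup, sup_le_iff]
    constructor
    · exact (pow_le_mono a _).trans (Ideal.span_mono fun x hx => Or.inl hx)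
    · unfold frobPow
      rw [Ideal.span_le]
      rintro _ ⟨f, hf, rfl⟩
      obtain ⟨c, rfl⟩ := Ideal.mem_span_range_iff_exists_fun.1 hf
      simp only
      rw [sum_pow_char_pow]
      refine Ideal.sum_mem _ fun i _ => ?_
      rw [mul_pow]
      exact Ideal.mul_mem_left _ _ (Ideal.subset_span (Or.inr ⟨i, rfl⟩))
  · rw [Ideal.span_le]
    rintro _ (⟨α, hα, rfl⟩ | ⟨i, rfl⟩)
    · exact Ideal.mem_sup_left (hα ▸ mono_mem a α)
    · exact Ideal.mem_sup_right (Ideal.subset_span ⟨a i, Ideal.subset_span ⟨i, rfl⟩, rfl⟩)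

theorem core3 [IsNoetherianRing R] (hk : OneDim 𝒜) (p : ℕ) (hp : p.Prime) (hcp : CharP R p)
    {ι : Type*} [Fintype ι] (a : ι → R) (ha : ∀ i, SetLike.IsHomogeneousElem 𝒜 (a i))
    {P Q : Ideal R} (hP : P.IsPrime) (hPQ : P ≤ Q) {u c : R}
    (huh : SetLike.IsHomogeneousElem 𝒜 u) (hch : SetLike.IsHomogeneousElem 𝒜 c) (hc : c ∉ P)
    (hQ : Q ∈ (mI 𝒜 u).minimalPrimes) (huQ : u ∉ Q) (s t ε : ℝ) (ht0 : 0 ≤ t) (ht : s - ε < t)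
    (hε : (∃ n : ℕ, 0 < n ∧ ∃ (β : ι → ℕ) (d : R), SetLike.IsHomogeneousElem 𝒜 d ∧
        u ^ n - d * ∏ i, a i ^ β i ∈ P ∧ (s - ε) * n < ((∑ i, β i : ℕ) : ℝ)) →
      (∃ n : ℕ, 0 < n ∧ ∃ (β : ι → ℕ) (d : R), SetLike.IsHomogeneousElem 𝒜 d ∧
        u ^ n - d * ∏ i, a i ^ β i ∈ P ∧ s * n ≤ ((∑ i, β i : ℕ) : ℝ)))
    (h : ∀ N, ∃ e, N ≤ e ∧ c * u ^ p ^ e ∈ Ideal.span (mixT a t (p ^ e))) :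
    (∃ i, ∃ l m n : ℕ, ∃ d : R, 0 < n ∧ a i ∣ u ^ l ∧ u ^ m * u ^ n = u ^ m * (d * a i ^ n)) ∨
    (∃ m n : ℕ, ∃ (β : ι → ℕ) (d : R), 0 < n ∧ s * n ≤ ((∑ i, β i : ℕ) : ℝ) ∧
      u ^ m * u ^ n = u ^ m * (d * ∏ i, a i ^ β i)) := by
  classical
  have hQp : Q.IsPrime := hQ.1.1
  have huP : u ∉ P := fun h => huQ (hPQ h)
  have hunil : ¬ IsNilpotent u := by
    rintro ⟨n, hn⟩
    exact huQ (hQp.mem_of_pow_mem n (hn ▸ Q.zero_mem))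
  let prA : Option ι → ℕ → (ι → ℕ) → Prop := fun o e α => match o with
    | none => ∑ i, α i = ⌈t * ((p ^ e : ℕ) : ℝ)⌉₊
    | some i => α = Pi.single i (p ^ e)
  have hsingle : ∀ (i : ι) (n : ℕ), ∏ k, a k ^ (Pi.single i n : ι → ℕ) k = a i ^ n := by
    intro i n
    rw [Finset.prod_eq_single i]
    · simp
    · intro x _ hx
      simp [hx]
    · simp
  obtain ⟨o, _, ho⟩ := pigeon (Finset.univ : Finset (Option ι)) 0
    (fun o N => ∃ e, N ≤ e ∧ ∃ α, prA o e α ∧ ∃ r, SetLike.IsHomogeneousElem 𝒜 r ∧ r ≠ 0 ∧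
      c * u ^ p ^ e = r * ∏ i, a i ^ α i) (fun N _ => by
      obtain ⟨e, he, hmem⟩ := h N
      have hne : c * u ^ p ^ e ≠ 0 := by
        intro h0
        have : c * u ^ p ^ e ∈ P := h0 ▸ P.zero_mem
        rcases hP.mem_or_mem this with h | h
        · exact hc h
        · exact huP (hP.mem_of_pow_mem _ h)
      obtain ⟨τ, hτ, r, hr, hrτ⟩ := lemma_one 𝒜 hk _ (mixT_hom 𝒜 a ha t (p ^ e))
        (hch.mul (hom_pow 𝒜 huh _)) hne hmem
      have hr0 : r ≠ 0 := by
        rintro rfl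
        exact hne (by rw [hrτ, zero_mul])
      rcases hτ with ⟨α, hα, rfl⟩ | ⟨i, rfl⟩
      · exact ⟨none, Finset.mem_univ _, e, he, α, hα, r, hr, hr0, hrτ⟩
      · exact ⟨some i, Finset.mem_univ _, e, he, Pi.single i (p ^ e), rfl, r, hr, hr0, by
          rw [hsingle]; exact hrτ⟩)
  have ho' : ∀ N, ∃ e, N ≤ e ∧ ∃ α, prA o e α ∧ ∃ r, SetLike.IsHomogeneousElem 𝒜 r ∧ r ≠ 0 ∧
      c * u ^ p ^ e = r * ∏ i, a i ^ α i := by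
    intro N
    obtain ⟨N', hN', e, he, h'⟩ := ho N
    exact ⟨e, hN'.trans he, h'⟩
  obtain ⟨e, e', α, α', d, hB, hee, hα, hα', hαα, hd, hmem⟩ :=
    pair_step 𝒜 hk p hp a hP hc huP (prA o) ho' (⌈1 / (t - (s - ε))⌉₊)
  have hlt : p ^ e < p ^ e' := Nat.pow_lt_pow_right hp.one_lt hee
  have hgen : ∀ (n : ℕ) (κ2 : R), SetLike.IsHomogeneousElem 𝒜 κ2 → u ^ n - κ2 ∈ P →
      ∃ r : ℕ, 0 < r ∧ ∃ m : ℕ, u ^ m * (u ^ n) ^ r = u ^ m * κ2 ^ r := by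
    intro n κ2 h2 h12
    exact core2 𝒜 hk p hp hcp hQ huQ (hom_pow 𝒜 huh n) h2
      (fun h => huQ (hQp.mem_of_pow_mem _ h)) (hPQ h12)
  cases o with
  | some i =>
    left
    have hα1 : α = Pi.single i (p ^ e) := hα
    have hα2 : α' = Pi.single i (p ^ e') := hα'
    have e1 : ∏ k, a k ^ (α' k - α k) = a i ^ (p ^ e' - p ^ e) := by
      rw [← hsingle]
      refine Finset.prod_congr rfl fun k _ => ?_
      rw [hα1, hα2]
      congr 1
      by_cases hki : k = i
      · subst hki; simp
      · simp [hki]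
    rw [e1] at hmem
    have haQ : a i ∉ Q := by
      intro haQ
      apply huQ
      apply hQp.mem_of_pow_mem (p ^ e' - p ^ e)
      have := Ideal.add_mem _ (hPQ hmem) (Ideal.mul_mem_left Q d
        (Ideal.pow_mem_of_mem _ haQ (p ^ e' - p ^ e) (Nat.sub_pos_of_lt hlt)))
      simpa using this
    obtain ⟨l, hl⟩ : ∃ l : ℕ, a i ∣ u ^ l := by
      by_contra hcon
      push Not at hcon
      exact haQ (hQ.1.2 ((mem_mI_iff 𝒜 hk hunil (ha i)).2 hcon))
    obtain ⟨r, hr, m, hm⟩ := hgen _ _ (hd.mul (hom_pow 𝒜 (ha i) _)) hmem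
    refine ⟨i, l, m, (p ^ e' - p ^ e) * r, d ^ r, Nat.mul_pos (Nat.sub_pos_of_lt hlt) hr, hl, ?_⟩
    rw [pow_mul u, hm, mul_pow, pow_mul (a i)]
  | none =>
    right
    have hα1 : ∑ i, α i = ⌈t * ((p ^ e : ℕ) : ℝ)⌉₊ := hα
    have hα2 : ∑ i, α' i = ⌈t * ((p ^ e' : ℕ) : ℝ)⌉₊ := hα'
    obtain ⟨n, hn, β, d', hd', hmem', hle⟩ := hε ⟨p ^ e' - p ^ e, Nat.sub_pos_of_lt hlt,
      fun i => α' i - α i, d, hd, hmem, by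
      have e1 : ∑ i, (α' i - α i) + ∑ i, α i = ∑ i, α' i := by
        rw [← Finset.sum_add_distrib]
        exact Finset.sum_congr rfl fun i _ => Nat.sub_add_cancel (hαα i)
      have e2 : ((∑ i, (α' i - α i) : ℕ) : ℝ) = ((∑ i, α' i : ℕ) : ℝ) - ((∑ i, α i : ℕ) : ℝ) := by
        rw [← e1]; push_cast; ring
      rw [e2, hα1, hα2]
      have h1 : t * ((p ^ e' : ℕ) : ℝ) ≤ (⌈t * ((p ^ e' : ℕ) : ℝ)⌉₊ : ℝ) := Nat.le_ceil _
      have h2 : (⌈t * ((p ^ e : ℕ) : ℝ)⌉₊ : ℝ) < t * ((p ^ e : ℕ) : ℝ) + 1 :=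
        Nat.ceil_lt_add_one (by positivity)
      have h3 : 1 / (t - (s - ε)) ≤ ((p ^ e' - p ^ e : ℕ) : ℝ) := by
        refine (Nat.le_ceil _).trans ?_
        have : e ≤ p ^ e' - p ^ e := by
          have h4 : p ^ e * p ≤ p ^ e' := by
            rw [← pow_succ]; exact Nat.pow_le_pow_right hp.pos hee
          have h5 : p ^ e * 2 ≤ p ^ e * p := Nat.mul_le_mul_left _ hp.two_le
          have h6 : e < p ^ e := Nat.lt_pow_self hp.one_lt
          omega
        exact_mod_cast hB.trans this
      rw [div_le_iff₀ (by linarith)] at h3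
      rw [Nat.cast_sub hlt.le] at h3 ⊢
      nlinarith⟩
    obtain ⟨r, hr, m, hm⟩ := hgen _ _ (hd'.mul (hom_prod 𝒜 Finset.univ (fun i => a i ^ β i)
      fun i _ => hom_pow 𝒜 (ha i) _)) hmem'
    refine ⟨m, n * r, fun i => β i * r, d' ^ r, Nat.mul_pos hn hr, ?_, ?_⟩
    · rw [← Finset.sum_mul]
      push_cast
      push_cast at hle
      nlinarith [(Nat.cast_nonneg r : (0 : ℝ) ≤ r)]
    · rw [pow_mul u, hm, mul_pow, ← Finset.prod_pow]
      simp only [pow_mul]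

end graded

section closures
variable {R : Type*} [CommRing R]

/-- real-exponent version of rational powers -/
def ratS (I : Ideal R) (s : ℝ) : Set R :=
  {x | ∃ c ∈ RCirc R, ∀ N : ℕ, c * x ^ N ∈ I ^ ⌈s * (N : ℝ)⌉₊}

theorem rcirc_mul {c d : R} (hc : c ∈ RCirc R) (hd : d ∈ RCirc R) : c * d ∈ RCirc R := by
  intro P hP h
  have hPp : P.IsPrime := hP.1.1
  exact (hPp.mem_or_mem h).elim (hc P hP) (hd P hP)

theorem rcirc_one : (1 : R) ∈ RCirc R := by
  intro P hP
  have hPp : P.IsPrime := hP.1.1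
  exact hPp.one_notMem

theorem avoid [IsNoetherianRing R] (c : Ideal R) (h : ∀ P ∈ minimalPrimes R, ¬ c ≤ P) :
    ∃ x ∈ c, x ∈ RCirc R := by
  classical
  have hfin := minimalPrimes.finite_of_isNoetherianRing R
  by_contra hcon
  push Not at hcon
  have hsub : (c : Set R) ⊆ ⋃ P ∈ (hfin.toFinset : Set (Ideal R)), ((id P : Ideal R) : Set R) := by
    intro x hx
    have := hcon x hx
    simp only [RCirc, Set.mem_ofPred_eq] at this
    push Not at this
    obtain ⟨P, hP, hxP⟩ := this
    simp only [Set.mem_iUnion]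
    exact ⟨P, by simpa using hP, hxP⟩
  rw [Ideal.subset_union_prime ⊥ ⊥ (fun P hP _ _ => by
    have : P ∈ minimalPrimes R := by simpa using hP
    exact this.1.1)] at hsub
  obtain ⟨P, hP, hle⟩ := hsub
  exact h P (by simpa using hP) hle

theorem avoid_fam [IsNoetherianRing R] {κ : Type*} (x : κ → R) (J : κ → Ideal R)
    (h : ∀ P ∈ minimalPrimes R, ∃ c, c ∉ P ∧ ∀ k, c * x k ∈ J k) :
    ∃ c ∈ RCirc R, ∀ k, c * x k ∈ J k := by
  let C : Ideal R :=
    { carrier := {c | ∀ k, c * x k ∈ J k}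
      add_mem' := fun ha hb k => by rw [add_mul]; exact (J k).add_mem (ha k) (hb k)
      zero_mem' := fun k => by simp
      smul_mem' := fun c y hy k => by
        rw [smul_eq_mul, mul_assoc]; exact (J k).mul_mem_left _ (hy k) }
  obtain ⟨c, hc, hc'⟩ := avoid C (fun P hP hle => by
    obtain ⟨c, hc, hc'⟩ := h P hP
    exact hc (hle hc'))
  exact ⟨c, hc', hc⟩

theorem exists_pow_rcirc [IsNoetherianRing R] {I : Ideal R} (hI : PosHeight I) (M : ℕ) :
    ∃ b ∈ RCirc R, b ∈ I ^ M := by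
  obtain ⟨b, hb, hb'⟩ := avoid (I ^ M) (fun P hP hle => by
    have hPp : P.IsPrime := hP.1.1
    exact hI P hP (fun x hx => hPp.mem_of_pow_mem M (hle (Ideal.pow_mem_pow hx M))))
  exact ⟨b, hb', hb⟩

theorem frobPow_le_mixed (I : Ideal R) (s : ℝ) (q : ℕ) : frobPow I q ≤ mixedPow I s q :=
  le_sup_right

theorem tight_sub_weak (p : ℕ) (I : Ideal R) (s : ℝ) : tightCl p I ⊆ weakCl p I s := by
  rintro x ⟨c, hc, N, h⟩
  exact ⟨c, hc, N, fun e he => frobPow_le_mixed I s _ (h e he)⟩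

theorem ratS_sub_weak (p : ℕ) (I : Ideal R) (s : ℝ) : ratS I s ⊆ weakCl p I s := by
  rintro x ⟨c, hc, h⟩
  exact ⟨c, hc, 0, fun e _ => Ideal.mem_sup_left (h (p ^ e))⟩

theorem weak_anti (p : ℕ) (I : Ideal R) {s t : ℝ} (hts : t ≤ s) :
    weakCl p I s ⊆ weakCl p I t := by
  rintro x ⟨c, hc, N, h⟩
  refine ⟨c, hc, N, fun e he => ?_⟩
  refine (sup_le_sup_right (Ideal.pow_le_pow_right (Nat.ceil_mono ?_)) _ :
    mixedPow I s (p ^ e) ≤ mixedPow I t (p ^ e)) (h e he)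
  exact mul_le_mul_of_nonneg_right hts (Nat.cast_nonneg _)

theorem weak_add (p : ℕ) (hp : p.Prime) (hcp : CharP R p) (I : Ideal R) (s : ℝ) {x y : R}
    (hx : x ∈ weakCl p I s) (hy : y ∈ weakCl p I s) : x + y ∈ weakCl p I s := by
  have : Fact p.Prime := ⟨hp⟩
  obtain ⟨c, hc, N, h⟩ := hx
  obtain ⟨d, hd, M, h'⟩ := hy
  refine ⟨c * d, rcirc_mul hc hd, max N M, fun e he => ?_⟩
  rw [add_pow_char_pow]
  have e1 : c * d * (x ^ p ^ e + y ^ p ^ e) = d * (c * x ^ p ^ e) + c * (d * y ^ p ^ e) := by ring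
  rw [e1]
  exact Ideal.add_mem _ (Ideal.mul_mem_left _ _ (h e ((le_max_left _ _).trans he)))
    (Ideal.mul_mem_left _ _ (h' e ((le_max_right _ _).trans he)))

theorem weak_smul (p : ℕ) (I : Ideal R) (s : ℝ) {x : R} (r : R)
    (hx : x ∈ weakCl p I s) : r * x ∈ weakCl p I s := by
  obtain ⟨c, hc, N, h⟩ := hx
  refine ⟨c, hc, N, fun e he => ?_⟩
  rw [mul_pow, mul_left_comm]
  exact Ideal.mul_mem_left _ _ (h e he)

theorem tight_add (p : ℕ) (hp : p.Prime) (hcp : CharP R p) (I : Ideal R) {x y : R}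
    (hx : x ∈ tightCl p I) (hy : y ∈ tightCl p I) : x + y ∈ tightCl p I := by
  have : Fact p.Prime := ⟨hp⟩
  obtain ⟨c, hc, N, h⟩ := hx
  obtain ⟨d, hd, M, h'⟩ := hy
  refine ⟨c * d, rcirc_mul hc hd, max N M, fun e he => ?_⟩
  rw [add_pow_char_pow]
  have e1 : c * d * (x ^ p ^ e + y ^ p ^ e) = d * (c * x ^ p ^ e) + c * (d * y ^ p ^ e) := by ring
  rw [e1]
  exact Ideal.add_mem _ (Ideal.mul_mem_left _ _ (h e ((le_max_left _ _).trans he)))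
    (Ideal.mul_mem_left _ _ (h' e ((le_max_right _ _).trans he)))

theorem ratS_add (I : Ideal R) (s : ℝ) {x y : R}
    (hx : x ∈ ratS I s) (hy : y ∈ ratS I s) : x + y ∈ ratS I s := by
  obtain ⟨c, hc, h⟩ := hx
  obtain ⟨d, hd, h'⟩ := hy
  refine ⟨c * d, rcirc_mul hc hd, fun N => ?_⟩
  rw [add_pow, Finset.mul_sum]
  refine Ideal.sum_mem _ fun i hi => ?_
  have hiN : i ≤ N := Nat.lt_succ_iff.1 (Finset.mem_range.1 hi)
  have e1 : c * d * (x ^ i * y ^ (N - i) * (N.choose i : R)) =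
    (c * x ^ i) * (d * y ^ (N - i)) * (N.choose i : R) := by ring
  rw [e1]
  refine Ideal.mul_mem_right _ _ ?_
  have h1 := Ideal.mul_mem_mul (h i) (h' (N - i))
  rw [← pow_add] at h1
  refine Ideal.pow_le_pow_right ?_ h1
  refine le_trans (le_of_eq ?_) (Nat.ceil_add_le _ _)
  congr 1
  rw [Nat.cast_sub hiN]
  ring

theorem tight_zero (p : ℕ) (hp : p.Prime) (I : Ideal R) : (0 : R) ∈ tightCl p I :=
  ⟨1, rcirc_one, 0, fun e _ => by
    rw [zero_pow (pow_pos hp.pos e).ne', mul_zero]; exact Ideal.zero_mem _⟩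

theorem tight_nil (p : ℕ) (hp : p.Prime) (I : Ideal R) {x : R} (hx : IsNilpotent x) :
    x ∈ tightCl p I := by
  obtain ⟨k, hk⟩ := hx
  refine ⟨1, rcirc_one, k, fun e he => ?_⟩
  rw [pow_eq_zero_of_le (he.trans (Nat.lt_pow_self hp.one_lt).le) hk, mul_zero]
  exact Ideal.zero_mem _

theorem ratS_zero [IsNoetherianRing R] {I : Ideal R} (s : ℝ) : (0 : R) ∈ ratS I s := by
  refine ⟨1, rcirc_one, fun N => ?_⟩
  rcases Nat.eq_zero_or_pos N with rfl | h
  · simp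
  · rw [zero_pow h.ne', mul_zero]; exact Ideal.zero_mem _

theorem ratS_eq_ratPow [IsNoetherianRing R] {I : Ideal R} (hI : PosHeight I) (s : ℚ)
    (hs : 0 ≤ s) : ratS I (s : ℝ) = ratPow I s := by
  set a := s.num.toNat with ha
  set b := s.den with hb
  have hb0 : 0 < b := s.den_pos
  have hab : (s : ℝ) * b = a := by
    have h1 : s * b = s.num := Rat.mul_den_eq_num s
    have h2 : (s.num : ℚ) = (a : ℚ) := by
      have : ((a : ℕ) : ℤ) = s.num := Int.toNat_of_nonneg (Rat.num_nonneg.2 hs)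
      rw [← this]; simp
    rw [h2] at h1
    exact_mod_cast h1
  have hsr : (0 : ℝ) ≤ s := by exact_mod_cast hs
  ext x
  constructor
  · rintro ⟨c, hc, h⟩
    refine ⟨c, hc, 0, fun n _ => ?_⟩
    have h1 := h (b * n)
    have e1 : ⌈(s : ℝ) * ((b * n : ℕ) : ℝ)⌉₊ = a * n := by
      have : (s : ℝ) * ((b * n : ℕ) : ℝ) = ((a * n : ℕ) : ℝ) := by
        push_cast; rw [← hab]; ring
      rw [this, Nat.ceil_natCast]
    rw [e1, pow_mul, pow_mul] at h1
    exact h1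
  · rintro ⟨c, hc, N0, h⟩
    obtain ⟨b0, hb0c, hb0M⟩ := exists_pow_rcirc hI (a * (N0 + 1))
    refine ⟨c * b0, rcirc_mul hc hb0c, fun N => ?_⟩
    set n := N / b with hn
    have hceil : ⌈(s : ℝ) * (N : ℝ)⌉₊ ≤ a * (n + 1) := by
      rw [Nat.ceil_le]
      have h1 : N ≤ b * (n + 1) := (Nat.lt_mul_div_succ N hb0).le
      have h2 : (N : ℝ) ≤ (b : ℝ) * (n + 1) := by exact_mod_cast h1
      calc (s : ℝ) * N ≤ s * (b * (n + 1)) := mul_le_mul_of_nonneg_left h2 hsr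
        _ = ((a * (n + 1) : ℕ) : ℝ) := by push_cast; rw [← hab]; ring
    refine Ideal.pow_le_pow_right hceil ?_
    rcases le_or_gt N0 n with hle | hlt
    · have h1 := h n hle
      rw [← pow_mul, ← pow_mul] at h1
      have h2 := Ideal.mul_mem_mul h1 hb0M
      rw [← pow_add] at h2
      have e1 : c * b0 * x ^ N = (c * x ^ (b * n) * b0) * x ^ (N - b * n) := by
        have : x ^ N = x ^ (b * n) * x ^ (N - b * n) := by
          rw [← pow_add, Nat.add_sub_cancel' (Nat.mul_div_le N b)]
        rw [this]; ring
      rw [e1]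
      refine Ideal.mul_mem_right _ _ (Ideal.pow_le_pow_right ?_ h2)
      nlinarith [Nat.zero_le a, Nat.zero_le N0, Nat.zero_le (a * N0)]
    · have : c * b0 * x ^ N = (c * x ^ N) * b0 := by ring
      rw [this]
      refine Ideal.mul_mem_left _ _ (Ideal.pow_le_pow_right ?_ hb0M)
      exact Nat.mul_le_mul_left _ (by omega)

theorem tight_transfer (p : ℕ) (I : Ideal R) {y v l : R} {e0 : ℕ}
    (h : y ^ p ^ e0 = l * v ^ p ^ e0) (hv : v ∈ tightCl p I) : y ∈ tightCl p I := by
  obtain ⟨c, hc, N, hN⟩ := hv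
  refine ⟨c, hc, max N e0, fun e he => ?_⟩
  obtain ⟨k, rfl⟩ := Nat.exists_eq_add_of_le ((le_max_right _ _).trans he)
  have h1 := hN (e0 + k) ((le_max_left _ _).trans he)
  have e1 : y ^ p ^ (e0 + k) = l ^ p ^ k * v ^ p ^ (e0 + k) := by
    rw [pow_add p, pow_mul, h, mul_pow, pow_mul]
  rw [e1, mul_left_comm]
  exact Ideal.mul_mem_left _ _ h1

theorem ratS_transfer [IsNoetherianRing R] {I : Ideal R} (hI : PosHeight I) {s : ℝ} (hs : 0 ≤ s)
    {y v l : R} {q : ℕ} (hq : 0 < q)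
    (h : y ^ q = l * v ^ q) (hv : v ∈ ratS I s) : y ∈ ratS I s := by
  obtain ⟨c, hc, hN⟩ := hv
  obtain ⟨b0, hb0c, hb0M⟩ := exists_pow_rcirc hI ⌈s * (q : ℝ)⌉₊
  refine ⟨c * b0, rcirc_mul hc hb0c, fun N => ?_⟩
  have h1 := Ideal.mul_mem_mul (hN (q * (N / q))) hb0M
  rw [← pow_add] at h1
  have e1 : c * b0 * y ^ N = (c * v ^ (q * (N / q)) * b0) * (l ^ (N / q) * y ^ (N % q)) := by
    have : y ^ N = (l ^ (N / q) * v ^ (q * (N / q))) * y ^ (N % q) := by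
      conv_lhs => rw [← Nat.div_add_mod N q, pow_add, pow_mul, h, mul_pow, ← pow_mul]
    rw [this]; ring
  rw [e1]
  refine Ideal.mul_mem_right _ _ (Ideal.pow_le_pow_right ?_ h1)
  refine le_trans (Nat.ceil_mono ?_) (Nat.ceil_add_le _ _)
  rw [← mul_add]
  refine mul_le_mul_of_nonneg_left ?_ hs
  have : N ≤ q * (N / q) + q := by
    have := Nat.lt_mul_div_succ N hq
    rw [Nat.mul_succ] at this
    exact this.le
  exact_mod_cast this

theorem mul_pow_eq_aux {w z m : R} (h : m * w = m * z) (k : ℕ) : m * w ^ k = m * z ^ k := by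
  induction k with
  | zero => simp
  | succ k ih =>
    rw [pow_succ, pow_succ, ← mul_assoc, ih]
    linear_combination z ^ k * h

theorem final_A [IsNoetherianRing R] (p : ℕ) (hp : p.Prime) {I : Ideal R} (hI : PosHeight I)
    {u a d : R} (ha : a ∈ I) {l m n : ℕ} (hn : 0 < n) (hal : a ∣ u ^ l)
    (h : u ^ m * u ^ n = u ^ m * (d * a ^ n)) : u ∈ tightCl p I := by
  obtain ⟨b, hbc, hbI⟩ := exists_pow_rcirc hI 1
  rw [pow_one] at hbI
  suffices ∃ c ∈ RCirc R, ∀ e : ℕ, c * u ^ p ^ e ∈ frobPow I (p ^ e) by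
    obtain ⟨c, hc, h⟩ := this
    exact ⟨c, hc, 0, fun e _ => h e⟩
  refine avoid_fam _ _ fun P hP => ?_
  have hPp : P.IsPrime := hP.1.1
  by_cases huP : u ∈ P
  · obtain ⟨y, hy, j, hj⟩ := min_kill hP huP
    rw [Ideal.mem_bot] at hj
    refine ⟨y * b ^ p ^ j, fun hh => ?_, fun e => ?_⟩
    · rcases hPp.mem_or_mem hh with hh | hh
      · exact hy hh
      · exact hbc P hP (hPp.mem_of_pow_mem _ hh)
    · rcases le_or_gt j e with hje | hje
      · have : y * u ^ p ^ e = 0 := by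
          have h1 : j ≤ p ^ e := hje.trans (Nat.lt_pow_self hp.one_lt).le
          rw [← Nat.add_sub_cancel' h1, pow_add, ← mul_assoc, hj, zero_mul]
        rw [mul_right_comm, this, zero_mul]
        exact Ideal.zero_mem _
      · refine Ideal.mul_mem_right _ _ (Ideal.mul_mem_left _ _ ?_)
        refine Ideal.mem_of_dvd _ (pow_dvd_pow b (Nat.pow_le_pow_right hp.pos hje.le)) ?_
        exact Ideal.subset_span ⟨b, hbI, rfl⟩
  · refine ⟨u ^ (l * n + m), fun hh => huP (hPp.mem_of_pow_mem _ hh), fun e => ?_⟩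
    set q := p ^ e
    have hmem : a ^ q ∈ frobPow I q := Ideal.subset_span ⟨a, ha, rfl⟩
    refine Ideal.mem_of_dvd _ ?_ hmem
    have h1 := mul_pow_eq_aux h (q / n)
    have h2 : a ^ n ∣ u ^ (l * n) := by rw [pow_mul]; exact pow_dvd_pow_of_dvd hal n
    have h3 : a ^ (n * (q / n)) ∣ u ^ m * u ^ (n * (q / n)) := by
      rw [pow_mul u, h1, mul_pow, ← pow_mul]
      exact Dvd.intro_left (u ^ m * d ^ (q / n)) (by ring)
    have h4 : a ^ q ∣ a ^ (n + n * (q / n)) := by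
      apply pow_dvd_pow
      have := Nat.lt_mul_div_succ q hn
      rw [Nat.mul_succ] at this
      omega
    refine h4.trans ?_
    rw [pow_add]
    refine (mul_dvd_mul h2 h3).trans ?_
    rw [← pow_add, ← pow_add, ← pow_add]
    apply pow_dvd_pow
    have := Nat.mul_div_le q n
    omega

theorem final_B [IsNoetherianRing R] {I : Ideal R} (hI : PosHeight I) {s : ℝ} (hs : 0 ≤ s)
    {u X d : R} {m n B : ℕ} (hX : X ∈ I ^ B) (hn : 0 < n) (hB : s * n ≤ (B : ℝ))
    (h : u ^ m * u ^ n = u ^ m * (d * X)) : u ∈ ratS I s := by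
  refine avoid_fam _ _ fun P hP => ?_
  have hPp : P.IsPrime := hP.1.1
  by_cases huP : u ∈ P
  · obtain ⟨y, hy, j, hj⟩ := min_kill hP huP
    rw [Ideal.mem_bot] at hj
    obtain ⟨b, hbc, hbI⟩ := exists_pow_rcirc hI ⌈s * (j : ℝ)⌉₊
    refine ⟨y * b, fun hh => ?_, fun N => ?_⟩
    · rcases hPp.mem_or_mem hh with hh | hh
      · exact hy hh
      · exact hbc P hP hh
    · rcases le_or_gt j N with hje | hje
      · have : y * u ^ N = 0 := by
          rw [← Nat.add_sub_cancel' hje, pow_add, ← mul_assoc, hj, zero_mul]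
        rw [mul_right_comm, this, zero_mul]
        exact Ideal.zero_mem _
      · refine Ideal.mul_mem_right _ _ (Ideal.mul_mem_left _ _ ?_)
        refine Ideal.pow_le_pow_right (Nat.ceil_mono ?_) hbI
        exact mul_le_mul_of_nonneg_left (by exact_mod_cast hje.le) hs
  · obtain ⟨b, hbc, hbI⟩ := exists_pow_rcirc hI ⌈s * (n : ℝ)⌉₊
    refine ⟨u ^ m * b, fun hh => ?_, fun N => ?_⟩
    · rcases hPp.mem_or_mem hh with hh | hh
      · exact huP (hPp.mem_of_pow_mem _ hh)
      · exact hbc P hP hh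
    have h1 := mul_pow_eq_aux h (N / n)
    have h2 : X ^ (N / n) * b ∈ I ^ (B * (N / n) + ⌈s * (n : ℝ)⌉₊) := by
      rw [pow_add, pow_mul]
      exact Ideal.mul_mem_mul (Ideal.pow_mem_pow hX _) hbI
    have e1 : u ^ m * b * u ^ N = (X ^ (N / n) * b) * (u ^ m * d ^ (N / n) * u ^ (N % n)) := by
      have : u ^ N = (u ^ n) ^ (N / n) * u ^ (N % n) := by
        conv_lhs => rw [← Nat.div_add_mod N n, pow_add, pow_mul]
      rw [this]
      rw [mul_pow] at h1
      linear_combination b * u ^ (N % n) * h1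
    rw [e1]
    refine Ideal.mul_mem_right _ _ (Ideal.pow_le_pow_right ?_ h2)
    rw [Nat.ceil_le]
    push_cast
    have h3 : N ≤ n * (N / n) + n := by
      have := Nat.lt_mul_div_succ N hn
      rw [Nat.mul_succ] at this
      exact this.le
    have h4 : (N : ℝ) ≤ n * ((N / n : ℕ) : ℝ) + n := by exact_mod_cast h3
    have h5 := mul_le_mul_of_nonneg_left h4 hs
    have h6 := Nat.le_ceil (s * (n : ℝ))
    have h7 : s * n * ((N / n : ℕ) : ℝ) ≤ B * ((N / n : ℕ) : ℝ) :=
      mul_le_mul_of_nonneg_right hB (Nat.cast_nonneg _)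
    linarith

end closures

section graded
variable {R G : Type*} [AddCommMonoid G] [DecidableEq G] [CommRing R]
  (𝒜 : G → AddSubgroup R) [GradedRing 𝒜]

theorem exists_gens [IsNoetherianRing R] (I : Ideal R) (hI : I.IsHomogeneous 𝒜) :
    ∃ (n : ℕ) (a : Fin n → R), (∀ i, SetLike.IsHomogeneousElem 𝒜 (a i)) ∧
      I = Ideal.span (Set.range a) := by
  classical
  obtain ⟨F, hF⟩ := (isNoetherianRing_iff_ideal_fg R).1 inferInstance I
  let T : Finset R := F.biUnion fun f =>
    (DirectSum.decompose 𝒜 f).support.image fun g => (DirectSum.decompose 𝒜 f g : R)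
  refine ⟨T.card, fun i => (T.equivFin.symm i : R), fun i => ?_, ?_⟩
  · have := (T.equivFin.symm i).2
    simp only [T, Finset.mem_biUnion, Finset.mem_image] at this
    obtain ⟨f, _, g, _, h⟩ := this
    refine ⟨g, ?_⟩
    show (T.equivFin.symm i : R) ∈ 𝒜 g
    rw [← h]
    exact SetLike.coe_mem _
  · have hr : Set.range (fun i => (T.equivFin.symm i : R)) = (T : Set R) := by
      ext y
      constructor
      · rintro ⟨i, rfl⟩
        exact (T.equivFin.symm i).2
      · intro hy
        exact ⟨T.equivFin ⟨y, hy⟩, by simp⟩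
    rw [hr]
    apply le_antisymm
    · rw [← hF]
      refine Submodule.span_le.2 fun f hf => ?_
      have : f = ∑ g ∈ (DirectSum.decompose 𝒜 f).support, (DirectSum.decompose 𝒜 f g : R) :=
        (DirectSum.sum_support_decompose 𝒜 f).symm
      rw [SetLike.mem_coe, this]
      refine Ideal.sum_mem _ fun g hg => Ideal.subset_span ?_
      simp only [T, Finset.mem_coe, Finset.mem_biUnion, Finset.mem_image]
      exact ⟨f, hf, g, hg, rfl⟩
    · refine Ideal.span_le.2 fun y hy => ?_
      simp only [T, Finset.mem_coe, Finset.mem_biUnion, Finset.mem_image] at hy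
      obtain ⟨f, hf, g, _, rfl⟩ := hy
      exact hI g (hF ▸ Submodule.subset_span hf)

/-- elements that become homogeneous, up to a scalar, after a Frobenius power -/
def PH (p : ℕ) (g : G) (y : R) : Prop :=
  ∃ v ∈ 𝒜 g, ∃ l ∈ 𝒜 0, ∃ e : ℕ, y ^ p ^ e = l * v ^ p ^ e

theorem zero_pow_mem {l : R} (hl : l ∈ 𝒜 0) (n : ℕ) : l ^ n ∈ 𝒜 0 := by
  have := SetLike.pow_mem_graded n hl
  rwa [smul_zero] at this

theorem zero_mul_mem {l m : R} (hl : l ∈ 𝒜 0) (hm : m ∈ 𝒜 0) : l * m ∈ 𝒜 0 := by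
  have := SetLike.GradedMul.mul_mem hl hm
  rwa [zero_add] at this

theorem ph_up {p : ℕ} {y l v : R} {e N : ℕ} (h : y ^ p ^ e = l * v ^ p ^ e) (he : e ≤ N) :
    y ^ p ^ N = l ^ p ^ (N - e) * v ^ p ^ N := by
  obtain ⟨k, rfl⟩ := Nat.exists_eq_add_of_le he
  rw [Nat.add_sub_cancel_left, pow_add p, pow_mul, h, mul_pow, pow_mul]

theorem ph_merge (hk : OneDim 𝒜) (p : ℕ) (hp : p.Prime) (hcp : CharP R p) {i j : G} {x y : R}
    (hx : PH 𝒜 p i x) (hy : PH 𝒜 p j y) {e : ℕ} (he : p ^ e • i = p ^ e • j) :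
    PH 𝒜 p i (x + y) ∨ PH 𝒜 p j (x + y) := by
  have : Fact p.Prime := ⟨hp⟩
  obtain ⟨v, hv, l, hl, e1, h1⟩ := hx
  obtain ⟨w, hw, m, hm, e2, h2⟩ := hy
  have h1' := ph_up (N := e1 + e2 + e) h1 (by omega)
  have h2' := ph_up (N := e1 + e2 + e) h2 (by omega)
  set N := e1 + e2 + e with hN
  by_cases hz : v ^ p ^ N = 0
  · right
    refine ⟨w, hw, _, zero_pow_mem 𝒜 hm (p ^ (N - e2)), N, ?_⟩
    rw [add_pow_char_pow, h1', h2', hz, mul_zero, zero_add]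
  · left
    have hg : p ^ N • i = p ^ N • j := by
      rw [hN, pow_add, mul_smul, mul_smul, he]
    have hvN : v ^ p ^ N ∈ 𝒜 (p ^ N • i) := SetLike.pow_mem_graded _ hv
    have hwN : w ^ p ^ N ∈ 𝒜 (p ^ N • i) := by rw [hg]; exact SetLike.pow_mem_graded _ hw
    obtain ⟨r, hr, hrw⟩ := hk _ _ hvN hz _ hwN
    refine ⟨v, hv, _, add_mem (zero_pow_mem 𝒜 hl (p ^ (N - e1)))
      (zero_mul_mem 𝒜 (zero_pow_mem 𝒜 hm (p ^ (N - e2))) hr), N, ?_⟩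
    rw [add_pow_char_pow, h1', h2', hrw]
    ring

theorem sum_merge (S : Finset G) (x : G → R) {i j : G} (hi : i ∈ S) (hj : j ∈ S) (hij : i ≠ j) :
    ∑ g ∈ S.erase j, Function.update x i (x i + x j) g = ∑ g ∈ S, x g := by
  have hi' : i ∈ S.erase j := Finset.mem_erase.2 ⟨hij, hi⟩
  rw [← Finset.add_sum_erase _ _ hi', ← Finset.add_sum_erase _ _ hj,
    ← Finset.add_sum_erase _ _ hi', Function.update_self]
  rw [Finset.sum_congr rfl (g := x) (fun g hg => Function.update_of_ne (Finset.mem_erase.1 hg).1 _ _)]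
  ring

theorem main_ind [IsNoetherianRing R] (hk : OneDim 𝒜) (p : ℕ) (hp : p.Prime) (hcp : CharP R p)
    {ι : Type*} [Fintype ι] (a : ι → R) (ha : ∀ i, SetLike.IsHomogeneousElem 𝒜 (a i))
    (I : Ideal R) (hIa : I = Ideal.span (Set.range a)) (hI : PosHeight I)
    (s t ε : ℝ) (hs : 0 ≤ s) (ht0 : 0 ≤ t) (ht : s - ε < t) (hts : t ≤ s)
    (hε : ∀ P ∈ minimalPrimes R, ∀ u, SetLike.IsHomogeneousElem 𝒜 u → u ∉ P →
      (∃ n : ℕ, 0 < n ∧ ∃ (β : ι → ℕ) (d : R), SetLike.IsHomogeneousElem 𝒜 d ∧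
        u ^ n - d * ∏ i, a i ^ β i ∈ P ∧ (s - ε) * n < ((∑ i, β i : ℕ) : ℝ)) →
      (∃ n : ℕ, 0 < n ∧ ∃ (β : ι → ℕ) (d : R), SetLike.IsHomogeneousElem 𝒜 d ∧
        u ^ n - d * ∏ i, a i ^ β i ∈ P ∧ s * n ≤ ((∑ i, β i : ℕ) : ℝ)))
    (n : ℕ) : ∀ (S : Finset G) (x : G → R), S.card = n → (∀ g ∈ S, PH 𝒜 p g (x g)) →
      ∑ g ∈ S, x g ∈ weakCl p I t →
      ∃ y ∈ tightCl p I, ∃ z ∈ ratS I s, y + z = ∑ g ∈ S, x g := by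
  have : Fact p.Prime := ⟨hp⟩
  induction n with
  | zero =>
    intro S x hS _ _
    rw [Finset.card_eq_zero] at hS
    subst hS
    exact ⟨0, tight_zero p hp I, 0, ratS_zero s, by simp⟩
  | succ n ih =>
    intro S x hS hPH hw
    -- removing one term
    have hrem : ∀ i ∈ S, x i ∈ weakCl p I t →
        (x i ∈ tightCl p I ∨ x i ∈ ratS I s) →
        ∃ y ∈ tightCl p I, ∃ z ∈ ratS I s, y + z = ∑ g ∈ S, x g := by
      intro i hi hwi hor
      have hsum := Finset.add_sum_erase S x hi
      obtain ⟨y, hy, z, hz, hyz⟩ := ih (S.erase i) x (by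
        rw [Finset.card_erase_of_mem hi, hS]; rfl)
        (fun g hg => hPH g (Finset.mem_of_mem_erase hg)) (by
          have h1 := weak_add p hp hcp I t hw (weak_smul p I t (-1) hwi)
          rw [← hsum] at h1
          convert h1 using 1
          ring)
      rcases hor with h | h
      · exact ⟨x i + y, tight_add p hp hcp I h hy, z, hz, by rw [← hsum, ← hyz]; ring⟩
      · exact ⟨y, hy, x i + z, ratS_add I s h hz, by rw [← hsum, ← hyz]; ring⟩
    by_cases hm : ∃ i ∈ S, ∃ j ∈ S, i ≠ j ∧ ∃ e : ℕ, p ^ e • i = p ^ e • j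
    · obtain ⟨i, hi, j, hj, hij, e, he⟩ := hm
      have key : ∀ i ∈ S, ∀ j ∈ S, i ≠ j → PH 𝒜 p i (x i + x j) →
          ∃ y ∈ tightCl p I, ∃ z ∈ ratS I s, y + z = ∑ g ∈ S, x g := by
        intro i hi j hj hij h
        rw [← sum_merge S x hi hj hij]
        refine ih _ _ (by rw [Finset.card_erase_of_mem hj, hS]; rfl) (fun g hg => ?_)
          (by rw [sum_merge S x hi hj hij]; exact hw)
        by_cases hgi : g = i
        · subst hgi
          rwa [Function.update_self]
        · rw [Function.update_of_ne hgi]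
          exact hPH g (Finset.mem_of_mem_erase hg)
      rcases ph_merge 𝒜 hk p hp hcp (hPH i hi) (hPH j hj) he with h | h
      · exact key i hi j hj hij h
      · rw [add_comm] at h
        exact key j hj i hi hij.symm h
    push Not at hm
    by_cases hnil : ∃ i ∈ S, IsNilpotent (x i)
    · obtain ⟨i, hi, h⟩ := hnil
      have h' := tight_nil p hp I h
      exact hrem i hi (tight_sub_weak p I t h') (Or.inl h')
    push Not at hnil
    have hdata : ∀ g, ∃ v l : R, ∃ e : ℕ, g ∈ S →
        v ∈ 𝒜 g ∧ l ∈ 𝒜 0 ∧ (x g) ^ p ^ e = l * v ^ p ^ e := by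
      intro g
      by_cases hg : g ∈ S
      · obtain ⟨v, hv, l, hl, e, h⟩ := hPH g hg
        exact ⟨v, l, e, fun _ => ⟨hv, hl, h⟩⟩
      · exact ⟨0, 0, 0, fun h => (hg h).elim⟩
    choose v l e hd using hdata
    obtain ⟨C, hC, N, hCN⟩ := id hw
    have hesup : ∀ g ∈ S, e g ≤ S.sup e := fun g hg => Finset.le_sup hg
    have hvn : ∀ i ∈ S, ¬ IsNilpotent (v i) := by
      rintro i hi ⟨k, hk0⟩
      apply hnil i hi
      have h1 := (hd i hi).2.2
      refine ⟨p ^ e i * k, ?_⟩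
      rw [pow_mul, h1, mul_pow, ← pow_mul, mul_comm (p ^ e i), pow_mul, hk0,
        zero_pow (pow_pos hp.pos _).ne', mul_zero]
    obtain ⟨i, hi, Q, P, hQ, hP, hPQ, hvQ, c, hch, hcP, hcJ⟩ := core1 𝒜 hk p hp S
      (Finset.card_pos.1 (by omega)) v id (fun i hi => (hd i hi).1) hvn
      (fun i hi j hj hij k => hm i hi j hj hij k) (∑ g ∈ S, x g)
      (fun i k => l i ^ p ^ (k - e i)) (N + S.sup e)
      (fun i hi k hk' => by
        have h1 := hesup i hi
        refine ⟨zero_pow_mem 𝒜 (hd i hi).2.1 _, fun h0 => hnil i hi ⟨p ^ k, ?_⟩⟩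
        rw [ph_up (hd i hi).2.2 (show e i ≤ k by omega), h0, zero_mul])
      (fun k hk' => by
        rw [sum_pow_char_pow]
        refine Finset.sum_congr rfl fun i hi => ?_
        have h1 := hesup i hi
        exact ph_up (hd i hi).2.2 (by omega))
      C hC (fun k => Ideal.span (mixT a t (p ^ k)))
      (fun k => Ideal.homogeneous_span 𝒜 _ (mixT_hom 𝒜 a ha t (p ^ k)))
      (fun k hk' => by
        rw [← mixedPow_eq p hp hcp, ← hIa]
        exact hCN k (by omega))
    have hPp : P.IsPrime := hP.1.1
    have hhom : SetLike.IsHomogeneousElem 𝒜 (v i) := ⟨i, (hd i hi).1⟩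
    have haI : ∀ j, a j ∈ I := fun j => by rw [hIa]; exact Ideal.subset_span ⟨j, rfl⟩
    have hq : 0 < p ^ e i := pow_pos hp.pos _
    have hcase : x i ∈ tightCl p I ∨ x i ∈ ratS I s := by
      rcases core3 𝒜 hk p hp hcp a ha hPp hPQ hhom hch hcP hQ hvQ s t ε ht0 ht
        (hε P hP (v i) hhom (fun h => hvQ (hPQ h))) hcJ with
        ⟨j, l', m, n', d, hn, hal, h⟩ | ⟨m, n', β, d, hn, hB, h⟩
      · exact Or.inl (tight_transfer p I (hd i hi).2.2 (final_A p hp hI (haI j) hn hal h))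
      · refine Or.inr (ratS_transfer hI hs hq (hd i hi).2.2 (final_B hI hs ?_ hn hB h))
        rw [hIa]
        exact mono_mem a β
    refine hrem i hi ?_ hcase
    rcases hcase with h | h
    · exact tight_sub_weak p I t h
    · exact weak_anti p I hts (ratS_sub_weak p I s h)

theorem main_lemma [IsNoetherianRing R] (hk : OneDim 𝒜) (p : ℕ) (hp : p.Prime) (hcp : CharP R p)
    (I : Ideal R) (hIhom : I.IsHomogeneous 𝒜) (hI : PosHeight I) (s : ℝ) (hs : 0 < s) :
    ∃ ε : ℝ, 0 < ε ∧ ∀ t, s - ε < t → t ≤ s → ∀ x ∈ weakCl p I t,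
      ∃ y ∈ tightCl p I, ∃ z ∈ ratS I s, y + z = x := by
  classical
  obtain ⟨n, a, ha, hIa⟩ := exists_gens 𝒜 I hIhom
  have hfin := minimalPrimes.finite_of_isNoetherianRing R
  have hex : ∀ P : Ideal R, ∃ ε : ℝ, 0 < ε ∧ (P ∈ minimalPrimes R →
      ∀ u, SetLike.IsHomogeneousElem 𝒜 u → u ∉ P →
      (∃ n' : ℕ, 0 < n' ∧ ∃ (β : Fin n → ℕ) (d : R), SetLike.IsHomogeneousElem 𝒜 d ∧
        u ^ n' - d * ∏ i, a i ^ β i ∈ P ∧ (s - ε) * n' < ((∑ i, β i : ℕ) : ℝ)) →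
      (∃ n' : ℕ, 0 < n' ∧ ∃ (β : Fin n → ℕ) (d : R), SetLike.IsHomogeneousElem 𝒜 d ∧
        u ^ n' - d * ∏ i, a i ^ β i ∈ P ∧ s * n' ≤ ((∑ i, β i : ℕ) : ℝ))) := by
    intro P
    by_cases hP : P ∈ minimalPrimes R
    · have hPp : P.IsPrime := hP.1.1
      obtain ⟨ε, h0, h⟩ := lemER 𝒜 hk P a s
      exact ⟨ε, h0, fun _ => h⟩
    · exact ⟨1, one_pos, fun h => (hP h).elim⟩
  choose εP hεP hεP' using hex
  obtain ⟨ε, hε0, hεs, hεle⟩ : ∃ ε : ℝ, 0 < ε ∧ ε ≤ s ∧ ∀ P ∈ minimalPrimes R, ε ≤ εP P := by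
    have hne : (insert s (hfin.toFinset.image εP)).Nonempty := Finset.insert_nonempty _ _
    refine ⟨(insert s (hfin.toFinset.image εP)).min' hne, ?_, ?_, ?_⟩
    · rw [Finset.lt_min'_iff]
      intro y hy
      rcases Finset.mem_insert.1 hy with rfl | hy
      · exact hs
      · obtain ⟨P, _, rfl⟩ := Finset.mem_image.1 hy
        exact hεP P
    · exact Finset.min'_le _ _ (Finset.mem_insert_self _ _)
    · intro P hP
      refine Finset.min'_le _ _ (Finset.mem_insert_of_mem (Finset.mem_image.2 ⟨P, ?_, rfl⟩))
      simpa using hP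
  refine ⟨ε, hε0, fun t ht hts x hx => ?_⟩
  have hsum : x = ∑ g ∈ (DirectSum.decompose 𝒜 x).support, (DirectSum.decompose 𝒜 x g : R) :=
    (DirectSum.sum_support_decompose 𝒜 x).symm
  have := main_ind 𝒜 hk p hp hcp a ha I hIa hI s t ε hs.le (by linarith) ht hts
    (fun P hP u hu huP h => by
      refine hεP' P hP u hu huP ?_
      obtain ⟨n', hn', β, d, hd, h1, h2⟩ := h
      refine ⟨n', hn', β, d, hd, h1, lt_of_le_of_lt ?_ h2⟩
      refine mul_le_mul_of_nonneg_right ?_ (Nat.cast_nonneg _)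
      linarith [hεle P hP]) _ (DirectSum.decompose 𝒜 x).support
    (fun g => (DirectSum.decompose 𝒜 x g : R)) rfl
    (fun g _ => ⟨_, SetLike.coe_mem _, 1, SetLike.GradedOne.one_mem, 0, by rw [one_mul]⟩)
    (by rw [← hsum]; exact hx)
  rwa [← hsum] at this

end graded

/-- for a `G`-graded Noetherian ring in which every graded piece `R_g` has
length 1 as an `R_0`-module (i.e. `R_g ≠ 0` and the only `R_0`-stable additive subgroups of
`R_g` are `0` and `R_g`), and a homogeneous ideal `I` of positive height: for every
rational `s ≥ 1` the weak `s`-closure of `I` equals `I* + I_s`, and for every real `s > 1`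
the weak closure of `I` is left-stable at `s`. -/
theorem stmt17 {R : Type*} {G : Type*} [AddCommMonoid G] [DecidableEq G]
    [CommRing R] [IsNoetherianRing R]
    (p : ℕ) (hp : p.Prime) (hcp : CharP R p)
    (𝒜 : G → AddSubgroup R) [GradedRing 𝒜]
    (hlen : ∀ g : G, (𝒜 g : Set R) ≠ {0} ∧ ∀ M : AddSubgroup R,
      (M : Set R) ⊆ (𝒜 g : Set R) → (∀ a ∈ 𝒜 (0 : G), ∀ m ∈ M, a * m ∈ M) →
      (M : Set R) = {0} ∨ (M : Set R) = (𝒜 g : Set R))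
    (I : Ideal R) (hI : I.IsHomogeneous 𝒜) (hIh : PosHeight I) :
    (∀ s : ℚ, 1 ≤ s → weakCl p I ((s : ℝ)) = tightCl p I + ratPow I s) ∧
      (∀ s : ℝ, 1 < s →
        ∃ ε : ℝ, 0 < ε ∧ ∀ t : ℝ, s - ε < t → t < s → weakCl p I t = weakCl p I s) := by
  have hk := oneDim_of_len 𝒜 hlen
  constructor
  · intro s hs
    have hs' : (0 : ℝ) < s := by exact_mod_cast lt_of_lt_of_le one_pos hs
    obtain ⟨ε, hε, h⟩ := main_lemma 𝒜 hk p hp hcp I hI hIh s hs'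
    rw [← ratS_eq_ratPow hIh s (le_trans zero_le_one hs)]
    apply Set.Subset.antisymm
    · intro x hx
      obtain ⟨y, hy, z, hz, hyz⟩ := h s (by linarith) le_rfl x hx
      exact Set.mem_add.2 ⟨y, hy, z, hz, hyz⟩
    · intro x hx
      obtain ⟨y, hy, z, hz, rfl⟩ := Set.mem_add.1 hx
      exact weak_add p hp hcp I s (tight_sub_weak p I s hy) (ratS_sub_weak p I s hz)
  · intro s hs
    obtain ⟨ε, hε, h⟩ := main_lemma 𝒜 hk p hp hcp I hI hIh s (by linarith)
    refine ⟨ε, hε, fun t ht hts => Set.Subset.antisymm (fun x hx => ?_) (weak_anti p I hts.le)⟩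
    obtain ⟨y, hy, z, hz, rfl⟩ := h t ht hts.le x hx
    exact weak_add p hp hcp I s (tight_sub_weak p I s hy) (ratS_sub_weak p I s hz)
end
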